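/- arXiv:2603.18754 — 3 statements merged into one kernel-verified Lean document; each statement's English description precedes it below -/
import Mathlib

section
/- Let γ : ℝ → ℝ² be a continuous injective map such that ‖γ(t)‖ → ∞ as t → ±∞. Then ℝ² \ γ(ℝ) has exactly two connected components. -/
open Set Filter Topology Complex

lemma JL_const {X : Type*} [TopologicalSpace X] {s : Set X} (hs : IsPreconnected s)
    {h : X → ℂ} (hc : ContinuousOn h s) (he : ∀ x ∈ s, exp (h x) = 1) {x y : X}
    (hx : x ∈ s) (hy : y ∈ s) : h x = h y := by
  have := isCoveringMap_exp.eqOn_of_comp_eqOn hs hc (g₂ := fun _ => h y)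
    continuousOn_const (fun z hz => by
      simp only [Function.comp]
      exact Subtype.ext (by simp only [he z hz, he y hy])) hy rfl
  exact this hx

lemma JL_A1 (f : ℂ × ℝ → ℂ) (hf : ContinuousOn f {p | p.1 ≠ 0})
    (h0 : ∀ p : ℂ × ℝ, p.1 ≠ 0 → f p ≠ 0) :
    ∃ n : ℤ, ∃ g : ℂ × ℝ → ℂ, ContinuousOn g {p | p.1 ≠ 0} ∧
      ∀ p : ℂ × ℝ, p.1 ≠ 0 → f p = p.1 ^ n * exp (g p) := by
  have hsc : IsSimplyConnected (univ : Set (ℂ × ℝ)) := by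
    have : SimplyConnectedSpace (ℂ × ℝ) := inferInstance
    exact (Homeomorph.Set.univ (ℂ × ℝ)).toHomotopyEquiv.simplyConnectedSpace
  have hFc : Continuous (fun p : ℂ × ℝ => f (exp p.1, p.2)) := by
    rw [← continuousOn_univ]
    exact hf.comp (by fun_prop) (fun p _ => exp_ne_zero _)
  obtain ⟨h, hhc, hh⟩ := exists_continuousOn_eqOn_exp_comp hsc isOpen_univ hFc.continuousOn
    (by rintro ⟨p, -, hp⟩; exact h0 _ (exp_ne_zero _) hp)
  rw [continuousOn_univ] at hhc
  have hh' : ∀ w t, exp (h (w, t)) = f (exp w, t) := fun w t => hh (mem_univ (w, t))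
  have h1 : ∀ p : ℂ × ℝ, exp (h (p.1 + 2 * Real.pi * I, p.2) - h p) = 1 := by
    rintro ⟨w, t⟩
    rw [Complex.exp_sub, hh', hh', Complex.exp_add, exp_two_pi_mul_I, mul_one,
      div_self (h0 _ (exp_ne_zero _))]
  obtain ⟨n, hn⟩ := exp_eq_one_iff.1 (h1 (0, 0))
  have h2 : ∀ w t, h (w + 2 * Real.pi * I, t) = h (w, t) + n * (2 * Real.pi * I) := by
    intro w t
    have := JL_const (s := univ) (h := fun p : ℂ × ℝ => h (p.1 + 2 * Real.pi * I, p.2) - h p)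
      isPreconnected_univ
      (by fun_prop) (fun x _ => h1 x) (mem_univ (w, t)) (mem_univ (0, 0))
    rw [hn] at this
    simp only at this
    linear_combination this
  set k : ℂ × ℝ → ℂ := fun p => h p - n * p.1 with hk
  have hkc : Continuous k := by fun_prop
  have hk1 : ∀ w t, k (w + 2 * Real.pi * I, t) = k (w, t) := by
    intro w t; simp only [hk, h2]; ring
  have hk2 : ∀ (m : ℕ) w t, k (w + m * (2 * Real.pi * I), t) = k (w, t) := by
    intro m
    induction m with
    | zero => simp
    | succ m ih =>
      intro w t
      rw [← ih w t, ← hk1 (w + m * (2 * Real.pi * I))]; congr 2; push_cast; ring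
  have hk3 : ∀ (m : ℤ) w t, k (w + m * (2 * Real.pi * I), t) = k (w, t) := by
    intro m w t
    obtain ⟨j, rfl | rfl⟩ := m.eq_nat_or_neg
    · exact_mod_cast hk2 j w t
    · rw [← hk2 j]; congr 2; push_cast; ring
  have hk4 : ∀ w w' t, exp w = exp w' → k (w, t) = k (w', t) := by
    intro w w' t hw
    obtain ⟨m, hm⟩ := exp_eq_exp_iff_exists_int.1 hw
    rw [hm, hk3]
  refine ⟨n, fun p => k (log p.1, p.2), ?_, ?_⟩
  · rintro ⟨z₀, t₀⟩ hz
    simp only [mem_ofPred_eq] at hz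
    have hc : ContinuousAt (fun p : ℂ × ℝ => k (log (p.1 / z₀) + log z₀, p.2)) (z₀, t₀) := by
      refine ContinuousAt.comp (g := k) hkc.continuousAt ?_
      refine ContinuousAt.prodMk ?_ continuousAt_snd
      refine ContinuousAt.add ?_ continuousAt_const
      refine ContinuousAt.clog (by fun_prop) ?_
      simp [hz]
    refine hc.continuousWithinAt.congr ?_ ?_
    · rintro ⟨z, t⟩ hz'
      simp only [mem_ofPred_eq] at hz'
      apply hk4
      rw [Complex.exp_add, exp_log hz, exp_log hz', exp_log (div_ne_zero hz' hz)]
      field_simp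
    · simp [hz]
  · rintro ⟨z, t⟩ hz
    simp only at hz
    simp only [hk]
    rw [Complex.exp_sub, hh', exp_log hz, mul_comm (n : ℂ), ← cpow_def_of_ne_zero hz, cpow_intCast]
    field_simp

lemma JL_A2 (g : ℂ × ℝ → ℂ) (hg : ContinuousOn g {p | p.1 ≠ 0})
    (h : ∀ p : ℂ × ℝ, p.1 ≠ 0 → exp (g p) = p.1) : False := by
  have hc : Continuous (fun θ : ℝ => g (exp (θ * I), 0) - θ * I) := by
    refine Continuous.sub ?_ (by fun_prop)
    rw [← continuousOn_univ]
    exact hg.comp (by fun_prop) (fun p _ => exp_ne_zero _)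
  have := JL_const (s := univ) isPreconnected_univ hc.continuousOn (fun θ _ => by
    rw [Complex.exp_sub, h _ (exp_ne_zero _), div_self (exp_ne_zero _)])
    (mem_univ 0) (mem_univ (2 * Real.pi))
  push_cast at this
  rw [exp_two_pi_mul_I] at this
  simp only [zero_mul, Complex.exp_zero, sub_zero] at this
  exact two_pi_I_ne_zero (by linear_combination this)

/-- the complement of `F × 0`. -/
def JL_U (F : Set (ℝ × ℝ)) : Set ((ℝ × ℝ) × ℝ) := {p | ¬ (p.1 ∈ F ∧ p.2 = 0)}

/-- the cut-off function. -/
noncomputable def JL_chi (F : Set (ℝ × ℝ)) (p : (ℝ × ℝ) × ℝ) : ℝ :=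
  max 0 (min 1 ((1 - p.2 / Metric.infDist p.1 F) / 2))

open Classical in
/-- the map associated to a locally constant function -/
noncomputable def JL_f (F : Set (ℝ × ℝ)) (c : ℝ × ℝ → ℤ) (p : (ℝ × ℝ) × ℝ) : ℂ :=
  if p.1 ∈ F then 1 else exp (2 * Real.pi * I * (c p.1 * JL_chi F p))

lemma JL_pos {F : Set (ℝ × ℝ)} (hF : IsClosed F) (hne : F.Nonempty) {x : ℝ × ℝ} (hx : x ∉ F) :
    0 < Metric.infDist x F := (hF.notMem_iff_infDist_pos hne).1 hx

lemma JL_chi_hi {F : Set (ℝ × ℝ)} (hF : IsClosed F) (hne : F.Nonempty) {x : ℝ × ℝ} (hx : x ∉ F)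
    {t : ℝ} (ht : Metric.infDist x F ≤ t) : JL_chi F (x, t) = 0 := by
  have h := JL_pos hF hne hx
  have : 1 ≤ t / Metric.infDist x F := by rwa [le_div_iff₀ h, one_mul]
  apply max_eq_left
  apply min_le_of_right_le
  simp only
  linarith

lemma JL_chi_lo {F : Set (ℝ × ℝ)} (hF : IsClosed F) (hne : F.Nonempty) {x : ℝ × ℝ} (hx : x ∉ F)
    {t : ℝ} (ht : t ≤ - Metric.infDist x F) : JL_chi F (x, t) = 1 := by
  have h := JL_pos hF hne hx
  have : t / Metric.infDist x F ≤ -1 := by rw [div_le_iff₀ h]; linarith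
  have h2 : min 1 ((1 - t / Metric.infDist x F) / 2) = 1 := by
    apply min_eq_left; linarith
  simp [JL_chi, h2]

lemma JL_f_one {F : Set (ℝ × ℝ)} (hF : IsClosed F) (hne : F.Nonempty) (c : ℝ × ℝ → ℤ)
    {x : ℝ × ℝ} {t : ℝ} (ht : Metric.infDist x F ≤ |t|) : JL_f F c (x, t) = 1 := by
  unfold JL_f
  split_ifs with hx
  · rfl
  · simp only at hx
    rcases le_abs.1 ht with h | h
    · rw [JL_chi_hi hF hne hx h]; simp
    · rw [JL_chi_lo hF hne hx (by linarith)]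
      rw [exp_eq_one_iff]
      exact ⟨c x, by push_cast; ring⟩

lemma JL_f_ne {F : Set (ℝ × ℝ)} (c : ℝ × ℝ → ℤ) (p) : JL_f F c p ≠ 0 := by
  unfold JL_f
  split_ifs
  · simp
  · exact exp_ne_zero _

lemma JL_B1 {F : Set (ℝ × ℝ)} (hF : IsClosed F) (hne : F.Nonempty) (c : ℝ × ℝ → ℤ)
    (hc : ContinuousOn (fun x => (c x : ℂ)) Fᶜ) : ContinuousOn (JL_f F c) (JL_U F) := by
  rintro ⟨x, t⟩ hp
  apply ContinuousAt.continuousWithinAt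
  by_cases hx : x ∈ F
  · have ht : t ≠ 0 := fun h => hp ⟨hx, h⟩
    have hev : ∀ᶠ p : (ℝ × ℝ) × ℝ in 𝓝 (x, t), Metric.infDist p.1 F < |p.2| := by
      have h1 : Continuous (fun p : (ℝ × ℝ) × ℝ => Metric.infDist p.1 F) :=
        (Metric.continuous_infDist_pt F).comp continuous_fst
      have h2 : Continuous (fun p : (ℝ × ℝ) × ℝ => |p.2|) := by fun_prop
      apply (isOpen_lt h1 h2).mem_nhds
      simp [Metric.infDist_zero_of_mem hx, ht]
    have : JL_f F c =ᶠ[𝓝 (x, t)] fun _ => 1 := by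
      filter_upwards [hev] with p hp
      exact JL_f_one hF hne c hp.le
    exact continuousAt_const.congr this.symm
  · have hev : ∀ᶠ p : (ℝ × ℝ) × ℝ in 𝓝 (x, t), p.1 ∉ F :=
      (hF.isOpen_compl.preimage continuous_fst).mem_nhds hx
    have : JL_f F c =ᶠ[𝓝 (x, t)] fun p => exp (2 * Real.pi * I * (c p.1 * JL_chi F p)) := by
      filter_upwards [hev] with p hp
      simp [JL_f, hp]
    refine ContinuousAt.congr ?_ this.symm
    have h1 : ContinuousAt (fun p : (ℝ × ℝ) × ℝ => (c p.1 : ℂ)) (x, t) :=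
      ContinuousAt.comp (f := Prod.fst) (g := fun x => (c x : ℂ))
        (hc.continuousAt (hF.isOpen_compl.mem_nhds hx)) continuousAt_fst
    have h2 : ContinuousAt (JL_chi F) (x, t) := by
      have h3 : ContinuousAt (fun p : (ℝ × ℝ) × ℝ => Metric.infDist p.1 F) (x, t) :=
        ((Metric.continuous_infDist_pt F).comp continuous_fst).continuousAt
      have h4 := (JL_pos hF hne hx).ne'
      have h5 : ContinuousAt (fun p : (ℝ × ℝ) × ℝ => p.2 / Metric.infDist p.1 F) (x, t) :=
        continuousAt_snd.div h3 h4
      unfold JL_chi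
      exact continuousAt_const.max (continuousAt_const.min
        ((continuousAt_const.sub h5).div_const 2))
    have h6 : ContinuousAt (fun p => (JL_chi F p : ℂ)) (x, t) :=
      ContinuousAt.comp (g := ((↑) : ℝ → ℂ)) continuous_ofReal.continuousAt h2
    exact (continuousAt_const.mul (h1.mul h6)).cexp

lemma JL_B2 {F : Set (ℝ × ℝ)} (hF : IsClosed F) (hne : F.Nonempty) (c : ℝ × ℝ → ℤ)
    (g : (ℝ × ℝ) × ℝ → ℂ) (hg : ContinuousOn g (JL_U F))
    (h : ∀ p ∈ JL_U F, JL_f F c p = exp (g p)) {x y : ℝ × ℝ} (hx : x ∉ F) (hy : y ∉ F) :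
    c x = c y := by
  obtain ⟨T, hT0, hT⟩ : ∃ T : ℝ, 0 < T ∧ ∀ z ∈ segment ℝ x y, Metric.infDist z F ≤ T := by
    have hcomp : IsCompact (segment ℝ x y) := by
      rw [← convexHull_pair (𝕜 := ℝ) x y]; exact Set.Finite.isCompact_convexHull (𝕜 := ℝ) (Set.toFinite _)
    obtain ⟨T, hT⟩ := (hcomp.bddAbove_image (f := fun z => Metric.infDist z F)
      (Metric.continuous_infDist_pt F).continuousOn)
    exact ⟨max T 1, by positivity, fun z hz => le_max_of_le_left (hT ⟨z, hz, rfl⟩)⟩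
  have hcon : IsPreconnected (segment ℝ x y) := (convex_segment x y).isPreconnected
  -- horizontal moves
  have hor : ∀ t : ℝ, |t| = T → g (x, t) = g (y, t) := by
    intro t ht
    have ht0 : t ≠ 0 := by rintro rfl; simp at ht; linarith
    refine JL_const (h := fun z => g (z, t)) hcon ?_ ?_ (left_mem_segment ℝ x y)
      (right_mem_segment ℝ x y)
    · exact hg.comp (by fun_prop) (fun z _ hz => ht0 hz.2)
    · intro z hz
      rw [← h (z, t) (fun hz => ht0 hz.2)]
      exact JL_f_one hF hne c (by rw [ht]; exact hT z hz)
  -- vertical moves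
  have ver : ∀ z, z ∉ F → Metric.infDist z F ≤ T →
      g (z, T) = g (z, -T) - 2 * Real.pi * I * c z := by
    intro z hz hzT
    have := JL_const (h := fun t : ℝ => g (z, t) - 2 * Real.pi * I * (c z * JL_chi F (z, t)))
      (s := univ) isPreconnected_univ ?_ ?_ (mem_univ T) (mem_univ (-T))
    · simp only [JL_chi_hi hF hne hz hzT, JL_chi_lo hF hne hz (neg_le_neg hzT)] at this
      simpa using this
    · refine ContinuousOn.sub (hg.comp (by fun_prop) (fun t _ ht => hz ht.1)) ?_
      have : Continuous fun t => JL_chi F (z, t) := by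
        unfold JL_chi
        have h5 : Continuous fun t : ℝ => (1 - t / Metric.infDist z F) / 2 := by fun_prop
        exact continuous_const.max (continuous_const.min h5)
      have h6 : Continuous (fun t => (JL_chi F (z, t) : ℂ)) := continuous_ofReal.comp this
      exact (continuous_const.mul (continuous_const.mul h6)).continuousOn
    · intro t _
      rw [Complex.exp_sub, ← h (z, t) (fun ht => hz ht.1)]
      simp [JL_f, hz]
  have e1 := hor T (abs_of_pos hT0)
  have e2 := hor (-T) (by rw [abs_neg, abs_of_pos hT0])
  have e3 := ver x hx (hT _ (left_mem_segment ℝ x y))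
  have e4 := ver y hy (hT _ (right_mem_segment ℝ x y))
  have e5 : 2 * Real.pi * I * ((c x : ℂ) - c y) = 0 := by
    linear_combination e3 - e4 - e1 + e2
  have e6 := (mul_eq_zero.1 e5).resolve_left two_pi_I_ne_zero
  exact_mod_cast sub_eq_zero.1 e6

lemma JL_sc (F : Set (ℝ × ℝ)) (σ : ℝ) (hσ : σ ≠ 0) :
    IsSimplyConnected {p : (ℝ × ℝ) × ℝ | p.1 ∉ F ∨ 0 < σ * p.2} := by
  set S := {p : (ℝ × ℝ) × ℝ | p.1 ∉ F ∨ 0 < σ * p.2} with hS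
  have hσ2 : 0 < σ * σ := mul_self_pos.2 hσ
  let a : C(S, ℝ × ℝ) := ⟨fun p => p.1.1, by fun_prop⟩
  let b : C(ℝ × ℝ, S) := ⟨fun x => ⟨(x, σ), Or.inr hσ2⟩, by fun_prop⟩
  have hmem : ∀ q : unitInterval × S,
      ((q.2.1.1, (1 - (q.1 : ℝ)) * σ + q.1 * q.2.1.2) : (ℝ × ℝ) × ℝ) ∈ S := by
    rintro ⟨s, ⟨p, hp⟩⟩
    rcases hp with hp | hp
    · exact Or.inl hp
    · right
      have h0 := s.2.1
      have h1 := s.2.2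
      simp only
      have e : σ * ((1 - (s : ℝ)) * σ + s * p.2) = (1 - s) * (σ * σ) + s * (σ * p.2) := by ring
      rw [e]
      rcases h0.eq_or_lt with h | h
      · rw [← h]; simpa using hσ2
      · have := mul_pos h hp
        have := mul_nonneg (sub_nonneg.2 h1) hσ2.le
        linarith
  let H : ContinuousMap.Homotopy (b.comp a) (ContinuousMap.id S) :=
    { toFun := fun q => ⟨_, hmem q⟩
      continuous_toFun := by fun_prop
      map_zero_left := fun p => by
        apply Subtype.ext
        simp [a, b]
      map_one_left := fun p => by
        apply Subtype.ext
        simp }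
  let e : ContinuousMap.HomotopyEquiv S (ℝ × ℝ) := ⟨a, b, ⟨H⟩, by
    have : a.comp b = ContinuousMap.id _ := by ext <;> rfl
    rw [this]⟩
  have : SimplyConnectedSpace S := e.simplyConnectedSpace
  exact this

lemma JL_C {F : Set (ℝ × ℝ)} (hF : IsClosed F) (hV : IsPreconnected Fᶜ)
    (f : (ℝ × ℝ) × ℝ → ℂ) (hf : ContinuousOn f (JL_U F)) (h0 : ∀ p ∈ JL_U F, f p ≠ 0) :
    ∃ g : (ℝ × ℝ) × ℝ → ℂ, ContinuousOn g (JL_U F) ∧ ∀ p ∈ JL_U F, f p = exp (g p) := by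
  classical
  have key : ∀ σ : ℝ, σ ≠ 0 → ∃ S : Set ((ℝ × ℝ) × ℝ),
      S = {p : (ℝ × ℝ) × ℝ | p.1 ∉ F ∨ 0 < σ * p.2} ∧ IsOpen S ∧ 
      ∃ g : (ℝ × ℝ) × ℝ → ℂ, ContinuousOn g S ∧ ∀ p ∈ S, exp (g p) = f p := by
    intro σ hσ
    refine ⟨_, rfl, ?_, ?_⟩
    · exact (hF.isOpen_compl.preimage continuous_fst).union
        (isOpen_lt continuous_const (by fun_prop : Continuous fun p : (ℝ × ℝ) × ℝ => σ * p.2))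
    · have hsub : {p : (ℝ × ℝ) × ℝ | p.1 ∉ F ∨ 0 < σ * p.2} ⊆ JL_U F := by
        rintro p (hp | hp) ⟨h1, h2⟩
        · exact hp h1
        · simp [h2] at hp
      obtain ⟨g, hg, hg'⟩ := exists_continuousOn_eqOn_exp_comp (JL_sc F σ hσ)
        ((hF.isOpen_compl.preimage continuous_fst).union
        (isOpen_lt continuous_const (by fun_prop : Continuous fun p : (ℝ × ℝ) × ℝ => σ * p.2)))
        (hf.mono hsub) (by rintro ⟨p, hp, hp'⟩; exact h0 p (hsub hp) hp')
      exact ⟨g, hg, hg'⟩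
  obtain ⟨A, hA, hAo, a, hac, hae⟩ := key 1 one_ne_zero
  obtain ⟨B, hB, hBo, b, hbc, hbe⟩ := key (-1) (by norm_num)
  have hAB : ∀ p, p ∈ JL_U F → p ∈ A ∨ p ∈ B := by
    rintro p hp
    rw [hA, hB]
    simp only [mem_ofPred_eq]
    by_cases h : p.1 ∈ F
    · rcases lt_trichotomy p.2 0 with h2 | h2 | h2
      · right; right; linarith
      · exact absurd ⟨h, h2⟩ hp
      · left; right; linarith
    · exact Or.inl (Or.inl h)
  have hint : ∀ p, p ∈ A → p ∈ B → p.1 ∉ F := by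
    rw [hA, hB]
    rintro p (h | h) (h' | h')
    · exact h
    · exact h
    · exact h'
    · linarith
  have hVA : ∀ p : (ℝ × ℝ) × ℝ, p.1 ∉ F → p ∈ A := by
    intro p hp; rw [hA]; exact Or.inl hp
  have hVB : ∀ p : (ℝ × ℝ) × ℝ, p.1 ∉ F → p ∈ B := by
    intro p hp; rw [hB]; exact Or.inl hp
  obtain ⟨k, hk1, hk⟩ : ∃ k : ℂ, exp k = 1 ∧ ∀ p : (ℝ × ℝ) × ℝ, p.1 ∉ F → a p = b p + k := by
    rcases Fᶜ.eq_empty_or_nonempty with he | ⟨x₀, hx₀⟩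
    · refine ⟨0, by simp, fun p hp => ?_⟩
      exact absurd (show p.1 ∈ Fᶜ from hp) (by simp [he])
    · have hexp : ∀ p ∈ Fᶜ ×ˢ (univ : Set ℝ), exp (a p - b p) = 1 := by
        rintro p ⟨hp, -⟩
        have hne : exp (b p) ≠ 0 := exp_ne_zero _
        rw [Complex.exp_sub, hae p (hVA p hp), ← hbe p (hVB p hp), div_self hne]
      refine ⟨a (x₀, 0) - b (x₀, 0), hexp _ ⟨hx₀, mem_univ _⟩, fun p hp => ?_⟩
      have := JL_const (h := fun p => a p - b p) (hV.prod isPreconnected_univ)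
        ((hac.mono fun p hp => hVA p hp.1).sub (hbc.mono fun p hp => hVB p hp.1)) hexp
        (show p ∈ Fᶜ ×ˢ (univ : Set ℝ) from ⟨hp, mem_univ _⟩)
        (show (x₀, 0) ∈ Fᶜ ×ˢ (univ : Set ℝ) from ⟨hx₀, mem_univ _⟩)
      linear_combination this
  have gB : ∀ p ∈ B, (if p ∈ A then a p else b p + k) = b p + k := by
    intro p hp
    split_ifs with h
    · exact hk p (hint p h hp)
    · rfl
  refine ⟨fun p => if p ∈ A then a p else b p + k, ?_, ?_⟩
  · intro p hp
    apply ContinuousAt.continuousWithinAt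
    rcases hAB p hp with h | h
    · refine (hac.continuousAt (hAo.mem_nhds h)).congr ?_
      filter_upwards [hAo.mem_nhds h] with q hq
      simp [hq]
    · refine ((hbc.continuousAt (hBo.mem_nhds h)).add (continuousAt_const (y := k))).congr ?_
      filter_upwards [hBo.mem_nhds h] with q hq
      exact (gB q hq).symm
  · intro p hp
    rcases hAB p hp with h | h
    · simp [h, hae]
    · change f p = exp (if p ∈ A then a p else b p + k)
      rw [gB p h, Complex.exp_add, hk1, hbe p h, mul_one]

/-- Klee's trick. -/
lemma JL_D (γ : ℝ → ℝ × ℝ) (hγ : IsClosedEmbedding γ) :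
    ∃ ζ : (ℝ × ℝ) × ℝ → ℂ, Continuous ζ ∧ (∀ p ∈ JL_U (range γ), ζ p ≠ 0) ∧
      (∀ f : (ℝ × ℝ) × ℝ → ℂ, ContinuousOn f (JL_U (range γ)) →
        (∀ p ∈ JL_U (range γ), f p ≠ 0) →
        ∃ n : ℤ, ∃ g : (ℝ × ℝ) × ℝ → ℂ, ContinuousOn g (JL_U (range γ)) ∧
          ∀ p ∈ JL_U (range γ), f p = ζ p ^ n * exp (g p)) ∧
      ¬ ∃ g : (ℝ × ℝ) × ℝ → ℂ, ContinuousOn g (JL_U (range γ)) ∧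
          ∀ p ∈ JL_U (range γ), ζ p = exp (g p) := by
  obtain ⟨τ, hτ⟩ := ContinuousMap.exists_extension hγ (ContinuousMap.id ℝ)
  have hτ' : ∀ s, τ (γ s) = s := fun s => congrArg (fun f => f s) hτ
  have hγc := hγ.continuous
  let Q := Complex.equivRealProdCLM
  let Φ : (ℝ × ℝ) × ℝ → ℂ × ℝ := fun p => (Q.symm (p.1 - γ (p.2 + τ p.1)), p.2 + τ p.1)
  let Ψ : ℂ × ℝ → (ℝ × ℝ) × ℝ := fun q => (Q q.1 + γ q.2, q.2 - τ (Q q.1 + γ q.2))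
  have hΦ : Continuous Φ := by fun_prop
  have hΨ : Continuous Ψ := by fun_prop
  have hΨΦ : ∀ p, Ψ (Φ p) = p := by intro p; simp [Ψ, Φ]
  have hΦΨ : ∀ p, Φ (Ψ p) = p := by intro p; simp [Ψ, Φ]
  have hΦU : ∀ p ∈ JL_U (range γ), (Φ p).1 ≠ 0 := by
    intro p hp h
    apply hp
    have h1 : p.1 = γ (p.2 + τ p.1) := by
      simpa [Φ, sub_eq_zero] using h
    refine ⟨⟨_, h1.symm⟩, ?_⟩
    have h2 := hτ' (p.2 + τ p.1)
    rw [← h1] at h2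
    linarith
  have hΨU : ∀ q : ℂ × ℝ, q.1 ≠ 0 → Ψ q ∈ JL_U (range γ) := by
    rintro ⟨z, t⟩ hz ⟨⟨s, hs⟩, h2⟩
    apply hz
    simp only [Ψ] at hs h2
    rw [← hs, hτ'] at h2
    have : s = t := by linarith
    subst this
    simpa using hs
  refine ⟨fun p => (Φ p).1, by fun_prop, hΦU, ?_, ?_⟩
  · intro f hf h0
    obtain ⟨n, g, hg, hfg⟩ := JL_A1 (f ∘ Ψ) (hf.comp hΨ.continuousOn hΨU)
      (fun q hq => h0 _ (hΨU q hq))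
    refine ⟨n, g ∘ Φ, hg.comp hΦ.continuousOn hΦU, fun p hp => ?_⟩
    have := hfg (Φ p) (hΦU p hp)
    simpa only [Function.comp, hΨΦ] using this
  · rintro ⟨g, hg, h⟩
    refine JL_A2 (g ∘ Ψ) (hg.comp hΨ.continuousOn hΨU) fun q hq => ?_
    have := h _ (hΨU q hq)
    simp only [hΦΨ] at this
    exact this.symm

lemma JL_f_mul {F : Set (ℝ × ℝ)} (c d : ℝ × ℝ → ℤ) (m n : ℤ) (p) :
    JL_f F (fun x => m * c x + n * d x) p = JL_f F c p ^ m * JL_f F d p ^ n := by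
  unfold JL_f
  split_ifs
  · simp
  · rw [← Complex.exp_int_mul, ← Complex.exp_int_mul, ← Complex.exp_add]
    congr 1; push_cast; ring

open Classical in
/-- indicator of a component -/
noncomputable def JL_ind (V : Set (ℝ × ℝ)) (x z : ℝ × ℝ) : ℤ :=
  if z ∈ connectedComponentIn V x then 1 else 0

lemma JL_ind_cont {V : Set (ℝ × ℝ)} (hV : IsOpen V) (x : ℝ × ℝ) :
    ContinuousOn (fun z => (JL_ind V x z : ℂ)) V := by
  intro z hz
  apply ContinuousAt.continuousWithinAt
  have ho : IsOpen (connectedComponentIn V z) := hV.connectedComponentIn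
  have : (fun z => (JL_ind V x z : ℂ)) =ᶠ[𝓝 z] fun _ => (JL_ind V x z : ℂ) := by
    filter_upwards [ho.mem_nhds (mem_connectedComponentIn hz)] with y hy
    have h1 := connectedComponentIn_eq hy
    have h2 : y ∈ connectedComponentIn V x ↔ z ∈ connectedComponentIn V x := by
      constructor
      · intro h
        rw [connectedComponentIn_eq h, ← h1]; exact mem_connectedComponentIn hz
      · intro h
        rw [connectedComponentIn_eq h]; exact hy
    by_cases h3 : z ∈ connectedComponentIn V x
    · simp [JL_ind, h3, h2.2 h3]
    · simp [JL_ind, h3, mt h2.1 h3]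
  exact continuousAt_const.congr this.symm

lemma JL_ind_ne {V : Set (ℝ × ℝ)} {x z : ℝ × ℝ} (hz : z ∈ V)
    (h : connectedComponentIn V x ≠ connectedComponentIn V z) : JL_ind V x z = 0 := by
  unfold JL_ind
  rw [if_neg]
  intro h'
  exact h (connectedComponentIn_eq h')

lemma JL_ind_self {V : Set (ℝ × ℝ)} {x : ℝ × ℝ} (hx : x ∈ V) : JL_ind V x x = 1 := by
  simp [JL_ind, mem_connectedComponentIn hx]

/-- Unbounded Jordan curve theorem: a proper injective continuous curve
`ℝ → ℝ²` separates the plane into exactly two connected components. -/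
theorem stmt6 (γ : ℝ → ℝ × ℝ) (hcont : Continuous γ) (hinj : Function.Injective γ)
    (htop : Filter.Tendsto (fun t => ‖γ t‖) Filter.atTop Filter.atTop)
    (hbot : Filter.Tendsto (fun t => ‖γ t‖) Filter.atBot Filter.atTop) :
    {C : Set (ℝ × ℝ) | ∃ x ∈ (Set.range γ)ᶜ,
      C = connectedComponentIn (Set.range γ)ᶜ x}.ncard = 2 := by
  have hγ : IsClosedEmbedding γ := by
    refine IsClosedEmbedding.of_continuous_injective_isClosedMap hcont hinj ?_
    have hp : IsProperMap γ := by
      rw [isProperMap_iff_tendsto_cocompact]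
      refine ⟨hcont, ?_⟩
      rw [← Metric.cobounded_eq_cocompact, ← Metric.cobounded_eq_cocompact,
        ← tendsto_norm_atTop_iff_cobounded, Metric.cobounded_eq_cocompact,
        cocompact_eq_atBot_atTop]
      exact hbot.sup htop
    exact hp.isClosedMap
  obtain ⟨ζ, hζc, hζ0, hζ, hζn⟩ := JL_D γ hγ
  set F := range γ with hFdef
  have hF : IsClosed F := hγ.isClosed_range
  have hne : F.Nonempty := range_nonempty γ
  have hVo : IsOpen Fᶜ := hF.isOpen_compl
  have hnp : ¬ IsPreconnected Fᶜ := fun h => hζn (JL_C hF h ζ hζc.continuousOn hζ0)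
  obtain ⟨x, hx, y, hy, hxy⟩ : ∃ x ∈ Fᶜ, ∃ y ∈ Fᶜ,
      connectedComponentIn Fᶜ x ≠ connectedComponentIn Fᶜ y := by
    by_contra! hcon
    apply hnp
    rcases Fᶜ.eq_empty_or_nonempty with he | ⟨x, hx⟩
    · rw [he]; exact isPreconnected_empty
    · have : Fᶜ = connectedComponentIn Fᶜ x := by
        apply Subset.antisymm _ (connectedComponentIn_subset _ _)
        intro y hy
        rw [hcon x hx y hy]
        exact mem_connectedComponentIn hy
      rw [this]
      exact isPreconnected_connectedComponentIn
  have hle : ∀ z ∈ Fᶜ, connectedComponentIn Fᶜ z = connectedComponentIn Fᶜ x ∨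
      connectedComponentIn Fᶜ z = connectedComponentIn Fᶜ y := by
    intro z hz
    by_contra! hcon
    obtain ⟨hzx, hzy⟩ := hcon
    obtain ⟨m, g, hg, hfg⟩ := hζ (JL_f F (JL_ind Fᶜ x))
      (JL_B1 hF hne _ (JL_ind_cont hVo x)) (fun p _ => JL_f_ne _ p)
    obtain ⟨n, k, hk, hfk⟩ := hζ (JL_f F (JL_ind Fᶜ y))
      (JL_B1 hF hne _ (JL_ind_cont hVo y)) (fun p _ => JL_f_ne _ p)
    have hcst := fun {u v : ℝ × ℝ} => JL_B2 hF hne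
      (fun u => n * JL_ind Fᶜ x u + (-m) * JL_ind Fᶜ y u) (fun p => n * g p + (-m : ℤ) * k p)
      (by fun_prop) (fun p hp => by
        rw [JL_f_mul, hfg p hp, hfk p hp, Complex.exp_add, Complex.exp_int_mul,
          Complex.exp_int_mul, mul_zpow, mul_zpow, ← zpow_mul, ← zpow_mul]
        have : ζ p ^ (m * n) * ζ p ^ (n * -m) = 1 := by
          rw [← zpow_add₀ (hζ0 p hp)]; ring_nf; simp
        linear_combination (exp (g p) ^ n * exp (k p) ^ (-m)) * this) (x := u) (y := v)
    have h1 := hcst hx hz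
    simp only [JL_ind_self hx, JL_ind_ne hz hzx.symm, JL_ind_ne hz hzy.symm,
      JL_ind_ne hx hxy.symm] at h1
    have hn : n = 0 := by linarith
    have h2 := hcst hy hz
    have hm : m = 0 := by
      simp only [JL_ind_self hy, JL_ind_ne hz hzx.symm, JL_ind_ne hz hzy.symm,
        JL_ind_ne hy hxy] at h2
      linarith
    subst hm
    have h3 := JL_B2 hF hne _ g hg (fun p hp => by simpa using hfg p hp) hx hz
    rw [JL_ind_self hx, JL_ind_ne hz hzx.symm] at h3
    exact one_ne_zero h3
  rw [ncard_eq_two]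
  refine ⟨_, _, hxy, ?_⟩
  ext C
  constructor
  · rintro ⟨z, hz, rfl⟩
    exact hle z hz
  · rintro (rfl | rfl)
    · exact ⟨x, hx, rfl⟩
    · exact ⟨y, hy, rfl⟩
end

section
/- Let S = (s₀, s₁, …, s_{n−1}) be a cyclic sequence over a color set {1,…,d} with d ≥ 2, let nᵢ be the number of occurrences of color i in S, and let k ∈ ℤ^d be such that k = λ·(n₁,…,n_d) for some λ ∈ [0,1] (so k lies on the segment from the origin to the color-count vector of S). Then there is a subset S' of positions {0,…,n−1} that is a union of at most d − 1 cyclic intervals and contains exactly kᵢ occurrences of color i for every i = 1, …, d. -/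
namespace S9

/-- dominance (Scarf) -/
def Dom {T I : Type*} (v : I → T → ℕ) (σ : Finset T) (C : Finset I) : Prop :=
  ∀ y : T, ∃ i ∈ C, ∀ x ∈ σ, v i y ≤ v i x

/-- incidence of a door with a room -/
def Inc {T I : Type*} [DecidableEq T] [DecidableEq I]
    (p r : Finset T × Finset I) : Prop :=
  (∃ x ∉ p.1, r = (insert x p.1, p.2)) ∨ (∃ i ∈ p.2, r = (p.1, p.2.erase i))

lemma door_two {T I : Type*} [Fintype T] [DecidableEq T] [DecidableEq I]
    (v : I → T → ℕ) (hv : ∀ i, Function.Injective (v i))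
    (τ : Finset T) (D : Finset I) (hτ : τ.Nonempty) (hcard : D.card = τ.card + 1)
    (hdom : Dom v τ D) :
    ∃ r s : Finset T × Finset I, r ≠ s ∧
      ∀ q, (Inc (τ, D) q ∧ Dom v q.1 q.2) ↔ (q = r ∨ q = s) := by
  have hm : ∀ i, ∃ m ∈ τ, ∀ x ∈ τ, v i m ≤ v i x := fun i => Finset.exists_min_image τ (v i) hτ
  choose m hmτ hmin using hm
  have hmeq : ∀ i, ∀ x ∈ τ, (∀ y ∈ τ, v i x ≤ v i y) → x = m i := by
    intro i x hx h
    exact hv i (le_antisymm (h _ (hmτ i)) (hmin i x hx))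
  -- pigeonhole
  obtain ⟨a, ha, b, hb, hab, hmab⟩ :=
    Finset.exists_ne_map_eq_of_card_lt_of_maps_to (s := D) (t := τ) (by omega)
      (fun i _ => hmτ i)
  have hsurj : ∀ x ∈ τ, ∃ i ∈ D, x = m i := by
    intro x hx
    obtain ⟨i, hi, h⟩ := hdom x
    exact ⟨i, hi, hmeq i x hx h⟩
  -- subset of D of size |τ| mapping onto τ misses a or b
  have hmiss : ∀ i ∈ D, (∀ x ∈ τ, ∃ j ∈ D.erase i, x = m j) → i = a ∨ i = b := by
    intro i hi h
    by_contra hne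
    push Not at hne
    have hsub : τ ⊆ ((D.erase i).erase a).image m := by
      intro x hx
      obtain ⟨j, hj, rfl⟩ := h x hx
      by_cases hja : j = a
      · subst hja
        refine Finset.mem_image.2 ⟨b, ?_, hmab.symm⟩
        simp [hb, hab.symm, hne.2.symm]
      · exact Finset.mem_image.2 ⟨j, Finset.mem_erase.2 ⟨hja, hj⟩, rfl⟩
    have h1 := Finset.card_le_card hsub
    have h2 := (Finset.card_image_le (s := (D.erase i).erase a) (f := m))
    rw [Finset.card_erase_of_mem (by simp [ha, hne.1.symm]), Finset.card_erase_of_mem hi] at h2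
    have : 0 < τ.card := hτ.card_pos
    omega
  -- for e = a or b the rest maps onto τ
  have honto : ∀ e, (e = a ∨ e = b) → ∀ x ∈ τ, ∃ j ∈ D.erase e, x = m j := by
    intro e he x hx
    obtain ⟨i, hi, rfl⟩ := hsurj x hx
    by_cases hie : i = e
    · rcases he with rfl | rfl
      · exact ⟨b, Finset.mem_erase.2 ⟨hab.symm, hb⟩, by rw [hie, hmab]⟩
      · exact ⟨a, Finset.mem_erase.2 ⟨hab, ha⟩, by rw [hie, hmab]⟩
    · exact ⟨i, Finset.mem_erase.2 ⟨hie, hi⟩, rfl⟩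
  -- type predicate
  let E : I → Finset T × Finset I → Prop := fun e r =>
    Dom v r.1 r.2 ∧ (r = (τ, D.erase e) ∨
      ∃ x ∉ τ, r = (insert x τ, D) ∧ ∀ j ∈ D.erase e, v j (m j) < v j x)
  have hex : ∀ e ∈ D, (e = a ∨ e = b) → ∃ r, ∀ q, E e q ↔ q = r := by
    intro e heD he
    classical
    let M : Finset T := Finset.univ.filter (fun y => ∀ j ∈ D.erase e, v j (m j) < v j y)
    have hMmem : ∀ y, y ∈ M ↔ ∀ j ∈ D.erase e, v j (m j) < v j y := by intro y; simp [M]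
    have hMτ : ∀ y ∈ M, y ∉ τ := by
      intro y hy hyτ
      obtain ⟨j, hj, rfl⟩ := honto e he y hyτ
      exact lt_irrefl _ ((hMmem _).1 hy j hj)
    rcases M.eq_empty_or_nonempty with hM | hM
    · refine ⟨(τ, D.erase e), fun q => ⟨?_, ?_⟩⟩
      · rintro ⟨-, h | ⟨x, -, -, hx⟩⟩
        · exact h
        · have := (hMmem x).2 hx
          simp [hM] at this
      · rintro rfl
        refine ⟨?_, Or.inl rfl⟩
        intro y
        have hy : y ∉ M := by simp [hM]
        rw [hMmem] at hy
        push Not at hy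
        obtain ⟨j, hj, hle⟩ := hy
        exact ⟨j, hj, fun x hx => hle.trans (hmin j x hx)⟩
    · obtain ⟨x, hxM, hxmax⟩ := Finset.exists_max_image M (v e) hM
      have hxM' := (hMmem x).1 hxM
      refine ⟨(insert x τ, D), fun q => ⟨?_, ?_⟩⟩
      · rintro ⟨hd, h | ⟨x', -, h, hx'⟩⟩
        · subst h
          obtain ⟨j, hj, hle⟩ := hd x
          exact absurd (hxM' j hj) (not_lt.2 (hle _ (hmτ j)))
        · subst h
          obtain ⟨i, hi, hle⟩ := hd x
          have hie : i = e := by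
            by_contra hne
            exact absurd (hxM' i (Finset.mem_erase.2 ⟨hne, hi⟩))
              (not_lt.2 (hle _ (Finset.mem_insert_of_mem (hmτ i))))
          subst hie
          have h1 := hle x' (Finset.mem_insert_self _ _)
          have h2 := hxmax x' ((hMmem x').2 hx')
          rw [hv i (le_antisymm h1 h2)]
      · rintro rfl
        refine ⟨?_, Or.inr ⟨x, hMτ x hxM, rfl, hxM'⟩⟩
        intro y
        by_cases hy : y ∈ M
        · obtain ⟨i, hi, hle⟩ := hdom y
          have hie : i = e := by
            by_contra hne
            exact absurd ((hMmem y).1 hy i (Finset.mem_erase.2 ⟨hne, hi⟩))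
              (not_lt.2 (hle _ (hmτ i)))
          subst hie
          refine ⟨i, hi, fun z hz => ?_⟩
          rcases Finset.mem_insert.1 hz with rfl | hz
          · exact hxmax y hy
          · exact hle z hz
        · rw [hMmem] at hy
          push Not at hy
          obtain ⟨j, hj, hle⟩ := hy
          refine ⟨j, Finset.mem_of_mem_erase hj, fun z hz => ?_⟩
          rcases Finset.mem_insert.1 hz with rfl | hz
          · exact hle.trans (hxM' j hj).le
          · exact hle.trans (hmin j z hz)
  obtain ⟨ra, hra⟩ := hex a ha (Or.inl rfl)
  obtain ⟨rb, hrb⟩ := hex b hb (Or.inr rfl)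
  have hEinc : ∀ e ∈ D, ∀ q, E e q → (Inc (τ, D) q ∧ Dom v q.1 q.2) := by
    rintro e he q ⟨hd, h | ⟨x, hx, h, -⟩⟩
    · exact ⟨Or.inr ⟨e, he, h⟩, hd⟩
    · exact ⟨Or.inl ⟨x, hx, h⟩, hd⟩
  refine ⟨ra, rb, ?_, ?_⟩
  · intro hEq
    have h1 : E a ra := (hra _).2 rfl
    have h2 : E b ra := (hrb _).2 hEq
    obtain ⟨-, h1⟩ := h1
    obtain ⟨-, h2⟩ := h2
    rcases h1 with h1 | ⟨x, hx, h1, hx1⟩ <;> rcases h2 with h2 | ⟨y, hy, h2, hy1⟩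
    · rw [h1] at h2
      have h3 : D.erase a = D.erase b := (Prod.mk.inj h2).2
      have : b ∈ D.erase a := Finset.mem_erase.2 ⟨hab.symm, hb⟩
      rw [h3] at this
      simp at this
    · rw [h1] at h2
      have h3 : τ = insert y τ := (Prod.mk.inj h2).1
      exact hy (h3 ▸ Finset.mem_insert_self _ _)
    · rw [h1] at h2
      have h3 : insert x τ = τ := (Prod.mk.inj h2).1
      exact hx (h3 ▸ Finset.mem_insert_self _ _)
    · rw [h1] at h2
      have h3 : insert x τ = insert y τ := (Prod.mk.inj h2).1
      have hxy : x = y := by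
        have := h3 ▸ Finset.mem_insert_self x τ
        rcases Finset.mem_insert.1 this with h | h
        · exact h
        · exact absurd h hx
      subst hxy
      obtain ⟨i, hi, hle⟩ := hdom x
      have hlt : v i (m i) < v i x := by
        by_cases hia : i = a
        · exact hy1 i (Finset.mem_erase.2 ⟨by rw [hia]; exact hab, hi⟩)
        · exact hx1 i (Finset.mem_erase.2 ⟨hia, hi⟩)
      exact absurd hlt (not_lt.2 (hle _ (hmτ i)))
  · intro q
    constructor
    · rintro ⟨hinc, hd⟩
      have key : E a q ∨ E b q := by
        rcases hinc with ⟨x, hx, rfl⟩ | ⟨i, hi, rfl⟩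
        · simp only at hx hd
          obtain ⟨ix, hix, hlex⟩ := hd x
          -- good set
          have hgood : ∀ z ∈ τ, ∃ j ∈ D.erase ix, z = m j ∧ v j (m j) < v j x := by
            intro z hz
            obtain ⟨j, hj, hle⟩ := hd z
            have hzm : z = m j := hmeq j z hz (fun y hy => hle y (Finset.mem_insert_of_mem hy))
            have h1 : v j z ≤ v j x := hle x (Finset.mem_insert_self _ _)
            have hne : z ≠ x := fun h => hx (h ▸ hz)
            have h2 : v j z < v j x := lt_of_le_of_ne h1 (fun h => hne (hv j h))
            refine ⟨j, Finset.mem_erase.2 ⟨?_, hj⟩, hzm, hzm ▸ h2⟩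
            rintro rfl
            exact absurd h2 (not_lt.2 (hlex z (Finset.mem_insert_of_mem hz)))
          have hix2 : ix = a ∨ ix = b := hmiss ix hix (fun z hz => by
            obtain ⟨j, hj, h, -⟩ := hgood z hz; exact ⟨j, hj, h⟩)
          -- the good set is everything in D.erase ix
          classical
          have hall : ∀ j ∈ D.erase ix, v j (m j) < v j x := by
            let Gd := (D.erase ix).filter (fun j => v j (m j) < v j x)
            have hsub : τ ⊆ Gd.image m := by
              intro z hz
              obtain ⟨j, hj, h, h'⟩ := hgood z hz
              exact Finset.mem_image.2 ⟨j, Finset.mem_filter.2 ⟨hj, h'⟩, h.symm⟩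
            have h1 := (Finset.card_le_card hsub).trans Finset.card_image_le
            have h2 : (D.erase ix).card = τ.card := by
              rw [Finset.card_erase_of_mem hix]; omega
            have h3 : Gd = D.erase ix :=
              Finset.eq_of_subset_of_card_le (Finset.filter_subset _ _) (by omega)
            intro j hj
            rw [← h3] at hj
            exact (Finset.mem_filter.1 hj).2
          rcases hix2 with h | h
          · left; exact ⟨hd, Or.inr ⟨x, hx, rfl, h ▸ hall⟩⟩
          · right; exact ⟨hd, Or.inr ⟨x, hx, rfl, h ▸ hall⟩⟩
        · simp only at hi hd
          have h : i = a ∨ i = b := hmiss i hi (fun z hz => by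
            obtain ⟨j, hj, hle⟩ := hd z
            exact ⟨j, hj, hmeq j z hz hle⟩)
          rcases h with rfl | rfl
          · left; exact ⟨hd, Or.inl rfl⟩
          · right; exact ⟨hd, Or.inl rfl⟩
      rcases key with h | h
      · exact Or.inl ((hra q).1 h)
      · exact Or.inr ((hrb q).1 h)
    · rintro (h | h)
      · exact hEinc a ha q ((hra q).2 h)
      · exact hEinc b hb q ((hrb q).2 h)

lemma Dom.mono {T I : Type*} {v : I → T → ℕ} {σ τ : Finset T} {C D : Finset I}
    (h : Dom v σ C) (h1 : τ ⊆ σ) (h2 : C ⊆ D) : Dom v τ D := by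
  intro y
  obtain ⟨i, hi, h⟩ := h y
  exact ⟨i, h2 hi, fun x hx => h x (h1 hx)⟩

lemma room_even {T I : Type*} [Fintype T] [Fintype I] [DecidableEq T] [DecidableEq I]
    (v : I → T → ℕ) (c : T → I) (i0 : I) (σ : Finset T) (C : Finset I)
    (hno : σ.image c ≠ C) (hdom : Dom v σ C) (hcard : σ.card = C.card)
    (A : Finset (Finset T × Finset I))
    (hA : ∀ p, p ∈ A ↔ (Dom v p.1 p.2 ∧ i0 ∈ p.2 ∧ p.2.card = p.1.card + 1 ∧
      p.1.image c = p.2.erase i0) ∧ Inc p (σ, C)) : Even A.card := by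
  rcases A.eq_empty_or_nonempty with h0 | ⟨p, hp⟩
  · simp [h0]
  have key : ∃ x ∈ σ, i0 ∈ C ∧ (σ.erase x).image c = C.erase i0 := by
    rw [hA] at hp
    obtain ⟨⟨h1, h2, h3, h4⟩, hI⟩ := hp
    obtain ⟨τ, D⟩ := p
    simp only at h1 h2 h3 h4
    rcases hI with ⟨x, hx, hr⟩ | ⟨i, hi, hr⟩
    · simp only [Prod.mk.injEq] at hr hx
      obtain ⟨rfl, rfl⟩ := hr
      exact ⟨x, by simp, h2, by simpa [hx] using h4⟩
    · simp only [Prod.mk.injEq] at hr hi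
      obtain ⟨rfl, rfl⟩ := hr
      have hne : i ≠ i0 := by rintro rfl; exact hno h4
      have hinj : Set.InjOn c σ := by
        rw [← Finset.card_image_iff, h4, Finset.card_erase_of_mem h2]; omega
      have : i ∈ σ.image c := by rw [h4]; simp [hne, hi]
      obtain ⟨x, hx, rfl⟩ := Finset.mem_image.1 this
      refine ⟨x, hx, by simp [h2, hne.symm], ?_⟩
      rw [Finset.erase_right_comm, ← h4]
      ext z
      simp only [Finset.mem_image, Finset.mem_erase]
      constructor
      · rintro ⟨w, ⟨hw, hw'⟩, rfl⟩
        exact ⟨fun h => hw (hinj hw' hx h), w, hw', rfl⟩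
      · rintro ⟨hz, w, hw', rfl⟩
        exact ⟨w, ⟨fun h => hz (by rw [h]), hw'⟩, rfl⟩
  obtain ⟨x, hx, hi0, him⟩ := key
  have hcpos : 0 < C.card := Finset.card_pos.2 ⟨i0, hi0⟩
  have hcx : c x ≠ i0 := by
    intro h
    apply hno
    rw [← Finset.insert_erase hx, Finset.image_insert, him, h, Finset.insert_erase hi0]
  have hinc1 : ∀ z ∈ σ, Inc (σ.erase z, C) (σ, C) := fun z hz =>
    Or.inl ⟨z, by simp, by simp [Finset.insert_erase hz]⟩
  have hd1 : (σ.erase x, C) ∈ A := by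
    rw [hA]
    refine ⟨⟨hdom.mono (Finset.erase_subset _ _) le_rfl, hi0, ?_, him⟩, hinc1 x hx⟩
    simp only [Finset.card_erase_of_mem hx]; omega
  by_cases hcC : c x ∈ C
  · have : c x ∈ (σ.erase x).image c := by rw [him]; simp [hcx, hcC]
    obtain ⟨x', hx', hcc⟩ := Finset.mem_image.1 this
    rw [Finset.mem_erase] at hx'
    have him' : (σ.erase x').image c = C.erase i0 := by
      rw [← him]
      ext z
      simp only [Finset.mem_image, Finset.mem_erase]
      constructor
      · rintro ⟨w, ⟨hw, hw'⟩, rfl⟩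
        by_cases h : w = x
        · exact ⟨x', hx', by rw [hcc, h]⟩
        · exact ⟨w, ⟨h, hw'⟩, rfl⟩
      · rintro ⟨w, ⟨hw, hw'⟩, rfl⟩
        by_cases h : w = x'
        · exact ⟨x, ⟨hx'.1.symm, hx⟩, by rw [h, hcc]⟩
        · exact ⟨w, ⟨h, hw'⟩, rfl⟩
    have hAe : A = {(σ.erase x, C), (σ.erase x', C)} := by
      ext p
      simp only [Finset.mem_insert, Finset.mem_singleton]
      constructor
      · intro hp
        rw [hA] at hp
        obtain ⟨⟨h1, h2, h3, h4⟩, hI⟩ := hp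
        obtain ⟨τ, D⟩ := p
        simp only at h1 h2 h3 h4
        have hinj : Set.InjOn c τ := by
          rw [← Finset.card_image_iff, h4, Finset.card_erase_of_mem h2]; omega
        rcases hI with ⟨z, hz, hr⟩ | ⟨i, hi, hr⟩
        · simp only [Prod.mk.injEq] at hr hz
          obtain ⟨rfl, rfl⟩ := hr
          by_cases h : z = x
          · left; subst h; simp [hz]
          by_cases h' : z = x'
          · right; subst h'; simp [hz]
          exfalso
          have e1 : x ∈ τ := by simpa [Ne.symm h] using hx
          have e2 : x' ∈ τ := by simpa [Ne.symm h'] using hx'.2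
          exact hx'.1 (hinj e2 e1 hcc)
        · simp only [Prod.mk.injEq] at hr hi
          obtain ⟨rfl, rfl⟩ := hr
          exact absurd (hinj hx'.2 hx hcc) hx'.1
      · rintro (rfl | rfl)
        · exact hd1
        · rw [hA]
          refine ⟨⟨hdom.mono (Finset.erase_subset _ _) le_rfl, hi0, ?_, him'⟩, hinc1 x' hx'.2⟩
          simp only [Finset.card_erase_of_mem hx'.2]; omega
    rw [hAe, Finset.card_pair]
    · exact even_two
    · intro h
      simp only [Prod.mk.injEq, and_true] at h
      have : x ∈ σ.erase x' := by simp [hx, hx'.1.symm]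
      rw [← h] at this
      simp at this
  · have hAe : A = {(σ.erase x, C), (σ, insert (c x) C)} := by
      ext p
      simp only [Finset.mem_insert, Finset.mem_singleton]
      constructor
      · intro hp
        rw [hA] at hp
        obtain ⟨⟨h1, h2, h3, h4⟩, hI⟩ := hp
        obtain ⟨τ, D⟩ := p
        simp only at h1 h2 h3 h4
        rcases hI with ⟨z, hz, hr⟩ | ⟨i, hi, hr⟩
        · simp only [Prod.mk.injEq] at hr hz
          obtain ⟨rfl, rfl⟩ := hr
          by_cases h : z = x
          · left; subst h; simp [hz]
          exfalso
          have e1 : x ∈ τ := by simpa [Ne.symm h] using hx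
          have := Finset.mem_image_of_mem c e1
          rw [h4] at this
          exact hcC (Finset.mem_of_mem_erase this)
        · simp only [Prod.mk.injEq] at hr hi
          obtain ⟨rfl, rfl⟩ := hr
          right
          have := Finset.mem_image_of_mem c hx
          rw [h4] at this
          have h5 := Finset.mem_of_mem_erase this
          have h6 : c x = i := by
            by_contra h
            exact hcC (by simp [h, h5])
          rw [h6, Finset.insert_erase hi]
      · rintro (rfl | rfl)
        · exact hd1
        · rw [hA]
          refine ⟨⟨hdom.mono le_rfl (Finset.subset_insert _ _), ?_, ?_, ?_⟩, ?_⟩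
          · simp [hi0]
          · simp [Finset.card_insert_of_notMem hcC, hcard]
          · simp only
            rw [← Finset.insert_erase hx, Finset.image_insert, him,
              Finset.erase_insert_of_ne hcx]
          · exact Or.inr ⟨c x, by simp, by simp [hcC]⟩
    rw [hAe, Finset.card_pair]
    · exact even_two
    · intro h
      simp only [Prod.mk.injEq] at h
      rw [← h.1] at hx
      simp at hx

lemma scarf {T I : Type*} [Fintype T] [Nonempty T] [DecidableEq T] [Fintype I] [DecidableEq I]
    (v : I → T → ℕ) (hv : ∀ i, Function.Injective (v i)) (c : T → I) (i0 : I) :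
    ∃ σ : Finset T, Dom v σ (σ.image c) := by
  classical
  by_contra hno
  push Not at hno
  let doors : Finset (Finset T × Finset I) := Finset.univ.filter fun p =>
    Dom v p.1 p.2 ∧ i0 ∈ p.2 ∧ p.2.card = p.1.card + 1 ∧ p.1.image c = p.2.erase i0
  let rooms : Finset (Finset T × Finset I) := Finset.univ.filter fun p =>
    Dom v p.1 p.2 ∧ p.1.card = p.2.card
  have hdc := Finset.sum_card_bipartiteAbove_eq_sum_card_bipartiteBelow
    (s := doors) (t := rooms) (fun p r => Inc p r)
  have hR : Even (∑ b ∈ rooms, (Finset.bipartiteBelow (fun p r => Inc p r) doors b).card) := by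
    apply Finset.even_sum
    rintro ⟨σ, C⟩ hr
    simp only [rooms, Finset.mem_filter, Finset.mem_univ, true_and] at hr
    refine room_even v c i0 σ C ?_ hr.1 hr.2 _ ?_
    · rintro rfl; exact hno _ hr.1
    · intro p
      simp [Finset.bipartiteBelow, doors]
  have hcardInc : ∀ p q : Finset T × Finset I, p.2.card = p.1.card + 1 → Inc p q →
      q.1.card = q.2.card := by
    rintro ⟨τ, D⟩ q h (⟨x, hx, rfl⟩ | ⟨i, hi, rfl⟩)
    · simp only at h hx ⊢
      rw [Finset.card_insert_of_notMem hx, h]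
    · simp only at h hi ⊢
      rw [Finset.card_erase_of_mem hi, h]; simp
  obtain ⟨t0, -, ht0⟩ := Finset.exists_max_image (Finset.univ : Finset T) (v i0)
    Finset.univ_nonempty
  have hp0 : ((∅ : Finset T), ({i0} : Finset I)) ∈ doors := by
    simp only [doors, Finset.mem_filter, Finset.mem_univ, true_and]
    refine ⟨fun y => ⟨i0, by simp, by simp⟩, by simp, by simp, by simp⟩
  rw [← Finset.sum_erase_add _ _ hp0] at hdc
  have h1 : (Finset.bipartiteAbove (fun p r => Inc p r) rooms
      ((∅ : Finset T), ({i0} : Finset I))).card = 1 := by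
    rw [Finset.card_eq_one]
    refine ⟨({t0}, {i0}), ?_⟩
    ext q
    simp only [Finset.bipartiteAbove, Finset.mem_filter, Finset.mem_singleton, rooms,
      Finset.mem_univ, true_and]
    constructor
    · rintro ⟨⟨hq, -⟩, ⟨x, hx, rfl⟩ | ⟨i, hi, rfl⟩⟩
      · obtain ⟨i, hi, h⟩ := hq t0
        simp only [Finset.mem_singleton] at hi
        subst hi
        have := h x (by simp)
        have e := hv i (le_antisymm this (ht0 x (by simp)))
        simp [e]
      · simp only [Finset.mem_singleton] at hi
        subst hi
        obtain ⟨i, hi, h⟩ := hq t0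
        simp at hi
    · rintro rfl
      refine ⟨⟨fun y => ⟨i0, by simp, ?_⟩, by simp⟩, Or.inl ⟨t0, by simp, by simp⟩⟩
      intro x hx
      simp only [Finset.mem_singleton] at hx
      subst hx
      exact ht0 y (by simp)
  have h2 : Even (∑ a ∈ doors.erase ((∅ : Finset T), ({i0} : Finset I)),
      (Finset.bipartiteAbove (fun p r => Inc p r) rooms a).card) := by
    apply Finset.even_sum
    rintro ⟨τ, D⟩ hp
    simp only [doors, Finset.mem_erase, Finset.mem_filter, Finset.mem_univ, true_and] at hp
    obtain ⟨hne, hdom, hi0, hcard, him⟩ := hp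
    have hτ : τ.Nonempty := by
      rw [Finset.nonempty_iff_ne_empty]
      rintro rfl
      apply hne
      simp only [Finset.card_empty, zero_add] at hcard
      obtain ⟨a, rfl⟩ := Finset.card_eq_one.1 hcard
      simp only [Finset.mem_singleton] at hi0
      rw [hi0]
    obtain ⟨r, s, hrs, h⟩ := door_two v hv τ D hτ hcard hdom
    have : Finset.bipartiteAbove (fun p r => Inc p r) rooms (τ, D) = {r, s} := by
      ext q
      simp only [Finset.bipartiteAbove, Finset.mem_filter, Finset.mem_insert,
        Finset.mem_singleton, rooms, Finset.mem_univ, true_and]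
      rw [← h q]
      constructor
      · rintro ⟨⟨a, b⟩, c⟩; exact ⟨c, a⟩
      · rintro ⟨a, b⟩; exact ⟨⟨b, hcardInc _ _ hcard a⟩, a⟩
    rw [this, Finset.card_pair hrs]
    exact even_two
  rw [h1] at hdc
  rw [← hdc] at hR
  rw [Nat.even_add_one] at hR
  exact hR h2

end S9

namespace S9

lemma grid (n : ℕ) (hn : 0 < n) (c : (Fin n → ℝ) → Fin n → ℝ) (N : ℕ) (hN : 0 < N) :
    ∃ x ∈ stdSimplex ℝ (Fin n), ∀ i, x i ≤ n / N ∨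
      ∃ x' ∈ stdSimplex ℝ (Fin n), (∀ j, |x j - x' j| ≤ n / N) ∧ ∀ j, c x' j ≤ c x' i := by
  classical
  have : Nonempty (Fin n) := ⟨⟨0, hn⟩⟩
  let T := {x : Fin n → Fin (N + 1) // ∑ i, (x i : ℕ) = N}
  have mk : ∀ y : Fin n → ℕ, ∑ i, y i = N → ∃ t : T, ∀ i, ((t.1 i : Fin (N+1)) : ℕ) = y i := by
    intro y hy
    have hle : ∀ i, y i < N + 1 := by
      intro i
      have := Finset.single_le_sum (f := y) (fun i _ => Nat.zero_le _) (Finset.mem_univ i)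
      omega
    exact ⟨⟨fun i => ⟨y i, hle i⟩, hy⟩, fun i => rfl⟩
  have : Nonempty T := by
    obtain ⟨t, -⟩ := mk (fun i => if i = ⟨0, hn⟩ then N else 0) (by simp)
    exact ⟨t⟩
  let v : Fin n → T → ℕ := fun i x => (x.1 i : ℕ) * Fintype.card T + Fintype.equivFin T x
  have hv : ∀ i, Function.Injective (v i) := by
    intro i x y h
    have h' := congrArg (· % Fintype.card T) h
    simp only [v, Nat.mul_add_mod_self_right, Nat.mod_eq_of_lt (Fin.is_lt _)] at h'
    exact (Fintype.equivFin T).injective (Fin.ext h')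
  have hvle : ∀ i x y, v i y ≤ v i x → (y.1 i : ℕ) ≤ x.1 i := by
    intro i x y h
    by_contra hlt
    push Not at hlt
    have h1 := Nat.mul_le_mul_right (Fintype.card T) (Nat.succ_le_of_lt hlt)
    have h2 := (Fintype.equivFin T x).is_lt
    simp only [v] at h
    rw [Nat.succ_mul] at h1
    omega
  let pt : T → Fin n → ℝ := fun t i => (t.1 i : ℕ) / (N : ℝ)
  have hN' : (0 : ℝ) < N := by exact_mod_cast hN
  have hpt : ∀ t, pt t ∈ stdSimplex ℝ (Fin n) := by
    intro t
    refine ⟨fun i => by positivity, ?_⟩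
    simp only [pt]
    rw [← Finset.sum_div, div_eq_one_iff_eq hN'.ne']
    exact_mod_cast t.2
  have hcol : ∀ t : T, ∃ i, ∀ j, c (pt t) j ≤ c (pt t) i := fun t => Finite.exists_max _
  choose col hcol using hcol
  obtain ⟨σ, hσ⟩ := scarf v hv col ⟨0, hn⟩
  have hne : σ.Nonempty := by
    obtain ⟨i, hi, -⟩ := hσ (Classical.arbitrary T)
    exact (Finset.image_nonempty).1 ⟨i, hi⟩
  have hm : ∀ i, ∃ x ∈ σ, ∀ y ∈ σ, (x.1 i : ℕ) ≤ y.1 i := fun i =>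
    Finset.exists_min_image σ (fun x => (x.1 i : ℕ)) hne
  choose m hmσ hmin using hm
  set C := σ.image col with hC
  let M : Fin n → ℕ := fun i => if i ∈ C then ((m i).1 i : ℕ) else 0
  have hsum : N < ∑ i, M i + n := by
    by_contra hle
    push Not at hle
    obtain ⟨i0, hi0⟩ : C.Nonempty := by simpa [hC] using hne
    obtain ⟨y, hy⟩ := mk (fun i => M i + 1 + if i = i0 then N - (∑ i, M i + n) else 0) (by
      simp [Finset.sum_add_distrib]; omega)
    obtain ⟨i, hi, h⟩ := hσ y
    have := hvle _ _ _ (h (m i) (hmσ i))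
    rw [hy] at this
    simp only [M, if_pos hi] at this
    omega
  have hMle : ∀ x ∈ σ, ∀ i, M i ≤ x.1 i := by
    intro x hx i
    simp only [M]
    split_ifs
    · exact hmin i x hx
    · exact Nat.zero_le _
  have hub : ∀ x ∈ σ, ∀ i, (x.1 i : ℕ) ≤ M i + n := by
    intro x hx i
    have h1 := x.2
    have h2 : ∑ j ∈ Finset.univ.erase i, M j ≤ ∑ j ∈ Finset.univ.erase i, (x.1 j : ℕ) :=
      Finset.sum_le_sum fun j _ => hMle x hx j
    rw [← Finset.sum_erase_add _ _ (Finset.mem_univ i)] at h1 hsum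
    omega
  obtain ⟨x0, hx0⟩ := hne
  refine ⟨pt x0, hpt x0, fun i => ?_⟩
  by_cases hi : i ∈ C
  · right
    obtain ⟨x', hx', rfl⟩ := Finset.mem_image.1 hi
    refine ⟨pt x', hpt x', fun j => ?_, hcol x'⟩
    simp only [pt]
    rw [← sub_div, abs_div, abs_of_pos hN']
    gcongr
    have a1 := hub x0 hx0 j
    have a2 := hub x' hx' j
    have a3 := hMle x0 hx0 j
    have a4 := hMle x' hx' j
    have b1 : ((x0.1 j : ℕ) : ℝ) ≤ M j + n := by exact_mod_cast a1
    have b2 : ((x'.1 j : ℕ) : ℝ) ≤ M j + n := by exact_mod_cast a2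
    have b3 : (M j : ℝ) ≤ ((x0.1 j : ℕ) : ℝ) := by exact_mod_cast a3
    have b4 : (M j : ℝ) ≤ ((x'.1 j : ℕ) : ℝ) := by exact_mod_cast a4
    rw [abs_le]; constructor <;> linarith
  · left
    simp only [pt]
    gcongr
    have := hub x0 hx0 i
    simpa [M, hi] using this

open Filter Topology in
lemma lemmaS (n : ℕ) (hn : 0 < n) (c : (Fin n → ℝ) → Fin n → ℝ)
    (hc : ContinuousOn c (stdSimplex ℝ (Fin n))) :
    ∃ x ∈ stdSimplex ℝ (Fin n), ∀ i, x i = 0 ∨ ∀ j, c x j ≤ c x i := by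
  have h := fun N : ℕ => grid n hn c (N + 1) (Nat.succ_pos N)
  choose x hx h using h
  obtain ⟨a, ha, φ, hφ, hlim⟩ := (isCompact_stdSimplex ℝ (Fin n)).tendsto_subseq hx
  refine ⟨a, ha, fun i => ?_⟩
  by_contra hcon
  push Not at hcon
  obtain ⟨hai, j, hj⟩ := hcon
  have hapos : 0 < a i := lt_of_le_of_ne (ha.1 i) (Ne.symm hai)
  have hsmall : Tendsto (fun k : ℕ => (n : ℝ) / ((φ k + 1 : ℕ) : ℝ)) atTop (𝓝 0) := by
    have h1 : Tendsto (fun k : ℕ => (n : ℝ) / ((k + 1 : ℕ) : ℝ)) atTop (𝓝 0) := by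
      have := (tendsto_const_div_atTop_nhds_zero_nat (n : ℝ))
      exact this.comp (tendsto_add_atTop_nat 1)
    exact h1.comp hφ.tendsto_atTop
  have hev : ∀ᶠ k in atTop, (n : ℝ) / ((φ k + 1 : ℕ) : ℝ) < x (φ k) i := by
    have h2 : Tendsto (fun k => x (φ k) i) atTop (𝓝 (a i)) :=
      (tendsto_pi_nhds.1 hlim) i
    exact hsmall.eventually_lt h2 hapos
  have hex : ∀ k, ∃ x' ∈ stdSimplex ℝ (Fin n), (∀ l, |x (φ k) l - x' l| ≤ (n : ℝ) / ((φ k + 1 : ℕ) : ℝ))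
      ∧ ((n : ℝ) / ((φ k + 1 : ℕ) : ℝ) < x (φ k) i → c x' j ≤ c x' i) := by
    intro k
    rcases h (φ k) i with h | ⟨x', h1, h2, h3⟩
    · exact ⟨x (φ k), hx _, fun l => by simp; positivity, fun h' => absurd h (not_le.2 h')⟩
    · exact ⟨x', h1, h2, fun _ => h3 j⟩
  choose z hz hz1 hz2 using hex
  have hzlim : Tendsto z atTop (𝓝 a) := by
    rw [tendsto_pi_nhds]
    intro l
    have h2 : Tendsto (fun k => x (φ k) l) atTop (𝓝 (a l)) :=
      (tendsto_pi_nhds.1 hlim) l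
    have h3 : Tendsto (fun k => x (φ k) l - z k l) atTop (𝓝 0) :=
      squeeze_zero_norm (fun k => hz1 k l) hsmall
    simpa using h2.sub h3
  have hcz : Tendsto (fun k => c (z k)) atTop (𝓝 (c a)) :=
    (hc a ha).tendsto.comp (tendsto_nhdsWithin_iff.2 ⟨hzlim, Eventually.of_forall hz⟩)
  have := le_of_tendsto_of_tendsto ((tendsto_pi_nhds.1 hcz) j) ((tendsto_pi_nhds.1 hcz) i)
    (hev.mono fun k hk => hz2 k hk)
  linarith

end S9

namespace S9

lemma generic (n d : ℕ) (hd : 0 < d) (A : Fin n → Fin d → ℝ) (η : ℝ) (hη : 0 < η) :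
    ∃ ε, 0 < ε ∧ ε < η ∧ ∃ V : Fin n → Fin d → ℝ, (∀ j i, 0 ≤ V j i ∧ V j i ≤ 1) ∧
      (∀ j, ∑ i, V j i = 1) ∧ ∀ e : Fin d → Fin n, Function.Injective e →
        (Matrix.of fun a i => A (e a) i + ε * V (e a) i).det ≠ 0 := by
  classical
  let S : Fin n → ℝ := fun j => ∑ i : Fin d, (j : ℝ) ^ (i : ℕ)
  have hS : ∀ j, 0 < S j := by
    intro j
    have : ((j : ℝ)) ^ (0 : ℕ) ≤ S j :=
      Finset.single_le_sum (f := fun i : Fin d => (j : ℝ) ^ (i : ℕ))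
        (fun i _ => by positivity) (Finset.mem_univ (⟨0, hd⟩ : Fin d))
    simp at this
    linarith
  let V : Fin n → Fin d → ℝ := fun j i => (S j)⁻¹ * (j : ℝ) ^ (i : ℕ)
  have hVsum : ∀ j, ∑ i, V j i = 1 := by
    intro j
    simp only [V, ← Finset.mul_sum]
    exact inv_mul_cancel₀ (hS j).ne'
  have hV0 : ∀ j i, 0 ≤ V j i := fun j i => by
    have := hS j
    positivity
  have hV1 : ∀ j i, V j i ≤ 1 := fun j i => by
    rw [← hVsum j]
    exact Finset.single_le_sum (f := fun i => V j i) (fun i _ => hV0 j i) (Finset.mem_univ i)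
  have hdet : ∀ e : Fin d → Fin n, Function.Injective e →
      (Matrix.of fun a i => V (e a) i).det ≠ 0 := by
    intro e he
    have h1 : (Matrix.of fun a i => V (e a) i) =
      Matrix.of fun a i => (fun a => (S (e a))⁻¹) a *
        (Matrix.vandermonde fun a => ((e a : ℕ) : ℝ)) a i := by
      ext a i; simp [V, Matrix.vandermonde_apply]
    rw [h1, Matrix.det_mul_column]
    refine mul_ne_zero (Finset.prod_ne_zero_iff.2 fun a _ => inv_ne_zero (hS _).ne') ?_
    rw [Matrix.det_vandermonde_ne_zero_iff]
    intro a b h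
    exact he (Fin.ext (by simpa using h))
  let p : (Fin d → Fin n) → Polynomial ℝ := fun e =>
    Matrix.det ((Polynomial.X : Polynomial ℝ) • (Matrix.of fun a i => V (e a) i).map Polynomial.C +
      (Matrix.of fun a i => A (e a) i).map Polynomial.C)
  have hp : ∀ e, Function.Injective e → p e ≠ 0 := by
    intro e he h
    have := Polynomial.coeff_det_X_add_C_card (Matrix.of fun a i => V (e a) i)
      (Matrix.of fun a i => A (e a) i)
    apply hdet e he
    rw [← this]
    simp only [p] at h
    rw [h]; simp
  have hev : ∀ e ε, (p e).eval ε = (Matrix.of fun a i => A (e a) i + ε * V (e a) i).det := by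
    intro e ε
    simp only [p]
    rw [← Polynomial.coe_evalRingHom, RingHom.map_det]
    congr 1
    ext a i
    simp; ring
  let bad : Set ℝ := ⋃ e : Fin d → Fin n, ((p e).roots.toFinset : Set ℝ)
  have hbad : bad.Finite := Set.finite_iUnion fun e => Finset.finite_toSet _
  obtain ⟨ε, hε, hεb⟩ := ((Set.Ioo_infinite hη).sdiff hbad).nonempty
  refine ⟨ε, hε.1, hε.2, V, fun j i => ⟨hV0 j i, hV1 j i⟩, hVsum, fun e he h => hεb ?_⟩
  simp only [bad, Set.mem_iUnion]
  refine ⟨e, ?_⟩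
  rw [← hev] at h
  simp [hp e he, Polynomial.IsRoot, h]

lemma zero_exists (n d : ℕ) (hn : 0 < n) (hd : 0 < d) (f : Fin n → Fin d → ℝ)
    (hf : ∀ j, ∑ i, f j i = 0)
    (G : (Fin n → ℝ) → Fin d → ℝ) (hGc : ContinuousOn G (stdSimplex ℝ (Fin n)))
    (hG0 : ∀ ν ∈ stdSimplex ℝ (Fin n), ∑ i, G ν i = 0)
    (hpos : ∀ ν ∈ stdSimplex ℝ (Fin n), (Finset.univ.filter fun j => ν j ≠ 0).card < d →
      ∀ (u : Fin d → ℝ) (ε : ℝ), 0 ≤ ε →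
        (∀ j, ν j ≠ 0 → ∀ k, ∑ i, u i * f j i ≤ ∑ i, u i * f k i + ε) →
        - (n * ε) ≤ ∑ i, u i * G ν i) :
    ∃ ν ∈ stdSimplex ℝ (Fin n), ∀ i, G ν i = 0 := by
  classical
  have hne : (stdSimplex ℝ (Fin n)).Nonempty := ⟨_, single_mem_stdSimplex ℝ (⟨0, hn⟩ : Fin n)⟩
  have hGi : ∀ i, ContinuousOn (fun ν => G ν i) (stdSimplex ℝ (Fin n)) :=
    fun i => (continuous_apply i).comp_continuousOn hGc
  have hsq : ContinuousOn (fun ν => ∑ i, (G ν i) ^ 2) (stdSimplex ℝ (Fin n)) :=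
    continuousOn_finsetSum _ fun i _ => (hGi i).pow 2
  have habs : ContinuousOn (fun ν => ∑ i, |G ν i|) (stdSimplex ℝ (Fin n)) :=
    continuousOn_finsetSum _ fun i _ => (hGi i).abs
  obtain ⟨ν0, hν0, hmin⟩ := (isCompact_stdSimplex ℝ (Fin n)).exists_isMinOn hne hsq
  obtain ⟨ν1, hν1, hmax⟩ := (isCompact_stdSimplex ℝ (Fin n)).exists_isMaxOn hne habs
  by_contra hcon
  push Not at hcon
  set B := ∑ i, |G ν1 i| with hB
  set δ := ∑ i, (G ν0 i) ^ 2 with hδ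
  have hB0 : 0 ≤ B := Finset.sum_nonneg fun i _ => abs_nonneg _
  have hδ0 : 0 < δ := by
    obtain ⟨i, hi⟩ := hcon ν0 hν0
    exact Finset.sum_pos' (fun i _ => sq_nonneg _) ⟨i, Finset.mem_univ i, by positivity⟩
  obtain ⟨ε, hε0, hε1, V, hV, hVs, hdet⟩ := generic n d hd (fun j i => f j i + 1 / d)
    (δ / (n * B + 1)) (by positivity)
  let q : Fin n → Fin d → ℝ := fun j i => f j i + 1 / d + ε * V j i
  have hqs : ∀ j, ∑ i, q j i = 1 + ε := by
    intro j
    simp only [q, Finset.sum_add_distrib, hf, ← Finset.mul_sum, hVs]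
    have : (d : ℝ) ≠ 0 := by exact_mod_cast hd.ne'
    simp [this]
  obtain ⟨ν, hν, hνS⟩ := lemmaS n hn (fun ν j => ∑ i, G ν i * q j i) (by
    apply continuousOn_pi.2
    intro j
    exact continuousOn_finsetSum _ fun i _ => (hGi i).mul continuousOn_const)
  have hGB : ∑ i, |G ν i| ≤ B := hmax hν
  have hGδ : δ ≤ ∑ i, (G ν i) ^ 2 := hmin hν
  by_cases hc : (Finset.univ.filter fun j => ν j ≠ 0).card < d
  · have h1 := hpos ν hν hc (fun i => - G ν i) (ε * B) (by positivity) (by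
      intro j hj k
      have h2 := (hνS j).resolve_left hj k
      have hexp : ∀ j, ∑ i, G ν i * q j i = ∑ i, G ν i * f j i + ε * ∑ i, G ν i * V j i := by
        intro j
        have : ∑ i, G ν i * (1 / (d : ℝ)) = 0 := by rw [← Finset.sum_mul, hG0 ν hν, zero_mul]
        rw [← add_zero (∑ i, G ν i * f j i), ← this, Finset.mul_sum, ← Finset.sum_add_distrib,
          ← Finset.sum_add_distrib]
        exact Finset.sum_congr rfl fun i _ => by simp only [q]; ring
      simp only [hexp] at h2
      have h3 : ∑ i, G ν i * V j i - ∑ i, G ν i * V k i ≤ B := by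
        rw [← Finset.sum_sub_distrib]
        refine le_trans (Finset.sum_le_sum fun i _ => ?_) hGB
        rw [← mul_sub]
        refine (le_abs_self _).trans ?_
        rw [abs_mul]
        refine mul_le_of_le_one_right (abs_nonneg _) ?_
        rw [abs_le]
        constructor <;> linarith [(hV j i).1, (hV j i).2, (hV k i).1, (hV k i).2]
      have h4 := mul_le_mul_of_nonneg_left h3 hε0.le
      simp only [neg_mul, Finset.sum_neg_distrib]
      linarith)
    have h2 : ∑ i, - G ν i * G ν i = - ∑ i, (G ν i) ^ 2 := by
      rw [← Finset.sum_neg_distrib]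
      exact Finset.sum_congr rfl fun i _ => by ring
    rw [h2] at h1
    rw [lt_div_iff₀ (by positivity)] at hε1
    nlinarith
  · push Not at hc
    obtain ⟨t, ht, htc⟩ := Finset.exists_subset_card_eq hc
    let e : Fin d → Fin n := fun a => (t.equivFinOfCardEq htc).symm a
    have he : Function.Injective e := fun a b h =>
      (t.equivFinOfCardEq htc).symm.injective (Subtype.ext h)
    have hes : ∀ a, ν (e a) ≠ 0 := fun a => by
      have := ht ((t.equivFinOfCardEq htc).symm a).2
      simpa using this
    have hmaxe : ∀ a k, ∑ i, G ν i * q k i ≤ ∑ i, G ν i * q (e a) i := fun a k =>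
      (hνS (e a)).resolve_left (hes a) k
    set c' := ∑ i, G ν i * q (e ⟨0, hd⟩) i with hc'
    have hce : ∀ a, ∑ i, G ν i * q (e a) i = c' := fun a =>
      le_antisymm (hmaxe _ _) (hmaxe _ _)
    have h0 : (Matrix.of fun a i => q (e a) i).mulVec (fun i => G ν i - c' / (1 + ε)) = 0 := by
      ext a
      simp only [Matrix.mulVec, dotProduct, Matrix.of_apply, Pi.zero_apply, mul_sub,
        Finset.sum_sub_distrib, ← Finset.sum_mul, hqs]
      have : ∑ i, q (e a) i * G ν i = c' := by
        rw [← hce a]; exact Finset.sum_congr rfl fun i _ => mul_comm _ _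
      rw [this]; field_simp; ring
    have h1 := Matrix.eq_zero_of_mulVec_eq_zero (hdet e he) h0
    have h2 : ∀ i, G ν i = c' / (1 + ε) := fun i => by
      have := congrFun h1 i
      simp only [Pi.zero_apply] at this
      linarith
    have h3 := hG0 ν hν
    simp only [h2, Finset.sum_const, Finset.card_univ, Fintype.card_fin, nsmul_eq_mul] at h3
    have hd' : (d : ℝ) ≠ 0 := by exact_mod_cast hd.ne'
    obtain ⟨i, hi⟩ := hcon ν hν
    exact hi (by rw [h2 i]; exact (mul_eq_zero.1 h3).resolve_left hd')

end S9

namespace S9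

/-- clamp -/
noncomputable def ph (t : ℝ) : ℝ := max 0 (min 1 t)

lemma ph_one {t : ℝ} (h : 1 ≤ t) : ph t = 1 := by simp [ph, h]
lemma ph_zero {t : ℝ} (h : t ≤ 0) : ph t = 0 := by
  simp [ph, h]
lemma ph_mid {t : ℝ} (h : 0 ≤ t) (h1 : t ≤ 1) : ph t = t := by simp [ph, h, h1]
lemma ph_mono : Monotone ph := fun a b h => by unfold ph; gcongr
lemma ph_cont : Continuous ph := by unfold ph; fun_prop
lemma ph_nonneg (t : ℝ) : 0 ≤ ph t := le_max_left _ _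
lemma ph_le_one (t : ℝ) : ph t ≤ 1 := by simp [ph]

lemma ph_interp (j c : ℤ) (θ : ℝ) (h0 : 0 ≤ θ) (h1 : θ ≤ 1) :
    ph (j + θ - c) = (1 - θ) * ph (j - c) + θ * ph (j + 1 - c) := by
  rcases lt_trichotomy c j with h | h | h
  · have : (c : ℝ) + 1 ≤ j := by exact_mod_cast h
    rw [ph_one (by linarith), ph_one (by linarith), ph_one (by linarith)]; ring
  · subst h
    rw [ph_zero (t := (c : ℝ) - c) (by linarith), ph_one (t := (c : ℝ) + 1 - c) (by linarith),
      ph_mid (by linarith) (by linarith)]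
    ring
  · have : (j : ℝ) + 1 ≤ c := by exact_mod_cast h
    rw [ph_zero (by linarith), ph_zero (by linarith), ph_zero (by linarith)]; ring

/-- cumulative coverage of bead `b` -/
noncomputable def Q (n b : ℕ) (t : ℝ) : ℝ := ph (t - b + n) + ph (t - b) + ph (t - b - n) - 1

lemma Q_mono (n b : ℕ) : Monotone (Q n b) := fun x y h => by
  unfold Q
  have h1 := ph_mono (show x - b + n ≤ y - b + n by linarith)
  have h2 := ph_mono (show x - b ≤ y - b by linarith)
  have h3 := ph_mono (show x - b - n ≤ y - b - n by linarith)
  linarith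

lemma Q_cont (n b : ℕ) : Continuous (Q n b) := by
  unfold Q
  have := ph_cont
  fun_prop

lemma Q_per {n b : ℕ} (hb : b < n) {t : ℝ} (h0 : -n ≤ t) (h1 : t ≤ n) :
    Q n b (t + n) = Q n b t + 1 := by
  have hb' : (b : ℝ) + 1 ≤ n := by exact_mod_cast hb
  have hb0 : (0 : ℝ) ≤ b := by positivity
  unfold Q
  rw [ph_one (t := t + n - b + n) (by linarith), ph_zero (t := t - b - n) (by linarith)]
  have e1 : t + n - b = t - b + n := by ring
  have e2 : t + n - b - n = t - b := by ring
  rw [e2, e1]; ring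

lemma Q_interp (n b j : ℕ) (θ : ℝ) (h0 : 0 ≤ θ) (h1 : θ ≤ 1) :
    Q n b (j + θ) = (1 - θ) * Q n b j + θ * Q n b ((j : ℝ) + 1) := by
  have a1 := ph_interp j (b - n) θ h0 h1
  have a2 := ph_interp j b θ h0 h1
  have a3 := ph_interp j (b + n) θ h0 h1
  push_cast at a1 a2 a3
  simp only [sub_add_eq_sub_sub, sub_sub_eq_add_sub] at a1 a2 a3
  unfold Q
  have e1 : ∀ t : ℝ, t - b + n = t + n - b := fun t => by ring
  simp only [e1]
  rw [a1, a2, a3]; ring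

lemma Q_nat {n b j : ℕ} (hb : b < n) (hj : j < n) : Q n b j = if b < j then 1 else 0 := by
  have hb' : (b : ℝ) + 1 ≤ n := by exact_mod_cast hb
  have hj' : (j : ℝ) + 1 ≤ n := by exact_mod_cast hj
  have hb0 : (0 : ℝ) ≤ b := by positivity
  have hj0 : (0 : ℝ) ≤ j := by positivity
  unfold Q
  rw [ph_one (t := (j : ℝ) - b + n) (by linarith), ph_zero (t := (j : ℝ) - b - n) (by linarith)]
  split_ifs with h
  · have : (b : ℝ) + 1 ≤ j := by exact_mod_cast h
    rw [ph_one (by linarith)]; ring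
  · have : (j : ℝ) ≤ b := by exact_mod_cast not_lt.1 h
    rw [ph_zero (by linarith)]; ring

/-- discrepancy function of a color -/
noncomputable def ff {d : ℕ} (n : ℕ) (s : ℕ → Fin d) (i : Fin d) (t : ℝ) : ℝ :=
  ∑ b ∈ (Finset.range n).filter (fun b => s b = i), (Q n b t - t / n)

lemma ff_cont {d : ℕ} (n : ℕ) (s : ℕ → Fin d) (i : Fin d) : Continuous (ff n s i) := by
  unfold ff
  have := Q_cont n
  fun_prop

lemma ff_per {d n : ℕ} (hn : 0 < n) (s : ℕ → Fin d) (i : Fin d) {t : ℝ} (h0 : -n ≤ t)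
    (h1 : t ≤ n) : ff n s i (t + n) = ff n s i t := by
  unfold ff
  refine Finset.sum_congr rfl fun b hb => ?_
  simp only [Finset.mem_filter, Finset.mem_range] at hb
  rw [Q_per hb.1 h0 h1]
  have : (n : ℝ) ≠ 0 := by exact_mod_cast hn.ne'
  field_simp
  ring

lemma ff_interp0 {d n : ℕ} (s : ℕ → Fin d) (i : Fin d) (j : ℕ)
    (θ : ℝ) (h0 : 0 ≤ θ) (h1 : θ ≤ 1) :
    ff n s i (j + θ) = (1 - θ) * ff n s i j + θ * ff n s i ((j : ℝ) + 1) := by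
  unfold ff
  rw [Finset.mul_sum, Finset.mul_sum, ← Finset.sum_add_distrib]
  refine Finset.sum_congr rfl fun b hb => ?_
  rw [Q_interp n b j θ h0 h1]; ring

lemma ff_interp1 {d n : ℕ} (hn : 0 < n) (s : ℕ → Fin d) {t : ℝ} (h0 : 0 ≤ t) (h1 : t ≤ n) :
    ∃ j j' : Fin n, ∃ θ : ℝ, 0 ≤ θ ∧ θ ≤ 1 ∧
      ∀ i, ff n s i t = (1 - θ) * ff n s i (j : ℕ) + θ * ff n s i (j' : ℕ) := by
  have hper : ∀ i, ff n s i n = ff n s i ((0 : ℕ) : ℝ) := by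
    intro i
    have := ff_per hn s i (t := 0) (by simp) (by simp)
    simpa using this
  rcases h1.eq_or_lt with rfl | h1
  · exact ⟨⟨0, hn⟩, ⟨0, hn⟩, 0, le_rfl, zero_le_one, fun i => by rw [hper]; simp⟩
  have hj : ⌊t⌋₊ < n := (Nat.floor_lt h0).2 h1
  have hle := Nat.floor_le h0
  have hlt := Nat.lt_floor_add_one t
  have key : ∀ i, ff n s i t = (1 - (t - ⌊t⌋₊)) * ff n s i (⌊t⌋₊ : ℕ)
      + (t - ⌊t⌋₊) * ff n s i ((⌊t⌋₊ : ℝ) + 1) := by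
    intro i
    rw [← ff_interp0 s i ⌊t⌋₊ (t - ⌊t⌋₊) (by linarith) (by linarith)]
    congr 1; ring
  by_cases hj1 : ⌊t⌋₊ + 1 < n
  · exact ⟨⟨_, hj⟩, ⟨_, hj1⟩, t - ⌊t⌋₊, by linarith, by linarith, fun i => by
      rw [key i]; push_cast; rfl⟩
  · have e : ⌊t⌋₊ + 1 = n := by omega
    refine ⟨⟨_, hj⟩, ⟨0, hn⟩, t - ⌊t⌋₊, by linarith, by linarith, fun i => ?_⟩
    rw [key i]
    have e' : (⌊t⌋₊ : ℝ) + 1 = n := by exact_mod_cast e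
    rw [e', hper]

lemma ff_interp {d n : ℕ} (hn : 0 < n) (s : ℕ → Fin d) {t : ℝ} (h0 : -n ≤ t) (h1 : t ≤ 2 * n) :
    ∃ j j' : Fin n, ∃ θ : ℝ, 0 ≤ θ ∧ θ ≤ 1 ∧
      ∀ i, ff n s i t = (1 - θ) * ff n s i (j : ℕ) + θ * ff n s i (j' : ℕ) := by
  have hn' : (0 : ℝ) < n := by exact_mod_cast hn
  by_cases ht : t < 0
  · have := ff_interp1 hn s (t := t + n) (by linarith) (by linarith)
    simpa only [fun i => ff_per hn s i (t := t) (by linarith) (by linarith)] using this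
  by_cases ht' : t ≤ n
  · exact ff_interp1 hn s (by linarith) ht'
  · have := ff_interp1 hn s (t := t - n) (by linarith) (by linarith)
    have e : ∀ i, ff n s i t = ff n s i (t - n) := fun i => by
      rw [← ff_per hn s i (t := t - n) (by linarith) (by linarith)]
      congr 1; ring
    simpa only [e] using this

lemma ff_sum_nat {d n : ℕ} (s : ℕ → Fin d) (j : Fin n) :
    ∑ i, ff n s i (j : ℕ) = 0 := by
  unfold ff
  rw [Finset.sum_fiberwise (Finset.range n) s]
  have hn : (n : ℝ) ≠ 0 := by
    have := j.2
    exact_mod_cast (by omega : n ≠ 0)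
  rw [Finset.sum_sub_distrib]
  have : ∑ b ∈ Finset.range n, Q n b (j : ℕ) = (j : ℕ) := by
    rw [Finset.sum_congr rfl (fun b hb => Q_nat (Finset.mem_range.1 hb) j.2)]
    rw [Finset.sum_ite, Finset.sum_const, Finset.sum_const_zero]
    have : (Finset.range n).filter (fun b => b < (j : ℕ)) = Finset.range j := by
      ext b; simp; have := j.2; omega
    rw [this]; simp
  rw [this]
  simp
  field_simp
  ring

lemma ff_sum {d n : ℕ} (hn : 0 < n) (s : ℕ → Fin d) {t : ℝ} (h0 : -n ≤ t) (h1 : t ≤ 2 * n) :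
    ∑ i, ff n s i t = 0 := by
  obtain ⟨j, j', θ, -, -, h⟩ := ff_interp hn s h0 h1
  simp only [h, Finset.sum_add_distrib, ← Finset.mul_sum, ff_sum_nat]
  simp

end S9

namespace S9

/-- parking recursion -/
noncomputable def pk (y l : ℕ → ℝ) (b : ℝ) : ℕ → ℝ
  | 0 => b
  | j + 1 => max (pk y l b j) (y j) + l j

lemma pk_mono (y l : ℕ → ℝ) {b b' : ℝ} (h : b ≤ b') (j : ℕ) : pk y l b j ≤ pk y l b' j := by
  induction j with
  | zero => exact h
  | succ j ih => simp only [pk]; gcongr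

lemma pk_le (y l : ℕ → ℝ) (b : ℝ) (j : ℕ) :
    pk y l b j ≤ max (b + ∑ i ∈ Finset.range j, l i) (pk y l 0 j) := by
  induction j with
  | zero => simp [pk]
  | succ j ih =>
    simp only [pk, Finset.sum_range_succ]
    rw [← add_assoc, max_add_add_right]
    refine add_le_add_left ?_ _
    apply max_le
    · refine ih.trans (max_le (le_max_left _ _) ?_)
      exact (le_max_left _ _).trans (le_max_right _ _)
    · exact (le_max_right _ _).trans (le_max_right _ _)

lemma pk_ub (y l : ℕ → ℝ) (N : ℝ) (hN : 0 ≤ N) (hl : ∀ j, 0 ≤ l j) (n : ℕ)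
    (hy : ∀ j < n, y j ≤ N) : pk y l 0 n ≤ N + ∑ i ∈ Finset.range n, l i := by
  induction n with
  | zero => simpa [pk] using hN
  | succ j ih =>
    simp only [pk, Finset.sum_range_succ]
    rw [← add_assoc]
    gcongr
    have h0 : 0 ≤ ∑ i ∈ Finset.range j, l i := Finset.sum_nonneg fun i _ => hl i
    apply max_le (ih fun i hi => hy i (by omega))
    have := hy j (by omega)
    linarith

lemma pk_lb (y l : ℕ → ℝ) (n : ℕ) : ∑ i ∈ Finset.range n, l i ≤ pk y l 0 n := by
  induction n with
  | zero => simp [pk]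
  | succ j ih =>
    simp only [pk, Finset.sum_range_succ]
    gcongr
    exact ih.trans (le_max_left _ _)

lemma pk_neg (y l : ℕ → ℝ) (hy : y 0 = 0) {b : ℝ} (hb : b ≤ 0) (j : ℕ) :
    pk y l b (j + 1) = pk y l 0 (j + 1) := by
  induction j with
  | zero => simp [pk, hy, hb]
  | succ j ih =>
    change max (pk y l b (j + 1)) _ + _ = max (pk y l 0 (j + 1)) _ + _
    rw [ih]

/-- starting point -/
noncomputable def st (y l : ℕ → ℝ) (n : ℕ) : ℝ := pk y l 0 n - n

lemma pk_fix (y l : ℕ → ℝ) (n : ℕ) (hn : 0 < n) (hy : y 0 = 0)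
    (hL : ∑ i ∈ Finset.range n, l i ≤ n) : pk y l (st y l n) n = st y l n + n := by
  have e : st y l n + n = pk y l 0 n := by unfold st; ring
  by_cases h : st y l n ≤ 0
  · obtain ⟨j, rfl⟩ : ∃ j, n = j + 1 := ⟨n - 1, by omega⟩
    rw [e, pk_neg y l hy h]
  · push Not at h
    rw [e]
    apply le_antisymm
    · refine (pk_le y l _ n).trans (max_le ?_ le_rfl)
      linarith
    · exact pk_mono y l h.le n

lemma pk_step (y l : ℕ → ℝ) (hl : ∀ j, 0 ≤ l j) (b : ℝ) (j : ℕ) :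
    max (pk y l b j) (y j) ≤ pk y l b (j + 1) := by
  simp only [pk]; linarith [hl j]

lemma pk_incr (y l : ℕ → ℝ) (hl : ∀ j, 0 ≤ l j) (b : ℝ) : Monotone (pk y l b) :=
  monotone_nat_of_le_succ fun j => (le_max_left _ _).trans (pk_step y l hl b j)

/-- total variation functional -/
noncomputable def Gs (n : ℕ) (F : ℝ → ℝ) (y l : ℕ → ℝ) : ℝ :=
  ∑ j ∈ Finset.range n,
    (F (pk y l (st y l n) (j + 1)) - F (max (pk y l (st y l n) j) (y j)))

lemma st_bounds (y l : ℕ → ℝ) (n : ℕ) (hl : ∀ j, 0 ≤ l j)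
    (hyn : ∀ j < n, y j ≤ n) (hL : ∑ i ∈ Finset.range n, l i ≤ n) :
    -n ≤ st y l n ∧ st y l n ≤ n := by
  have h1 := pk_lb y l n
  have h2 := pk_ub y l n (by positivity) hl n hyn
  have h3 : 0 ≤ ∑ i ∈ Finset.range n, l i := Finset.sum_nonneg fun i _ => hl i
  unfold st
  constructor <;> linarith

lemma pk_range (y l : ℕ → ℝ) (n : ℕ) (hn : 0 < n) (hy : y 0 = 0) (hl : ∀ j, 0 ≤ l j)
    (hyn : ∀ j < n, y j ≤ n) (hL : ∑ i ∈ Finset.range n, l i ≤ n) (j : ℕ) (hj : j < n) :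
    (-n ≤ pk y l (st y l n) (j + 1) ∧ pk y l (st y l n) (j + 1) ≤ 2 * n) ∧
    (-n ≤ max (pk y l (st y l n) j) (y j) ∧ max (pk y l (st y l n) j) (y j) ≤ 2 * n) := by
  have hb := st_bounds y l n hl hyn hL
  have h1 := pk_incr y l hl (st y l n) (Nat.zero_le j)
  have h2 := pk_incr y l hl (st y l n) (Nat.succ_le_of_lt hj)
  have h3 := pk_step y l hl (st y l n) j
  have h4 := pk_fix y l n hn hy hL
  have h5 : pk y l (st y l n) 0 = st y l n := rfl
  have h6 := le_max_left (pk y l (st y l n) j) (y j)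
  simp only [Nat.succ_eq_add_one] at h2
  refine ⟨⟨?_, ?_⟩, ?_, ?_⟩ <;> linarith

lemma Gs_pos (n : ℕ) (hn : 0 < n) (F : ℝ → ℝ) (l : ℕ → ℝ) (hl : ∀ j, 0 ≤ l j)
    (hL : ∑ i ∈ Finset.range n, l i ≤ n)
    (hF : ∀ t : ℝ, -n ≤ t → t ≤ 2 * n → 0 ≤ F t)
    (hper : ∀ t : ℝ, -n ≤ t → t ≤ n → F (t + n) = F t)
    (ε : ℝ) (hε : 0 ≤ ε) (hFl : ∀ j < n, l j ≠ 0 → F j ≤ ε) :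
    -(n * ε) ≤ Gs n F (fun j => j) l := by
  set y : ℕ → ℝ := fun j => j with hydef
  have hy : y 0 = 0 := by simp [y]
  have hyn : ∀ j < n, y j ≤ n := fun j hj => by simp only [y]; exact_mod_cast hj.le
  have hb := st_bounds y l n hl hyn hL
  have hR := pk_range y l n hn hy hl hyn hL
  have hfix := pk_fix y l n hn hy hL
  set b := st y l n with hbdef
  set c : ℝ := if 0 < b then F b else 0 with hc
  have hFb : 0 ≤ F b := hF b hb.1 (by have : (0:ℝ) ≤ n := by positivity
                                      linarith [hb.2])
  have hc0 : 0 ≤ c := by simp only [hc]; split_ifs <;> simp [hFb]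
  have inv : ∀ j ≤ n, (-c - j * ε ≤ ∑ i ∈ Finset.range j,
        (F (pk y l b (i + 1)) - F (max (pk y l b i) (y i)))) ∧
      (y j < pk y l b j → F (pk y l b j) - c - j * ε ≤ ∑ i ∈ Finset.range j,
        (F (pk y l b (i + 1)) - F (max (pk y l b i) (y i)))) := by
    intro j
    induction j with
    | zero =>
      intro _
      refine ⟨by simpa using hc0, fun h => ?_⟩
      simp only [pk, hy] at h
      simp [pk, hc, h]
    | succ j ih =>
      intro hj
      obtain ⟨ih1, ih2⟩ := ih (by omega)
      have hFp := hF _ (hR j (by omega)).1.1 (hR j (by omega)).1.2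
      rw [Finset.sum_range_succ]
      push_cast
      by_cases h : y j < pk y l b j
      · have := ih2 h
        rw [max_eq_left h.le]
        constructor
        · linarith
        · intro _; linarith
      · push Not at h
        rw [max_eq_right h]
        by_cases hlj : l j = 0
        · have e : pk y l b (j + 1) = y j := by simp [pk, hlj, h]
          rw [e]
          constructor
          · linarith
          · intro h'
            simp only [y] at h'
            push_cast at h'
            linarith
        · have := hFl j (by omega) hlj
          have e : F (y j) ≤ ε := this
          constructor
          · linarith
          · intro _; linarith
  obtain ⟨i1, i2⟩ := inv n le_rfl
  unfold Gs
  rw [← hbdef]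
  by_cases h : 0 < b
  · have := i2 (by rw [hfix]; simp only [y]; linarith)
    rw [hfix, hper b hb.1 hb.2] at this
    simp only [hc, if_pos h] at this
    linarith
  · simp only [hc, if_neg h] at i1
    linarith

lemma pk_contOn {X : Type*} [TopologicalSpace X] {S : Set X} (y l : X → ℕ → ℝ) (b : X → ℝ)
    (hy : ∀ j, ContinuousOn (fun x => y x j) S) (hl : ∀ j, ContinuousOn (fun x => l x j) S)
    (hb : ContinuousOn b S) (j : ℕ) : ContinuousOn (fun x => pk (y x) (l x) (b x) j) S := by
  induction j with
  | zero => simpa [pk] using hb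
  | succ j ih => simp only [pk]; exact (ih.sup (hy j)).add (hl j)

lemma Gs_contOn {X : Type*} [TopologicalSpace X] {S : Set X} (n : ℕ) (F : ℝ → ℝ)
    (hF : Continuous F) (y l : X → ℕ → ℝ)
    (hy : ∀ j, ContinuousOn (fun x => y x j) S) (hl : ∀ j, ContinuousOn (fun x => l x j) S) :
    ContinuousOn (fun x => Gs n F (y x) (l x)) S := by
  have hst : ContinuousOn (fun x => st (y x) (l x) n) S := by
    unfold st
    exact (pk_contOn y l (fun _ => 0) hy hl continuousOn_const n).sub continuousOn_const
  unfold Gs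
  refine continuousOn_finsetSum _ fun j _ => ?_
  exact (hF.comp_continuousOn (pk_contOn y l _ hy hl hst (j + 1))).sub
    (hF.comp_continuousOn ((pk_contOn y l _ hy hl hst j).sup (hy j)))

lemma exists_mm (n d : ℕ) (hn : 0 < n) (hd : 0 < d) : ∃ m : (Fin n → ℝ) → ℝ,
    Continuous m ∧ (∀ ν, (∀ j, 0 ≤ ν j) → 0 ≤ m ν) ∧
    (∀ ν, (Finset.univ.filter fun j => m ν < ν j).card < d) ∧
    (∀ ν, (∀ j, 0 ≤ ν j) → (Finset.univ.filter fun j => ν j ≠ 0).card < d → m ν = 0) := by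
  classical
  have : Nonempty (Fin n) := ⟨⟨0, hn⟩⟩
  have : Nonempty (Fin d) := ⟨⟨0, hd⟩⟩
  let g : (Fin d → Fin n) → (Fin n → ℝ) → ℝ := fun e ν =>
    if Function.Injective e then Finset.univ.inf' Finset.univ_nonempty (fun a => ν (e a)) else 0
  have hg0 : ∀ e ν, (∀ j, 0 ≤ ν j) → 0 ≤ g e ν := by
    intro e ν h
    simp only [g]
    split_ifs
    · exact Finset.le_inf' _ _ fun a _ => h _
    · exact le_rfl
  refine ⟨fun ν => Finset.univ.sup' Finset.univ_nonempty (fun e => g e ν), ?_, ?_, ?_, ?_⟩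
  · apply Continuous.finset_sup'_apply
    intro e _
    simp only [g]
    split_ifs
    · apply Continuous.finset_inf'_apply
      intro a _
      exact continuous_apply _
    · exact continuous_const
  · intro ν h
    let e0 : Fin d → Fin n := Classical.arbitrary _
    exact (hg0 e0 ν h).trans (Finset.le_sup' (fun e => g e ν) (Finset.mem_univ e0))
  · intro ν
    by_contra hc
    push Not at hc
    obtain ⟨t, ht, htc⟩ := Finset.exists_subset_card_eq hc
    let e : Fin d → Fin n := fun a => (t.equivFinOfCardEq htc).symm a
    have he : Function.Injective e := fun a b h =>
      (t.equivFinOfCardEq htc).symm.injective (Subtype.ext h)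
    have hlt : Finset.univ.sup' Finset.univ_nonempty (fun e => g e ν) < g e ν := by
      have : g e ν = Finset.univ.inf' Finset.univ_nonempty (fun a => ν (e a)) := by
        simp [g, he]
      rw [this, Finset.lt_inf'_iff]
      intro a _
      have := ht ((t.equivFinOfCardEq htc).symm a).2
      simpa using this
    exact absurd (Finset.le_sup' (fun e => g e ν) (Finset.mem_univ e)) (not_le.2 hlt)
  · intro ν h hc
    have : ∀ e, g e ν = 0 := by
      intro e
      apply le_antisymm _ (hg0 e ν h)
      simp only [g]
      split_ifs with he
      · by_contra hpos
        push Not at hpos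
        rw [Finset.lt_inf'_iff] at hpos
        have : (Finset.univ.image e).card ≤ (Finset.univ.filter fun j => ν j ≠ 0).card := by
          apply Finset.card_le_card
          intro j hj
          obtain ⟨a, -, rfl⟩ := Finset.mem_image.1 hj
          simpa using (hpos a (Finset.mem_univ a)).ne'
        rw [Finset.card_image_of_injective _ he] at this
        simp at this
        simp at hc
        omega
      · exact le_rfl
    simp [this]

end S9

namespace S9

lemma Gs_flat (n : ℕ) (F : ℝ → ℝ) (y l : ℕ → ℝ) (hy : ∀ j, y j = 0)
    (hl : ∀ j, 0 ≤ l j) (hL : ∑ i ∈ Finset.range n, l i ≤ n) :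
    Gs n F y l = F (∑ i ∈ Finset.range n, l i) - F 0 := by
  have h0 : ∀ j, pk y l 0 j = ∑ i ∈ Finset.range j, l i := by
    intro j
    induction j with
    | zero => simp [pk]
    | succ j ih =>
      have : 0 ≤ ∑ i ∈ Finset.range j, l i := Finset.sum_nonneg fun i _ => hl i
      rw [pk, ih, hy, max_eq_left this, Finset.sum_range_succ]
  have hst : st y l n ≤ 0 := by unfold st; rw [h0]; linarith
  have h1 : ∀ j, max (pk y l (st y l n) j) (y j) = ∑ i ∈ Finset.range j, l i := by
    intro j
    cases j with
    | zero => simp [pk, hy, hst]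
    | succ j =>
      rw [pk_neg y l (hy 0) hst, h0, hy]
      exact max_eq_left (Finset.sum_nonneg fun i _ => hl i)
  unfold Gs
  simp only [h1, pk_neg y l (hy 0) hst, h0]
  rw [Finset.sum_range_sub (fun j => F (∑ i ∈ Finset.range j, l i))]
  simp

lemma finish3 (n d : ℕ) (hn : 0 < n) (s : ℕ → Fin d) (L : ℝ) (hLn : L ≤ n)
    (y l : ℕ → ℝ) (hy : y 0 = 0) (hyn : ∀ j < n, y j ≤ n) (hl : ∀ j, 0 ≤ l j)
    (hL : ∑ i ∈ Finset.range n, l i = L)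
    (hcard : ((Finset.range n).filter (fun j => l j ≠ 0)).card ≤ d - 1)
    (hG : ∀ i, Gs n (ff n s i) y l = 0) :
    ∃ p α : ℕ → ℝ, (∀ j < n, p j ≤ α j ∧ α j ≤ p (j + 1)) ∧ p n = p 0 + n ∧ -n ≤ p 0 ∧
      p 0 ≤ n ∧ ((Finset.range n).filter (fun j => α j < p (j + 1))).card ≤ d - 1 ∧
      (∀ i, ∑ j ∈ Finset.range n, (ff n s i (p (j + 1)) - ff n s i (α j)) = 0) ∧
      ∑ j ∈ Finset.range n, (p (j + 1) - α j) = L := by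
  have hb := st_bounds y l n hl hyn (hL.le.trans hLn)
  refine ⟨pk y l (st y l n), fun j => max (pk y l (st y l n) j) (y j),
    fun j _ => ⟨le_max_left _ _, pk_step y l hl _ j⟩, pk_fix y l n hn hy (hL.le.trans hLn),
    hb.1, hb.2, ?_, hG, ?_⟩
  · refine le_trans (Finset.card_le_card ?_) hcard
    intro j hj
    rw [Finset.mem_filter] at hj ⊢
    refine ⟨hj.1, fun h => ?_⟩
    have h2 := hj.2
    simp [pk, h] at h2
  · rw [← hL]
    exact Finset.sum_congr rfl fun j _ => by simp [pk]

lemma main3 (n d : ℕ) (hn : 0 < n) (hd : 2 ≤ d) (s : ℕ → Fin d) (L : ℝ) (hL0 : 0 ≤ L)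
    (hLn : L ≤ n) :
    ∃ p α : ℕ → ℝ, (∀ j < n, p j ≤ α j ∧ α j ≤ p (j + 1)) ∧ p n = p 0 + n ∧ -n ≤ p 0 ∧
      p 0 ≤ n ∧ ((Finset.range n).filter (fun j => α j < p (j + 1))).card ≤ d - 1 ∧
      (∀ i, ∑ j ∈ Finset.range n, (ff n s i (p (j + 1)) - ff n s i (α j)) = 0) ∧
      ∑ j ∈ Finset.range n, (p (j + 1) - α j) = L := by
  classical
  have hn' : (0 : ℝ) < n := by exact_mod_cast hn
  obtain ⟨m, hmc, hm0, hmcard, hmz⟩ := exists_mm n d hn (by omega)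
  let w : (Fin n → ℝ) → Fin n → ℝ := fun ν j => max (ν j - m ν) 0
  let sc : (Fin n → ℝ) → ℝ := fun ν => ∑ j, w ν j
  let den : (Fin n → ℝ) → ℝ := fun ν => max (sc ν) (1 / 2)
  let l : (Fin n → ℝ) → ℕ → ℝ := fun ν j =>
    (if h : j < n then L * (w ν ⟨j, h⟩ / den ν) else 0) +
      (if j = 0 then L * (1 - sc ν / den ν) else 0)
  let y : (Fin n → ℝ) → ℕ → ℝ := fun ν j => j * max 0 (2 * sc ν - 1)
  have hwc : ∀ j, Continuous (fun ν => w ν j) := fun j => by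
    simp only [w]; fun_prop
  have hscc : Continuous sc := continuous_finsetSum _ fun j _ => hwc j
  have hdenc : Continuous den := by simp only [den]; fun_prop
  have hdpos : ∀ ν, 0 < den ν := fun ν => lt_of_lt_of_le (by norm_num) (le_max_right _ _)
  have hlc : ∀ j, Continuous (fun ν => l ν j) := by
    intro j
    simp only [l]
    refine Continuous.add ?_ ?_
    · split_ifs with h
      · exact continuous_const.mul ((hwc _).div hdenc fun ν => (hdpos ν).ne')
      · exact continuous_const
    · split_ifs
      · exact continuous_const.mul (continuous_const.sub
          (hscc.div hdenc fun ν => (hdpos ν).ne'))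
      · exact continuous_const
  have hyc : ∀ j, Continuous (fun ν => y ν j) := fun j => by
    simp only [y]; fun_prop
  have hw0 : ∀ ν j, 0 ≤ w ν j := fun ν j => le_max_right _ _
  have hsc0 : ∀ ν, 0 ≤ sc ν := fun ν => Finset.sum_nonneg fun j _ => hw0 ν j
  have hsd : ∀ ν, sc ν / den ν ≤ 1 := fun ν => (div_le_one (hdpos ν)).2 (le_max_left _ _)
  have hl0 : ∀ ν j, 0 ≤ l ν j := by
    intro ν j
    simp only [l]
    apply add_nonneg
    · split_ifs
      · exact mul_nonneg hL0 (div_nonneg (hw0 _ _) (hdpos ν).le)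
      · exact le_rfl
    · split_ifs
      · exact mul_nonneg hL0 (by linarith [hsd ν])
      · exact le_rfl
  have hlsum : ∀ ν, ∑ j ∈ Finset.range n, l ν j = L := by
    intro ν
    simp only [l, Finset.sum_add_distrib]
    rw [Finset.sum_range]
    simp only [Fin.is_lt, dite_true, Fin.eta, ← Finset.mul_sum, ← Finset.sum_div]
    rw [Finset.sum_ite_eq_of_mem' _ _ _ (Finset.mem_range.2 hn)]
    change L * (sc ν / den ν) + _ = _
    ring
  have hsc1 : ∀ ν ∈ stdSimplex ℝ (Fin n), sc ν ≤ 1 := by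
    intro ν hν
    rw [← hν.2]
    refine Finset.sum_le_sum fun j _ => max_le ?_ (hν.1 j)
    linarith [hm0 ν hν.1]
  have hy0 : ∀ ν, y ν 0 = 0 := fun ν => by simp [y]
  have hyn : ∀ ν ∈ stdSimplex ℝ (Fin n), ∀ j < n, y ν j ≤ n := by
    intro ν hν j hj
    simp only [y]
    have h1 : max 0 (2 * sc ν - 1) ≤ 1 := max_le zero_le_one (by linarith [hsc1 ν hν])
    have h2 : (j : ℝ) ≤ n := by exact_mod_cast hj.le
    calc (j : ℝ) * max 0 (2 * sc ν - 1) ≤ j * 1 := by gcongr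
      _ ≤ n := by linarith
  obtain ⟨ν, hν, hz⟩ := zero_exists n d hn (by omega) (fun j i => ff n s i (j : ℕ))
    (fun j => ff_sum_nat s j) (fun ν i => Gs n (ff n s i) (y ν) (l ν))
    (continuousOn_pi.2 fun i => Gs_contOn n _ (ff_cont n s i) y l
      (fun j => (hyc j).continuousOn) (fun j => (hlc j).continuousOn))
    (by
      intro ν hν
      simp only [Gs]
      rw [Finset.sum_comm]
      refine Finset.sum_eq_zero fun j hj => ?_
      obtain ⟨h1, h2⟩ := pk_range (y ν) (l ν) n hn (hy0 ν) (hl0 ν) (hyn ν hν)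
        ((hlsum ν).le.trans hLn) j (Finset.mem_range.1 hj)
      rw [Finset.sum_sub_distrib, ff_sum hn s h1.1 h1.2, ff_sum hn s h2.1 h2.2, sub_zero])
    (by
      intro ν hν hcard u ε hε hu
      have hmz' := hmz ν hν.1 hcard
      have hw : ∀ j, w ν j = ν j := fun j => by simp [w, hmz', hν.1 j]
      have hsc : sc ν = 1 := by simp only [sc, hw]; exact hν.2
      have hden : den ν = 1 := by simp only [den, hsc]; norm_num
      have hyj : y ν = fun j : ℕ => (j : ℝ) := by
        funext j; simp only [y, hsc]; norm_num
      obtain ⟨k0, hk0⟩ := @Finite.exists_min (Fin n) _ _ ⟨⟨0, hn⟩⟩ _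
        (fun k : Fin n => ∑ i, u i * ff n s i (k : ℕ))
      set μ := ∑ i, u i * ff n s i (k0 : ℕ) with hμ
      have hlin : ∑ i, u i * Gs n (ff n s i) (y ν) (l ν) =
          Gs n (fun t => ∑ i, u i * ff n s i t - μ) (y ν) (l ν) := by
        simp only [Gs, Finset.mul_sum]
        rw [Finset.sum_comm]
        refine Finset.sum_congr rfl fun j _ => ?_
        rw [sub_sub_sub_cancel_right, ← Finset.sum_sub_distrib]
        exact Finset.sum_congr rfl fun i _ => by ring
      rw [hlin, hyj]
      refine Gs_pos n hn _ (l ν) (hl0 ν) ((hlsum ν).le.trans hLn) ?_ ?_ ε hε ?_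
      · intro t h0 h1
        obtain ⟨j, j', θ, hθ0, hθ1, h⟩ := ff_interp hn s h0 h1
        have e : ∑ i, u i * ff n s i t = (1 - θ) * ∑ i, u i * ff n s i (j : ℕ)
            + θ * ∑ i, u i * ff n s i (j' : ℕ) := by
          rw [Finset.mul_sum, Finset.mul_sum, ← Finset.sum_add_distrib]
          exact Finset.sum_congr rfl fun i _ => by rw [h i]; ring
        have a1 := mul_le_mul_of_nonneg_left (hk0 j) (sub_nonneg.2 hθ1)
        have a2 := mul_le_mul_of_nonneg_left (hk0 j') hθ0
        rw [e]
        linarith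
      · intro t h0 h1
        simp only [fun i => ff_per hn s i h0 h1]
      · intro j hj hlj
        have hνj : ν ⟨j, hj⟩ ≠ 0 := by
          intro h
          apply hlj
          simp [l, hj, hw, h, hsc, hden]
        have := hu ⟨j, hj⟩ hνj k0
        simp only at this
        linarith)
  by_cases hs : 1 / 2 ≤ sc ν
  · refine finish3 n d hn s L hLn (y ν) (l ν) (hy0 ν) (hyn ν hν) (hl0 ν) (hlsum ν) ?_ hz
    have hden : den ν = sc ν := max_eq_left hs
    have h1 := hmcard ν
    have h2 : (Finset.range n).filter (fun j => l ν j ≠ 0) ⊆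
        (Finset.univ.filter fun j : Fin n => m ν < ν j).image (fun j : Fin n => (j : ℕ)) := by
      intro j hj
      simp only [Finset.mem_filter, Finset.mem_range] at hj
      obtain ⟨hj, hlj⟩ := hj
      simp only [Finset.mem_image, Finset.mem_filter, Finset.mem_univ, true_and]
      refine ⟨⟨j, hj⟩, ?_, rfl⟩
      by_contra hle
      push Not at hle
      apply hlj
      have hw : w ν ⟨j, hj⟩ = 0 := max_eq_right (by linarith)
      have : sc ν ≠ 0 := by linarith
      simp [l, hj, hw, hden, this]
    have h3 := (Finset.card_le_card h2).trans Finset.card_image_le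
    omega
  · push Not at hs
    have hyz : ∀ j, y ν j = 0 := fun j => by
      simp only [y]
      rw [max_eq_left (by linarith), mul_zero]
    let l' : ℕ → ℝ := fun j => if j = 0 then L else 0
    have hl' : ∀ j, 0 ≤ l' j := fun j => by simp only [l']; split_ifs <;> simp [hL0]
    have hl's : ∑ j ∈ Finset.range n, l' j = L :=
      Finset.sum_ite_eq_of_mem' _ _ _ (Finset.mem_range.2 hn)
    refine finish3 n d hn s L hLn (fun _ => 0) l' rfl (fun _ _ => hn'.le) hl' hl's ?_ ?_
    · have : (Finset.range n).filter (fun j => l' j ≠ 0) ⊆ {0} := by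
        intro j hj
        simp only [Finset.mem_filter, l'] at hj
        by_contra h
        simp at h
        simp [h] at hj
      have := Finset.card_le_card this
      simp only [Finset.card_singleton] at this
      omega
    · intro i
      rw [Gs_flat n _ _ l' (fun _ => rfl) hl' (hl's.le.trans hLn), hl's]
      have := hz i
      rw [Gs_flat n _ _ _ hyz (hl0 ν) ((hlsum ν).le.trans hLn), hlsum] at this
      exact this

end S9

namespace S9

/-- residue -/
def res (n : ℕ) (c : ℤ) : ℕ := (c % (n : ℤ)).toNat

lemma res_add {n : ℕ} (hn : 0 < n) (lo : ℤ) (x : ℕ) : (res n lo + x) % n = res n (lo + x) := by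
  have hn' : (n : ℤ) ≠ 0 := by exact_mod_cast hn.ne'
  have h1 := Int.emod_nonneg lo hn'
  have h2 := Int.emod_nonneg (lo + x) hn'
  unfold res
  zify
  rw [Int.toNat_of_nonneg h1, Int.toNat_of_nonneg h2, Int.emod_add_emod]

lemma res_shift {n b : ℕ} (hb : b < n) (r : ℤ) : res n (b + r * n) = b := by
  unfold res
  rw [Int.add_mul_emod_self_right, Int.emod_eq_of_lt (by positivity) (by exact_mod_cast hb)]
  simp

lemma interval {n : ℕ} (hn : 0 < n) (S : Finset ℕ) (a β : ℝ)
    (hfull : ∀ c : ℤ, a ≤ c → (c : ℝ) + 1 ≤ β → res n c ∈ S) :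
    ∃ A len : ℕ, (Finset.range len).image (fun x => (A + x) % n) ⊆ S ∧
      ∀ c : ℤ, a < c + 1 → c < β → res n c ∈ S →
        res n c ∈ (Finset.range len).image (fun x => (A + x) % n) := by
  set c0 := ⌊a⌋ with hc0
  set c1 := ⌈β⌉ - 1 with hc1
  let lo : ℤ := if res n c0 ∈ S then c0 else c0 + 1
  let hi : ℤ := if res n c1 ∈ S then c1 + 1 else c1
  refine ⟨res n lo, (hi - lo).toNat, ?_, ?_⟩
  · intro b hb
    obtain ⟨x, hx, rfl⟩ := Finset.mem_image.1 hb
    rw [Finset.mem_range] at hx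
    rw [res_add hn]
    have hx' : lo + x < hi := by omega
    have hlo : lo ≤ lo + x := by omega
    set c := lo + (x : ℤ)
    by_cases e0 : c = c0
    · simp only [lo] at hlo
      split_ifs at hlo with h
      · rw [e0]; exact h
      · omega
    by_cases e1 : c = c1
    · simp only [hi] at hx'
      split_ifs at hx' with h
      · rw [e1]; exact h
      · omega
    have h0 : c0 < c := by
      simp only [lo] at hlo
      split_ifs at hlo <;> omega
    have h1 : c < c1 := by
      simp only [hi] at hx'
      split_ifs at hx' <;> omega
    apply hfull
    · exact (Int.floor_lt.1 h0).le
    · have : c + 1 < ⌈β⌉ := by omega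
      have := Int.lt_ceil.1 this
      push_cast at this
      exact this.le
  · intro c h1 h2 hc
    have h1' : c0 < c + 1 := Int.floor_lt.2 (by push_cast; exact h1)
    have h2' : c < ⌈β⌉ := Int.lt_ceil.2 h2
    have hlo : lo ≤ c := by
      simp only [lo]
      split_ifs with h
      · omega
      · have : c ≠ c0 := by rintro e; exact h (e ▸ hc)
        omega
    have hhi : c < hi := by
      simp only [hi]
      split_ifs with h
      · omega
      · have : c ≠ c1 := by rintro e; exact h (e ▸ hc)
        omega
    refine Finset.mem_image.2 ⟨(c - lo).toNat, ?_, ?_⟩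
    · rw [Finset.mem_range]; omega
    · rw [res_add hn]
      congr 1
      omega

lemma Q_full {n : ℕ} {c : ℤ} {a β : ℝ} (ha : -n ≤ a) (hβ : β ≤ 2 * n)
    (h1 : a ≤ c) (h2 : (c : ℝ) + 1 ≤ β) :
    ∃ b, b < n ∧ res n c = b ∧ 1 ≤ Q n b β - Q n b a := by
  have l1 : -(n : ℤ) ≤ c := by
    have : (-(n : ℝ)) ≤ c := by linarith
    exact_mod_cast this
  have l2 : c + 1 ≤ 2 * (n : ℤ) := by
    have : (c : ℝ) + 1 ≤ 2 * n := by linarith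
    exact_mod_cast this
  have hab : a ≤ β := by linarith
  have key : ∀ r : ℤ, (r = -1 ∨ r = 0 ∨ r = 1) → ∀ b : ℕ, b < n → c = b + r * n →
      1 ≤ Q n b β - Q n b a := by
    intro r hr b hb hc
    have m1 := ph_mono (show a - b + n ≤ β - b + n by linarith)
    have m2 := ph_mono (show a - b ≤ β - b by linarith)
    have m3 := ph_mono (show a - b - n ≤ β - b - n by linarith)
    have hc' : (c : ℝ) = b + r * n := by exact_mod_cast hc
    unfold Q
    rcases hr with rfl | rfl | rfl
    · push_cast at hc'
      rw [ph_one (t := β - b + n) (by linarith), ph_zero (t := a - b + n) (by linarith)]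
      linarith
    · push_cast at hc'
      rw [ph_one (t := β - b) (by linarith), ph_zero (t := a - b) (by linarith)]
      linarith
    · push_cast at hc'
      rw [ph_one (t := β - b - n) (by linarith), ph_zero (t := a - b - n) (by linarith)]
      linarith
  have fin : ∀ r : ℤ, (r = -1 ∨ r = 0 ∨ r = 1) → 0 ≤ c - r * n → c - r * n < n →
      ∃ b, b < n ∧ res n c = b ∧ 1 ≤ Q n b β - Q n b a := by
    intro r hr h0 h1
    have hb : (c - r * n).toNat < n := by omega
    have hc : c = ((c - r * n).toNat : ℤ) + r * n := by
      rw [Int.toNat_of_nonneg h0]; ring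
    refine ⟨(c - r * n).toNat, hb, ?_, key r hr _ hb hc⟩
    conv_lhs => rw [hc]
    exact res_shift hb r
  by_cases c1 : c < 0
  · exact fin (-1) (by simp) (by linarith) (by linarith)
  by_cases c2 : c < n
  · exact fin 0 (by simp) (by linarith) (by linarith)
  · exact fin 1 (by simp) (by linarith) (by linarith)

lemma ph_lt {x y : ℝ} (h : ph x < ph y) : x < 1 ∧ 0 < y := by
  constructor
  · by_contra h1
    push Not at h1
    rw [ph_one h1] at h
    linarith [ph_le_one y]
  · by_contra h1
    push Not at h1
    rw [ph_zero h1] at h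
    linarith [ph_nonneg x]

lemma Q_lt {n b : ℕ} (hb : b < n) {a β : ℝ} (h : Q n b a < Q n b β) :
    ∃ c : ℤ, res n c = b ∧ a < c + 1 ∧ c < β := by
  by_cases h1 : ph (a - b + n) < ph (β - b + n)
  · obtain ⟨u, v⟩ := ph_lt h1
    exact ⟨b + (-1) * n, res_shift hb _, by push_cast; linarith, by push_cast; linarith⟩
  by_cases h2 : ph (a - b) < ph (β - b)
  · obtain ⟨u, v⟩ := ph_lt h2
    exact ⟨b + 0 * n, res_shift hb _, by push_cast; linarith, by push_cast; linarith⟩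
  by_cases h3 : ph (a - b - n) < ph (β - b - n)
  · obtain ⟨u, v⟩ := ph_lt h3
    exact ⟨b + 1 * n, res_shift hb _, by push_cast; linarith, by push_cast; linarith⟩
  unfold Q at h
  linarith

lemma round (n d : ℕ) (s : ℕ → Fin d) (k : Fin d → ℤ) (g : ℕ → ℝ)
    (hg0 : ∀ b < n, 0 ≤ g b) (hg1 : ∀ b < n, g b ≤ 1)
    (hsum : ∀ i, ∑ b ∈ (Finset.range n).filter (fun b => s b = i), g b = k i) :
    ∃ S ⊆ Finset.range n, (∀ b < n, g b = 1 → b ∈ S) ∧ (∀ b ∈ S, 0 < g b) ∧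
      ∀ i, ((S.filter (fun b => s b = i)).card : ℤ) = k i := by
  classical
  have hex : ∀ i, ∃ R : Finset ℕ, ((Finset.range n).filter (fun b => s b = i)).filter (g · = 1) ⊆ R ∧
      R ⊆ ((Finset.range n).filter (fun b => s b = i)).filter (0 < g ·) ∧
      R.card = (k i).toNat := by
    intro i
    set B := (Finset.range n).filter (fun b => s b = i) with hB
    have hBn : ∀ b ∈ B, b < n := fun b hb => by simp [hB] at hb; exact hb.1
    have hk0 : 0 ≤ k i := by
      have : (0 : ℝ) ≤ k i := by
        rw [← hsum i]; exact Finset.sum_nonneg fun b hb => hg0 b (hBn b hb)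
      exact_mod_cast this
    apply Finset.exists_subsuperset_card_eq
    · intro b hb
      simp only [Finset.mem_filter] at hb ⊢
      exact ⟨hb.1, by rw [hb.2]; exact one_pos⟩
    · have : (((B.filter (g · = 1)).card : ℕ) : ℝ) ≤ k i := by
        rw [← hsum i, ← Finset.sum_filter_add_sum_filter_not B (g · = 1)]
        rw [Finset.sum_congr rfl (fun b hb => (Finset.mem_filter.1 hb).2)]
        simp only [Finset.sum_const, nsmul_eq_mul, mul_one, le_add_iff_nonneg_right]
        exact Finset.sum_nonneg fun b hb => hg0 b (hBn b (Finset.mem_filter.1 hb).1)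
      have h2 : ((B.filter (g · = 1)).card : ℤ) ≤ k i := by exact_mod_cast this
      omega
    · have : (k i : ℝ) ≤ (((B.filter (0 < g ·)).card : ℕ) : ℝ) := by
        rw [← hsum i, ← Finset.sum_filter_add_sum_filter_not B (0 < g ·)]
        have e : ∑ b ∈ B.filter (fun b => ¬ 0 < g b), g b ≤ 0 :=
          Finset.sum_nonpos fun b hb => not_lt.1 (Finset.mem_filter.1 hb).2
        have e2 : ∑ b ∈ B.filter (0 < g ·), g b ≤ ∑ b ∈ B.filter (0 < g ·), (1 : ℝ) :=
          Finset.sum_le_sum fun b hb => hg1 b (hBn b (Finset.mem_filter.1 hb).1)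
        simp only [Finset.sum_const, nsmul_eq_mul, mul_one] at e2
        linarith
      have h2 : k i ≤ ((B.filter (0 < g ·)).card : ℤ) := by exact_mod_cast this
      omega
  choose R hR1 hR2 hR3 using hex
  have hmem : ∀ i, ∀ b ∈ R i, b < n ∧ s b = i ∧ 0 < g b := by
    intro i b hb
    have := hR2 i hb
    simp only [Finset.mem_filter, Finset.mem_range] at this
    exact ⟨this.1.1, this.1.2, this.2⟩
  refine ⟨Finset.univ.biUnion R, ?_, ?_, ?_, ?_⟩
  · intro b hb
    obtain ⟨i, -, hi⟩ := Finset.mem_biUnion.1 hb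
    exact Finset.mem_range.2 (hmem i b hi).1
  · intro b hb h1
    refine Finset.mem_biUnion.2 ⟨s b, Finset.mem_univ _, hR1 _ ?_⟩
    simp [hb, h1]
  · intro b hb
    obtain ⟨i, -, hi⟩ := Finset.mem_biUnion.1 hb
    exact (hmem i b hi).2.2
  · intro i
    have e : (Finset.univ.biUnion R).filter (fun b => s b = i) = R i := by
      ext b
      simp only [Finset.mem_filter, Finset.mem_biUnion, Finset.mem_univ, true_and]
      constructor
      · rintro ⟨⟨i', hi'⟩, h⟩
        have := (hmem i' b hi').2.1
        rw [h] at this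
        rw [this]; exact hi'
      · intro h
        exact ⟨⟨i, h⟩, (hmem i b h).2.1⟩
    rw [e, hR3]
    have hk0 : 0 ≤ k i := by
      have : (0 : ℝ) ≤ k i := by
        rw [← hsum i]
        exact Finset.sum_nonneg fun b hb => hg0 b (by simp at hb; exact hb.1)
      exact_mod_cast this
    exact Int.toNat_of_nonneg hk0

end S9

/-- Positions of the cyclic sequence are `{0, …, n-1}`, colors are `Fin d`,
`s j` is the color at position `j`. A cyclic interval is a set of consecutive
indices modulo `n`. -/
theorem stmt9 (n d : ℕ) (hd : 2 ≤ d) (hn : 0 < n) (s : ℕ → Fin d) (k : Fin d → ℤ)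
    (lam : ℝ) (hlam0 : 0 ≤ lam) (hlam1 : lam ≤ 1)
    (hk : ∀ i : Fin d,
      (k i : ℝ) = lam * ((Finset.range n).filter (fun j => s j = i)).card) :
    ∃ S' : Finset ℕ, S' ⊆ Finset.range n ∧
      (∃ m : ℕ, m ≤ d - 1 ∧ ∃ T : Fin m → Finset ℕ,
        (∀ j : Fin m, ∃ a len : ℕ,
          T j = (Finset.range len).image (fun x => (a + x) % n)) ∧
        S' = Finset.univ.biUnion T) ∧
      ∀ i : Fin d, ((S'.filter (fun j => s j = i)).card : ℤ) = k i := by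
  classical
  have hn' : (0 : ℝ) < n := by exact_mod_cast hn
  obtain ⟨p, α, hpα, hpn, hp0, hp1, hcard, hff, hlen⟩ :=
    S9.main3 n d hn hd s (lam * n) (by positivity) (by nlinarith)
  have hmono : ∀ j ≤ n, p 0 ≤ p j := by
    intro j
    induction j with
    | zero => intro _; exact le_rfl
    | succ j ih =>
      intro h
      have := hpα j (by omega)
      linarith [ih (by omega)]
  have hmono2 : ∀ j i, j + i ≤ n → p j ≤ p (j + i) := by
    intro j i
    induction i with
    | zero => intro _; exact le_rfl
    | succ i ih =>
      intro h
      have := hpα (j + i) (by omega)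
      have h2 := ih (by omega)
      rw [← add_assoc]
      linarith
  let g : ℕ → ℝ := fun b => ∑ j ∈ Finset.range n, (S9.Q n b (p (j + 1)) - S9.Q n b (α j))
  have hterm : ∀ b, ∀ j ∈ Finset.range n, 0 ≤ S9.Q n b (p (j + 1)) - S9.Q n b (α j) :=
    fun b j hj => sub_nonneg.2 (S9.Q_mono n b (hpα j (Finset.mem_range.1 hj)).2)
  have hg0 : ∀ b < n, 0 ≤ g b := fun b _ => Finset.sum_nonneg (hterm b)
  have hg1 : ∀ b < n, g b ≤ 1 := by
    intro b hb
    calc g b ≤ ∑ j ∈ Finset.range n, (S9.Q n b (p (j + 1)) - S9.Q n b (p j)) :=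
          Finset.sum_le_sum fun j hj => sub_le_sub_left
            (S9.Q_mono n b (hpα j (Finset.mem_range.1 hj)).1) _
      _ = S9.Q n b (p n) - S9.Q n b (p 0) := Finset.sum_range_sub (fun j => S9.Q n b (p j)) n
      _ = 1 := by rw [hpn, S9.Q_per hb hp0 hp1]; ring
  have hsum : ∀ i, ∑ b ∈ (Finset.range n).filter (fun b => s b = i), g b = k i := by
    intro i
    have h1 := hff i
    simp only [S9.ff, ← Finset.sum_sub_distrib] at h1
    rw [Finset.sum_comm] at h1
    have h2 : ∀ b, ∑ j ∈ Finset.range n, (S9.Q n b (p (j + 1)) - p (j + 1) / n -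
        (S9.Q n b (α j) - α j / n)) = g b - lam := by
      intro b
      have : lam = (∑ j ∈ Finset.range n, (p (j + 1) - α j)) / n := by
        rw [hlen]; field_simp
      rw [this, Finset.sum_div, ← Finset.sum_sub_distrib]
      exact Finset.sum_congr rfl fun j _ => by ring
    simp only [h2, Finset.sum_sub_distrib, Finset.sum_const, nsmul_eq_mul] at h1
    rw [hk i]
    linarith
  obtain ⟨S, hS, hS1, hSpos, hScard⟩ := S9.round n d s k g hg0 hg1 hsum
  refine ⟨S, hS, ?_, hScard⟩
  set J := (Finset.range n).filter (fun j => α j < p (j + 1)) with hJ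
  have hint : ∀ j ∈ J, ∃ A len : ℕ, (Finset.range len).image (fun x => (A + x) % n) ⊆ S ∧
      ∀ c : ℤ, α j < c + 1 → c < p (j + 1) → S9.res n c ∈ S →
        S9.res n c ∈ (Finset.range len).image (fun x => (A + x) % n) := by
    intro j hj
    simp only [hJ, Finset.mem_filter, Finset.mem_range] at hj
    apply S9.interval hn
    intro c h1 h2
    have b1 : -(n : ℝ) ≤ α j := by linarith [(hpα j hj.1).1, hmono j hj.1.le]
    have b2 : p (j + 1) ≤ 2 * n := by
      have := hmono2 (j + 1) (n - (j + 1)) (by omega)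
      rw [show j + 1 + (n - (j + 1)) = n by omega] at this
      linarith
    obtain ⟨b, hb, hres, hQ⟩ := S9.Q_full b1 b2 h1 h2
    rw [hres]
    apply hS1 b hb
    apply le_antisymm (hg1 b hb)
    exact hQ.trans (Finset.single_le_sum (hterm b) (Finset.mem_range.2 hj.1))
  choose! A len hA1 hA2 using hint
  let I : ℕ → Finset ℕ := fun j => (Finset.range (len j)).image (fun x => (A j + x) % n)
  refine ⟨J.card, hcard, fun x => I (J.equivFin.symm x), fun x => ⟨_, _, rfl⟩, ?_⟩
  ext b
  simp only [Finset.mem_biUnion, Finset.mem_univ, true_and]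
  constructor
  · intro hb
    have hbn : b < n := Finset.mem_range.1 (hS hb)
    have hpos := hSpos b hb
    obtain ⟨j, hj, hlt⟩ := Finset.exists_lt_of_sum_lt
      (s := Finset.range n) (f := fun _ => (0 : ℝ))
      (g := fun j => S9.Q n b (p (j + 1)) - S9.Q n b (α j)) (by rw [Finset.sum_const_zero]; exact hpos)
    have hlt' : S9.Q n b (α j) < S9.Q n b (p (j + 1)) := by linarith
    have hjJ : j ∈ J := by
      rw [hJ, Finset.mem_filter]
      refine ⟨hj, ?_⟩
      by_contra hle
      exact absurd (S9.Q_mono n b (not_lt.1 hle)) (not_le.2 hlt')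
    obtain ⟨c, hc, h1, h2⟩ := S9.Q_lt hbn hlt'
    refine ⟨J.equivFin ⟨j, hjJ⟩, ?_⟩
    have := hA2 j hjJ c h1 h2 (by rw [hc]; exact hb)
    rw [hc] at this
    simpa [I] using this
  · rintro ⟨x, hx⟩
    exact hA1 _ (J.equivFin.symm x).2 hx
end

section
/- Let C be a circle (a closed interval of length L > 0 with endpoints identified), let d ≥ 2, and let μ₁, …, μ_d be non-atomic probability measures on C. Then for each λ ∈ [0,1] there exists a subset K ⊆ C that is a union of at most d − 1 arcs (intervals of the circle) such that μᵢ(K) = λ for every i = 1, …, d. -/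
open MeasureTheory


set_option linter.unusedSectionVars false

namespace SW

section Scarf
variable {X I α : Type} [Fintype X] [Fintype I] [DecidableEq X] [DecidableEq I] [LinearOrder α]

def Dom (r : I → X → α) (S : Finset (X ⊕ I)) : Prop :=
  ∀ x : X, ∃ i : I, Sum.inr i ∉ S ∧ ∀ y : X, Sum.inl y ∈ S → r i x ≤ r i y

lemma Dom.mono {r : I → X → α} {S T : Finset (X ⊕ I)} (h : Dom r S) (hT : T ⊆ S) : Dom r T := by
  intro x
  obtain ⟨i, hi, h2⟩ := h x
  exact ⟨i, fun h' => hi (hT h'), fun y hy => h2 y (hT hy)⟩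

/-- the room parity -/
lemma room_even {Z : Type} [DecidableEq Z] (c : Z → I) (i0 : I) (S : Finset Z)
    (hS : S.card = Fintype.card I) (hc : S.image c ≠ Finset.univ) :
    Even (S.filter (fun z => (S.erase z).image c = Finset.univ.erase i0)).card := by
  by_cases h0 : ∃ z0 ∈ S, (S.erase z0).image c = Finset.univ.erase i0
  swap
  · have : (S.filter (fun z => (S.erase z).image c = Finset.univ.erase i0)) = ∅ := by
      apply Finset.filter_eq_empty_iff.2
      intro z hz h
      exact h0 ⟨z, hz, h⟩
    rw [this]; simp
  obtain ⟨z0, hz0, hz⟩ := h0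
  have hinj : Set.InjOn c (S.erase z0 : Finset Z) := by
    rw [← Finset.card_image_iff, hz, Finset.card_erase_of_mem (Finset.mem_univ _),
      Finset.card_erase_of_mem hz0, hS, Finset.card_univ]
  have hne : c z0 ≠ i0 := by
    intro h
    apply hc
    rw [← Finset.insert_erase hz0, Finset.image_insert, hz, h,
      Finset.insert_erase (Finset.mem_univ _)]
  have : c z0 ∈ (S.erase z0).image c := by rw [hz]; simp [hne]
  obtain ⟨z1, hz1, h1⟩ := Finset.mem_image.1 this
  have hz1' := Finset.mem_erase.1 hz1
  have key : (S.filter (fun z => (S.erase z).image c = Finset.univ.erase i0)) = {z0, z1} := by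
    ext z
    simp only [Finset.mem_filter, Finset.mem_insert, Finset.mem_singleton]
    constructor
    · rintro ⟨hzS, hzi⟩
      by_contra hcon
      push Not at hcon
      have hcz : c z ∈ (S.erase z0).image c :=
        Finset.mem_image_of_mem _ (Finset.mem_erase.2 ⟨hcon.1, hzS⟩)
      rw [hz, ← hzi] at hcz
      obtain ⟨w, hw, hwz⟩ := Finset.mem_image.1 hcz
      have hw' := Finset.mem_erase.1 hw
      by_cases hw0 : w = z0
      · subst hw0
        exact hcon.2 (hinj (by simp [hcon.1, hzS]) (Finset.mem_coe.2 hz1) (by rw [h1, hwz]))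
      · exact hw'.1 (hinj (by simp [hw0, hw'.2]) (by simp [hcon.1, hzS]) hwz)
    · rintro (rfl | rfl)
      · exact ⟨hz0, hz⟩
      · refine ⟨hz1'.2, ?_⟩
        rw [← hz]
        ext i
        simp only [Finset.mem_image, Finset.mem_erase]
        constructor
        · rintro ⟨w, ⟨hw, hwS⟩, rfl⟩
          by_cases hw0 : w = z0
          · exact ⟨z, hz1', by rw [h1, hw0]⟩
          · exact ⟨w, ⟨hw0, hwS⟩, rfl⟩
        · rintro ⟨w, ⟨hw, hwS⟩, rfl⟩
          by_cases hw0 : w = z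
          · exact ⟨z0, ⟨Ne.symm hz1'.1, hz0⟩, by rw [← h1, hw0]⟩
          · exact ⟨w, ⟨hw0, hwS⟩, rfl⟩
  rw [key, Finset.card_pair (Ne.symm hz1'.1)]
  decide

lemma door_ext [Nonempty X] (r : I → X → α) (hr : ∀ i, Function.Injective (r i)) (i0 : I) :
    ∃ x0 : X, ∀ z, (z ∉ (Finset.univ.erase i0).image (Sum.inr : I → X ⊕ I) ∧
      Dom r (insert z ((Finset.univ.erase i0).image (Sum.inr : I → X ⊕ I)))) ↔ z = Sum.inl x0 := by
  obtain ⟨x0, -, hx0⟩ := Finset.exists_max_image (Finset.univ : Finset X) (r i0)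
    Finset.univ_nonempty
  refine ⟨x0, fun z => ?_⟩
  constructor
  · rintro ⟨h1, h2⟩
    rcases z with x | i
    · obtain ⟨i, hi, hy⟩ := h2 x0
      have : i = i0 := by
        by_contra h; apply hi; simp [h]
      subst this
      have := hy x (by simp)
      rw [hr i (le_antisymm (hx0 x (Finset.mem_univ _)) this)]
    · exfalso
      have : i = i0 := by
        by_contra h; apply h1; simp [h]
      subst this
      obtain ⟨j, hj, -⟩ := h2 x0
      apply hj
      by_cases h : j = i <;> simp [h]
  · rintro rfl
    refine ⟨by simp, fun x => ⟨i0, by simp, fun y hy => ?_⟩⟩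
    have : y = x0 := by simpa using hy
    subst this
    exact hx0 x (Finset.mem_univ _)

lemma door_int [Nonempty X] (r : I → X → α) (hr : ∀ i, Function.Injective (r i))
    (T : Finset (X ⊕ I)) (hT : T.card + 1 = Fintype.card I) (hd : Dom r T)
    (hx : ∃ x, Sum.inl x ∈ T) :
    ∃ z1 z2, z1 ≠ z2 ∧ ∀ z, (z ∉ T ∧ Dom r (insert z T)) ↔ (z = z1 ∨ z = z2) := by
  classical
  -- argmin function
  have hf : ∀ i, ∃ y, Sum.inl y ∈ T ∧ ∀ y', Sum.inl y' ∈ T → r i y ≤ r i y' := by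
    intro i
    obtain ⟨y, hy, h⟩ := Finset.exists_min_image (Finset.univ.filter (fun y => Sum.inl y ∈ T)) (r i)
      (by obtain ⟨x, hx⟩ := hx; exact ⟨x, by simp [hx]⟩)
    exact ⟨y, by simpa using hy, fun y' hy' => h y' (by simp [hy'])⟩
  choose f hfT hfm using hf
  set D := Finset.univ.filter (fun i : I => Sum.inr i ∉ T) with hD
  set τ := Finset.univ.filter (fun y : X => Sum.inl y ∈ T) with hτ
  have hdf : ∀ x, ∃ i ∈ D, r i x ≤ r i (f i) := by
    intro x
    obtain ⟨i, hi, h⟩ := hd x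
    exact ⟨i, by simp [hD, hi], h _ (hfT i)⟩
  have hsurj : ∀ y, Sum.inl y ∈ T → ∃ i ∈ D, f i = y := by
    intro y hy
    obtain ⟨i, hi, h⟩ := hdf y
    exact ⟨i, hi, hr i (le_antisymm (hfm i y hy) h)⟩
  have hcard : D.card = τ.card + 1 := by
    have e1 : T.card = τ.card + (Finset.univ.filter (fun i : I => Sum.inr i ∈ T)).card := by
      have : T = τ.disjSum (Finset.univ.filter (fun i : I => Sum.inr i ∈ T)) := by
        ext z; rcases z with z | z <;> simp [hτ]
      conv_lhs => rw [this]
      rw [Finset.card_disjSum]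
    have e2 : (Finset.univ.filter (fun i : I => Sum.inr i ∈ T)).card + D.card = Fintype.card I := by
      rw [hD, Finset.card_filter_add_card_filter_not, Finset.card_univ]
    omega
  obtain ⟨a, ha, b, hb, hab, hfab⟩ : ∃ a ∈ D, ∃ b ∈ D, a ≠ b ∧ f a = f b :=
    Finset.exists_ne_map_eq_of_card_lt_of_maps_to (t := τ) (by omega)
      (fun i _ => by simp [hτ, hfT])
  -- f injective on D erase a, and on D erase b
  have hinj : ∀ a ∈ D, ∀ b ∈ D, a ≠ b → f a = f b → Set.InjOn f (D.erase a : Finset I) := by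
    intro a ha b hb hab hfab
    rw [← Finset.card_image_iff]
    have : (D.erase a).image f = τ := by
      ext y
      simp only [Finset.mem_image, Finset.mem_erase, hτ, Finset.mem_filter, Finset.mem_univ,
        true_and]
      constructor
      · rintro ⟨i, -, rfl⟩; exact hfT i
      · intro hy
        obtain ⟨i, hi, rfl⟩ := hsurj y hy
        by_cases hia : i = a
        · exact ⟨b, ⟨Ne.symm hab, hb⟩, by rw [hia, hfab]⟩
        · exact ⟨i, ⟨hia, hi⟩, rfl⟩
    rw [this, Finset.card_erase_of_mem ha]; omega
  have hsurj' : ∀ a ∈ D, ∀ b ∈ D, a ≠ b → f a = f b → ∀ y, Sum.inl y ∈ T → ∃ i ∈ D, i ≠ a ∧ f i = y := by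
    intro a ha b hb hab hfab y hy
    obtain ⟨i, hi, rfl⟩ := hsurj y hy
    by_cases hia : i = a
    · exact ⟨b, hb, Ne.symm hab, by rw [hia, hfab]⟩
    · exact ⟨i, hi, hia, rfl⟩
  -- P
  let B : I → X → Prop := fun c x => ∀ i ∈ D, i ≠ c → r i (f i) < r i x
  let P : I → X ⊕ I → Prop := fun c z => (z = Sum.inr c ∧ ∀ x, ¬ B c x) ∨
    ∃ x, z = Sum.inl x ∧ B c x ∧ ∀ x', B c x' → r c x' ≤ r c x
  have hP : ∀ c, ∃ z, ∀ z', P c z' ↔ z' = z := by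
    intro c
    by_cases h : ∃ x, B c x
    · obtain ⟨x, hx, hm⟩ := Finset.exists_max_image (Finset.univ.filter (B c)) (r c)
        (by obtain ⟨x, hx⟩ := h; exact ⟨x, by simp [hx]⟩)
      have hx : B c x := by simpa using hx
      have hm : ∀ x', B c x' → r c x' ≤ r c x := fun x' hx' => hm x' (by simp [hx'])
      refine ⟨Sum.inl x, fun z' => ⟨?_, ?_⟩⟩
      · rintro (⟨-, h2⟩ | ⟨y, rfl, hy, hym⟩)
        · exact absurd hx (h2 x)
        · rw [hr c (le_antisymm (hm y hy) (hym x hx))]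
      · rintro rfl
        exact Or.inr ⟨x, rfl, hx, hm⟩
    · push Not at h
      refine ⟨Sum.inr c, fun z' => ⟨?_, ?_⟩⟩
      · rintro (⟨h2, -⟩ | ⟨y, rfl, hy, hym⟩)
        · exact h2
        · exact absurd hy (h y)
      · rintro rfl
        exact Or.inl ⟨rfl, h⟩
  have hback : ∀ a ∈ D, ∀ b ∈ D, a ≠ b → f a = f b → ∀ z, P a z → z ∉ T ∧ Dom r (insert z T) := by
    intro a ha b hb hab hfab z hz
    rcases hz with ⟨rfl, h⟩ | ⟨x, rfl, hx, hm⟩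
    · refine ⟨by simpa [hD] using ha, fun x => ?_⟩
      have := h x
      simp only [B] at this
      push Not at this
      obtain ⟨i, hi, hia, hle⟩ := this
      have hi' : Sum.inr i ∉ T := by simpa [hD] using hi
      refine ⟨i, by simp [hia, hi'], fun y hy => ?_⟩
      have hy : Sum.inl y ∈ T := by simpa using hy
      exact hle.trans (hfm i y hy)
    · have hxT : Sum.inl x ∉ T := by
        intro hxT
        obtain ⟨i, hi, hia, rfl⟩ := hsurj' a ha b hb hab hfab x hxT
        exact lt_irrefl _ (hx i hi hia)
      refine ⟨hxT, fun x' => ?_⟩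
      by_cases hB : B a x'
      · have ha' : Sum.inr a ∉ T := by simpa [hD] using ha
        refine ⟨a, by simp [ha'], fun y hy => ?_⟩
        rcases Finset.mem_insert.1 hy with h | h
        · cases h; exact hm x' hB
        · obtain ⟨i, hi, hle⟩ := hdf x'
          by_cases hia : i = a
          · subst hia; exact hle.trans (hfm i y h)
          · exact absurd (hB i hi hia) (not_lt.2 hle)
      · simp only [B] at hB
        push Not at hB
        obtain ⟨i, hi, hia, hle⟩ := hB
        have hi' : Sum.inr i ∉ T := by simpa [hD] using hi
        refine ⟨i, by simp [hi'], fun y hy => ?_⟩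
        rcases Finset.mem_insert.1 hy with h | h
        · cases h; exact hle.trans (hx i hi hia).le
        · exact hle.trans (hfm i y h)
  have hfab_uniq : ∀ c ∈ D, (∃ c' ∈ D, c' ≠ c ∧ f c' = f c) → c = a ∨ c = b := by
    rintro c hc ⟨c', hc', hne, hcc⟩
    by_contra hcon
    push Not at hcon
    by_cases h : c' = a
    · subst h
      exact hcon.2 (hinj c' ha b hb hab hfab (by simp [hne.symm, hc]) (by simp [hab.symm, hb])
        (by rw [← hcc, hfab]))
    · exact hne (hinj a ha b hb hab hfab (by simp [h, hc']) (by simp [hcon.1, hc]) hcc)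
  have hfwd : ∀ z, z ∉ T → Dom r (insert z T) → P a z ∨ P b z := by
    intro z hz hdz
    rcases z with x | j
    · -- some i with f' i = x
      obtain ⟨c, hc, hcm⟩ := hdz x
      have hc' : c ∈ D := by simp [hD]; intro h; exact hc (by simp [h])
      have hlt : r c x < r c (f c) := by
        refine lt_of_le_of_ne (hcm _ (by simp [hfT])) ?_
        intro h
        rw [hr c h] at hz
        exact hz (hfT c)
      -- f c must be min of another
      obtain ⟨c', hc1, hcm'⟩ := hdz (f c)
      have hc1' : c' ∈ D := by simp [hD]; intro h; exact hc1 (by simp [h])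
      have hne : c' ≠ c := by
        rintro rfl
        exact absurd (hcm' x (by simp)) (not_le.2 hlt)
      have hcc : f c' = f c :=
        hr c' (le_antisymm (hfm c' _ (hfT c)) (hcm' _ (by simp [hfT])))
      have hPc : P c (Sum.inl x) := by
        refine Or.inr ⟨x, rfl, ?_, ?_⟩
        · intro i hi hic
          -- otherwise x below f i; then f i unattained
          by_contra hle
          push Not at hle
          have hlt' : r i x < r i (f i) := by
            refine lt_of_le_of_ne hle ?_
            intro h
            rw [hr i h] at hz
            exact hz (hfT i)
          obtain ⟨k, hk, hkm⟩ := hdz (f i)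
          have hkD : k ∈ D := by simp [hD]; intro h; exact hk (by simp [h])
          have hki : k ≠ i := by
            rintro rfl
            exact absurd (hkm x (by simp)) (not_le.2 hlt')
          have hfk : f k = f i :=
            hr k (le_antisymm (hfm k _ (hfT i)) (hkm _ (by simp [hfT])))
          -- so {i,k} = {c,c'} ; k ≠ c as x below f c
          have hkc : k ≠ c := by
            rintro rfl
            have := hkm x (by simp)
            rw [← hfk] at this
            exact absurd this (not_le.2 hlt)
          have := hinj c hc' c' hc1' hne.symm hcc.symm (by simp [hkc, hkD]) (by simp [hic, hi]) hfk
          exact hki this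
        · intro x' hx'
          obtain ⟨k, hk, hkm⟩ := hdz x'
          have hkD : k ∈ D := by simp [hD]; intro h; exact hk (by simp [h])
          by_cases hkc : k = c
          · subst hkc; exact hkm x (by simp)
          · exact absurd (hx' k hkD hkc) (not_lt.2 (hkm _ (by simp [hfT])))
      rcases hfab_uniq c hc' ⟨c', hc1', hne, hcc⟩ with rfl | rfl
      · exact Or.inl hPc
      · exact Or.inr hPc
    · have hj : j ∈ D := by simpa [hD] using hz
      have hPc : P j (Sum.inr j) := by
        refine Or.inl ⟨rfl, fun x hx => ?_⟩
        obtain ⟨k, hk, hkm⟩ := hdz x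
        have hkD : k ∈ D := by simp [hD]; intro h; exact hk (by simp [h])
        have hkj : k ≠ j := by rintro rfl; exact hk (by simp)
        exact absurd (hx k hkD hkj) (not_lt.2 (hkm _ (by simp [hfT])))
      obtain ⟨k, hk, hkm⟩ := hdz (f j)
      have hkD : k ∈ D := by simp [hD]; intro h; exact hk (by simp [h])
      have hkj : k ≠ j := by rintro rfl; exact hk (by simp)
      have hfk : f k = f j :=
        hr k (le_antisymm (hfm k _ (hfT j)) (hkm _ (by simp [hfT])))
      rcases hfab_uniq j hj ⟨k, hkD, hkj, hfk⟩ with rfl | rfl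
      · exact Or.inl hPc
      · exact Or.inr hPc
  obtain ⟨za, hza⟩ := hP a
  obtain ⟨zb, hzb⟩ := hP b
  refine ⟨za, zb, ?_, fun z => ⟨?_, ?_⟩⟩
  · rintro rfl
    have h1 := (hza za).2 rfl
    have h2 := (hzb za).2 rfl
    rcases h1 with ⟨h1, h1'⟩ | ⟨x, h1, h1', -⟩ <;> rcases h2 with ⟨h2, h2'⟩ | ⟨x', h2, h2', -⟩
    · rw [h1] at h2; exact hab (Sum.inr_injective h2)
    · rw [h1] at h2; cases h2
    · rw [h1] at h2; cases h2
    · rw [h1] at h2; cases h2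
      obtain ⟨i, hi, hle⟩ := hdf x
      by_cases hia : i = a
      · exact absurd (h2' i hi (by rw [hia]; exact hab)) (not_lt.2 hle)
      · exact absurd (h1' i hi hia) (not_lt.2 hle)
  · rintro ⟨h1, h2⟩
    rcases hfwd z h1 h2 with h | h
    · exact Or.inl ((hza z).1 h)
    · exact Or.inr ((hzb z).1 h)
  · rintro (h | h)
    · exact hback a ha b hb hab hfab z ((hza z).2 h)
    · exact hback b hb a ha hab.symm hfab.symm z ((hzb z).2 h)

theorem scarf [Nonempty X] [Nonempty I] (r : I → X → α) (hr : ∀ i, Function.Injective (r i))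
    (c : X → I) : ∃ S : Finset (X ⊕ I), Dom r S ∧
      ∀ i, Sum.inr i ∈ S ∨ ∃ x, Sum.inl x ∈ S ∧ c x = i := by
  classical
  by_contra hcon
  obtain ⟨i0⟩ := ‹Nonempty I›
  let c' : X ⊕ I → I := Sum.elim c id
  let rooms : Finset (Finset (X ⊕ I)) :=
    Finset.univ.filter (fun S => S.card = Fintype.card I ∧ Dom r S)
  let doors : Finset (Finset (X ⊕ I)) :=
    Finset.univ.filter (fun T => T.card + 1 = Fintype.card I ∧ Dom r T ∧
      T.image c' = Finset.univ.erase i0)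
  have hcount := Finset.sum_card_bipartiteAbove_eq_sum_card_bipartiteBelow
    (s := doors) (t := rooms) (fun T S => T ⊆ S)
  have hr2 : Even (∑ S ∈ rooms, (Finset.bipartiteBelow (fun T S => T ⊆ S) doors S).card) := by
    apply Finset.even_sum
    intro S hS
    obtain ⟨hS1, hS2⟩ : S.card = Fintype.card I ∧ Dom r S := by simpa [rooms] using hS
    have hnc : S.image c' ≠ Finset.univ := by
      intro h
      apply hcon
      refine ⟨S, hS2, fun i => ?_⟩
      have : i ∈ S.image c' := by rw [h]; simp
      obtain ⟨z, hz, hzi⟩ := Finset.mem_image.1 this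
      rcases z with x | j
      · exact Or.inr ⟨x, hz, hzi⟩
      · left; have : j = i := hzi
        rwa [← this]
    have := room_even c' i0 S hS1 hnc
    suffices hsuf : (S.filter (fun z => (S.erase z).image c' = Finset.univ.erase i0)).card =
        (Finset.bipartiteBelow (fun T S => T ⊆ S) doors S).card by rwa [hsuf] at this
    apply Finset.card_bij (fun z _ => S.erase z)
    · intro z hz
      obtain ⟨hz1, hz2⟩ := Finset.mem_filter.1 hz
      simp only [Finset.mem_bipartiteBelow, doors, Finset.mem_filter, Finset.mem_univ, true_and]
      exact ⟨⟨by rw [Finset.card_erase_add_one hz1, hS1], hS2.mono (Finset.erase_subset _ _), hz2⟩,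
        Finset.erase_subset _ _⟩
    · intro z hz w hw h
      exact Finset.erase_injOn S (Finset.mem_filter.1 hz).1 (Finset.mem_filter.1 hw).1 h
    · intro T hT
      simp only [Finset.mem_bipartiteBelow, doors, Finset.mem_filter, Finset.mem_univ, true_and] at hT
      obtain ⟨⟨h1, h2, h3⟩, h4⟩ := hT
      have : T ⋖ S := by
        rw [Finset.covBy_iff_card_sdiff_eq_one]
        refine ⟨h4, ?_⟩
        rw [Finset.card_sdiff_of_subset h4]; omega
      obtain ⟨z, hz, rfl⟩ := Finset.covBy_iff_exists_insert.1 this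
      exact ⟨z, by simp only [Finset.mem_filter, Finset.erase_insert hz]; simp [h3],
        Finset.erase_insert hz⟩
  have habove : ∀ T ∈ doors, (Finset.bipartiteAbove (fun T S => T ⊆ S) rooms T).card =
      (Finset.univ.filter (fun z => z ∉ T ∧ Dom r (insert z T))).card := by
    intro T hT
    simp only [doors, Finset.mem_filter, Finset.mem_univ, true_and] at hT
    obtain ⟨h1, h2, h3⟩ := hT
    symm
    apply Finset.card_bij (fun z _ => insert z T)
    · intro z hz
      obtain ⟨hz1, hz2⟩ := (Finset.mem_filter.1 hz).2
      simp only [Finset.mem_bipartiteAbove, rooms, Finset.mem_filter, Finset.mem_univ, true_and]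
      exact ⟨⟨by rw [Finset.card_insert_of_notMem hz1, h1], hz2⟩, Finset.subset_insert _ _⟩
    · intro z hz w hw h
      have hz1 := (Finset.mem_filter.1 hz).2.1
      have h : insert z T = insert w T := h
      have : z ∈ insert w T := by rw [← h]; simp
      rcases Finset.mem_insert.1 this with h | h
      · exact h
      · exact absurd h hz1
    · intro S hS
      simp only [Finset.mem_bipartiteAbove, rooms, Finset.mem_filter, Finset.mem_univ, true_and] at hS
      obtain ⟨⟨g1, g2⟩, h4⟩ := hS
      have : T ⋖ S := by
        rw [Finset.covBy_iff_card_sdiff_eq_one]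
        refine ⟨h4, ?_⟩
        rw [Finset.card_sdiff_of_subset h4]; omega
      obtain ⟨z, hz, rfl⟩ := Finset.covBy_iff_exists_insert.1 this
      exact ⟨z, by simp [hz, g2], rfl⟩
  set T0 : Finset (X ⊕ I) := (Finset.univ.erase i0).image Sum.inr with hT0
  have hT0d : T0 ∈ doors := by
    simp only [doors, Finset.mem_filter, Finset.mem_univ, true_and]
    refine ⟨?_, ?_, ?_⟩
    · rw [hT0, Finset.card_image_of_injective _ Sum.inr_injective,
        Finset.card_erase_add_one (Finset.mem_univ _), Finset.card_univ]
    · intro x; exact ⟨i0, by simp [hT0], by simp [hT0]⟩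
    · rw [hT0, Finset.image_image]
      exact Finset.image_id
  have hd2 : Odd (∑ T ∈ doors, (Finset.bipartiteAbove (fun T S => T ⊆ S) rooms T).card) := by
    rw [← Finset.add_sum_erase _ _ hT0d]
    apply Odd.add_even
    · rw [habove T0 hT0d]
      obtain ⟨x0, hx0⟩ := door_ext r hr i0
      have : (Finset.univ.filter (fun z => z ∉ T0 ∧ Dom r (insert z T0))) = {Sum.inl x0} := by
        ext z
        rw [Finset.mem_filter, hx0 z]; simp
      rw [this]; simp
    · apply Finset.even_sum
      intro T hT
      obtain ⟨hne, hT⟩ := Finset.mem_erase.1 hT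
      rw [habove T hT]
      simp only [doors, Finset.mem_filter, Finset.mem_univ, true_and] at hT
      obtain ⟨h1, h2, h3⟩ := hT
      have hx : ∃ x, Sum.inl x ∈ T := by
        by_contra hno
        push Not at hno
        apply hne
        ext z
        rcases z with x | i
        · simp [hno x, hT0]
        · have : i ∈ T.image c' ↔ Sum.inr i ∈ T := by
            rw [Finset.mem_image]
            constructor
            · rintro ⟨z, hz, rfl⟩
              rcases z with x | j
              · exact absurd hz (hno x)
              · exact hz
            · intro h; exact ⟨_, h, rfl⟩
          rw [← this, h3, hT0]; simp
      obtain ⟨z1, z2, hne', hz⟩ := door_int r hr T h1 h2 hx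
      have : (Finset.univ.filter (fun z => z ∉ T ∧ Dom r (insert z T))) = {z1, z2} := by
        ext z
        rw [Finset.mem_filter, hz z]; simp
      rw [this, Finset.card_pair hne']; decide
  rw [hcount] at hd2
  exact (Nat.not_even_iff_odd.2 hd2) hr2

end Scarf
end SW

set_option linter.unusedSectionVars false
namespace SW
section Brouwer
variable {I : Type} [Fintype I] [DecidableEq I]

/-- combinatorial approximate statement -/
lemma grid_step [Nonempty I] (N : ℕ) (col : (I → ℕ) → I) :
    ∃ (x : I → ℕ), ∑ i, x i = N ∧
      ∀ i, x i ≤ Fintype.card I ∨ ∃ x' : I → ℕ, ∑ i, x' i = N ∧ col x' = i ∧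
        ∀ j, x j ≤ x' j + Fintype.card I ∧ x' j ≤ x j + Fintype.card I := by
  classical
  let X := {x : I → Fin (N+1) // ∑ i, (x i : ℕ) = N}
  have mk : ∀ x : I → ℕ, ∑ i, x i = N → ∃ z : X, ∀ i, ((z.1 i : Fin (N+1)) : ℕ) = x i := by
    intro x hx
    have hle : ∀ i, x i < N + 1 := fun i => by
      have := Finset.single_le_sum (f := x) (fun _ _ => Nat.zero_le _) (Finset.mem_univ i)
      omega
    exact ⟨⟨fun i => ⟨x i, hle i⟩, by simpa using hx⟩, fun i => rfl⟩
  obtain ⟨i0⟩ := id ‹Nonempty I›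
  haveI : Nonempty X := by
    obtain ⟨z, -⟩ := mk (fun i => if i = i0 then N else 0) (by simp)
    exact ⟨z⟩
  let e := Fintype.equivFin X
  let r : I → X → ℕ ×ₗ Fin (Fintype.card X) := fun i x => toLex (((x.1 i : Fin (N+1)) : ℕ), e x)
  have hr : ∀ i, Function.Injective (r i) := by
    intro i x y h
    have := congrArg (fun z => (ofLex z).2) h
    exact e.injective this
  have hrle : ∀ i x y, r i x ≤ r i y → ((x.1 i : Fin (N+1)) : ℕ) ≤ y.1 i := by
    intro i x y h
    rw [Prod.Lex.le_iff] at h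
    rcases h with h | h
    · exact h.le
    · exact h.1.le
  obtain ⟨S, hdom, hcol⟩ := scarf r hr (fun x => col (fun i => (x.1 i : ℕ)))
  let C := Finset.univ.filter (fun i : I => Sum.inr i ∉ S)
  have hCne : C.Nonempty := by
    obtain ⟨i, hi, -⟩ := hdom (Classical.arbitrary X)
    exact ⟨i, by simp [C, hi]⟩
  have hCcol : ∀ i ∈ C, ∃ x : X, Sum.inl x ∈ S ∧ col (fun i => (x.1 i : ℕ)) = i := by
    intro i hi
    rcases hcol i with h | h
    · exact absurd h (by simpa [C] using hi)
    · exact h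
  -- minimum
  have hmin : ∀ i, ∃ m : ℕ, (∀ x : X, Sum.inl x ∈ S → m ≤ x.1 i) ∧ ∃ x : X, Sum.inl x ∈ S ∧ ((x.1 i : Fin (N+1)) : ℕ) = m := by
    intro i
    obtain ⟨x, hx, hm⟩ := Finset.exists_min_image (Finset.univ.filter (fun x : X => Sum.inl x ∈ S))
      (fun x => ((x.1 i : Fin (N+1)) : ℕ)) (by
        obtain ⟨i, hi⟩ := hCne
        obtain ⟨x, hx, -⟩ := hCcol i hi
        exact ⟨x, by simp [hx]⟩)
    exact ⟨x.1 i, fun y hy => hm y (by simp [hy]), x, by simpa using hx, rfl⟩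
  choose m hm hm' using hmin
  have hbig : N < ∑ i ∈ C, (m i + 1) := by
    by_contra hle
    push Not at hle
    obtain ⟨c0, hc0⟩ := hCne
    obtain ⟨k, hk⟩ := Nat.exists_eq_add_of_le hle
    obtain ⟨z, hz⟩ := mk (fun i => (if i ∈ C then m i + 1 else 0) + if i = c0 then k else 0) (by
      rw [Finset.sum_add_distrib]
      simp only [Finset.sum_ite_mem, Finset.univ_inter, Finset.sum_ite_eq', Finset.mem_univ, if_true]
      omega)
    obtain ⟨i, hi, h⟩ := hdom z
    obtain ⟨x, hx, hxm⟩ := hm' i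
    have h1 := hrle i z x (h x hx)
    rw [hz, hxm] at h1
    have : i ∈ C := by simp [C, hi]
    simp [this] at h1
    omega
  rw [Finset.sum_add_distrib, Finset.sum_const, smul_eq_mul, mul_one] at hbig
  have hCc : C.card ≤ Fintype.card I := Finset.card_le_univ _
  have hsumC : ∀ x : X, Sum.inl x ∈ S → ∀ i, ((x.1 i : Fin (N+1)) : ℕ) ≤ (if i ∈ C then m i else 0) + Fintype.card I := by
    intro x hx i
    have h1 : ∑ j, (if j ∈ C then m j else 0) = ∑ j ∈ C, m j := by simp
    have h2 : ∀ j, (if j ∈ C then m j else 0) ≤ ((x.1 j : Fin (N+1)) : ℕ) := by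
      intro j; split_ifs
      · exact hm j x hx
      · exact Nat.zero_le _
    have h3 := x.2
    have h4 : ∑ j ∈ Finset.univ.erase i, (if j ∈ C then m j else 0) ≤ ∑ j ∈ Finset.univ.erase i, ((x.1 j : Fin (N+1)) : ℕ) :=
      Finset.sum_le_sum (fun j _ => h2 j)
    rw [← Finset.add_sum_erase _ _ (Finset.mem_univ i)] at h1 h3
    omega
  obtain ⟨c0, hc0⟩ := hCne
  obtain ⟨x0, hx0, -⟩ := hCcol c0 hc0
  refine ⟨fun i => x0.1 i, x0.2, fun i => ?_⟩
  by_cases hi : i ∈ C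
  · right
    obtain ⟨x, hx, hxc⟩ := hCcol i hi
    refine ⟨fun i => x.1 i, x.2, hxc, fun j => ?_⟩
    have a1 := hsumC x hx j
    have a2 := hsumC x0 hx0 j
    have a3 := hm j x hx
    have a4 := hm j x0 hx0
    refine ⟨?_, ?_⟩ <;> dsimp only <;> split_ifs at a1 a2 <;> omega
  · left
    have := hsumC x0 hx0 i
    simpa [hi] using this

lemma brouwer_approx [Nonempty I] (f : (I → ℝ) → (I → ℝ)) (hf : Continuous f)
    (hs : ∀ x, f x ∈ stdSimplex ℝ I) (ε : ℝ) (hε : 0 < ε) :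
    ∃ x ∈ stdSimplex ℝ I, ∀ i, x i - 2 * ε ≤ f x i := by
  have huc : UniformContinuousOn f (stdSimplex ℝ I) :=
    (isCompact_stdSimplex ℝ I).uniformContinuousOn_of_continuous hf.continuousOn
  rw [Metric.uniformContinuousOn_iff_le] at huc
  obtain ⟨δ, hδ, h⟩ := huc ε hε
  obtain ⟨N, hN⟩ := exists_nat_gt ((Fintype.card I : ℝ) / min δ ε)
  have hmin : 0 < min δ ε := lt_min hδ hε
  have hNpos : (0 : ℝ) < N := lt_of_le_of_lt (by positivity) hN
  have hMN : (Fintype.card I : ℝ) / N ≤ min δ ε := by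
    rw [div_lt_iff₀ hmin] at hN
    rw [div_le_iff₀ hNpos]; linarith
  let g : (I → ℕ) → (I → ℝ) := fun x i => (x i : ℝ) / N
  have hg : ∀ x : I → ℕ, ∑ i, x i = N → g x ∈ stdSimplex ℝ I := by
    intro x hx
    refine ⟨fun i => by simp only [g]; positivity, ?_⟩
    simp only [g]
    rw [← Finset.sum_div, ← Nat.cast_sum, hx, div_self hNpos.ne']
  have hcol : ∀ x : I → ℕ, ∃ i, (∑ i, x i = N → g x i ≤ f (g x) i) := by
    intro x
    by_cases hx : ∑ i, x i = N
    · by_contra hcon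
      push Not at hcon
      have h1 := (hg x hx).2
      have h2 := (hs (g x)).2
      have : ∑ i, f (g x) i < ∑ i, g x i :=
        Finset.sum_lt_sum_of_nonempty Finset.univ_nonempty (fun i _ => (hcon i).2)
      linarith
    · exact ⟨Classical.arbitrary I, fun h => absurd h hx⟩
  choose col hcol using hcol
  obtain ⟨x, hx, hxi⟩ := grid_step N col
  refine ⟨g x, hg x hx, fun i => ?_⟩
  rcases hxi i with h1 | ⟨x', hx', hc, hj⟩
  · have h2 := (hs (g x)).1 i
    have : g x i ≤ (Fintype.card I : ℝ) / N := by
      simp only [g]; gcongr; 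
    have := hMN.trans (min_le_right _ _)
    linarith
  · have hdist : ∀ j, |g x j - g x' j| ≤ min δ ε := by
      intro j
      refine le_trans ?_ hMN
      simp only [g]
      rw [← sub_div, abs_div, abs_of_pos hNpos]
      gcongr
      rw [abs_le]
      have e1 : (x j : ℝ) ≤ x' j + Fintype.card I := by exact_mod_cast (hj j).1
      have e2 : (x' j : ℝ) ≤ x j + Fintype.card I := by exact_mod_cast (hj j).2
      constructor <;> linarith
    have hd : dist (g x) (g x') ≤ δ := by
      rw [dist_pi_le_iff hδ.le]
      intro j
      rw [Real.dist_eq]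
      exact (hdist j).trans (min_le_left _ _)
    have h2 := h _ (hg x hx) _ (hg x' hx') hd
    have h3 : |f (g x) i - f (g x') i| ≤ ε := by
      rw [← Real.dist_eq]; exact (dist_le_pi_dist _ _ i).trans h2
    have h4 := hcol x' hx'
    rw [hc] at h4
    have h5 := (hdist i).trans (min_le_right _ _)
    rw [abs_le] at h3 h5
    linarith [h3.1, h5.2]

lemma brouwer_simplex [Nonempty I] (f : (I → ℝ) → (I → ℝ)) (hf : Continuous f)
    (hs : ∀ x, f x ∈ stdSimplex ℝ I) : ∃ x ∈ stdSimplex ℝ I, f x = x := by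
  let φ : (I → ℝ) → ℝ := fun x => ∑ i, max 0 (x i - f x i)
  have hφ : Continuous φ := by fun_prop
  have hne : (stdSimplex ℝ I).Nonempty := ⟨_, hs 0⟩
  obtain ⟨x, hx, hmin⟩ := (isCompact_stdSimplex ℝ I).exists_isMinOn hne hφ.continuousOn
  have hnn : ∀ i, 0 ≤ max 0 (x i - f x i) := fun i => le_max_left _ _
  have h0 : φ x ≤ 0 := by
    apply le_of_forall_pos_le_add
    intro ε hε
    have hc : (0 : ℝ) < Fintype.card I := by exact_mod_cast Fintype.card_pos
    obtain ⟨y, hy, hyi⟩ := brouwer_approx f hf hs (ε / (2 * Fintype.card I)) (by positivity)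
    refine (hmin hy).trans ?_
    have : φ y ≤ ∑ i : I, (ε / Fintype.card I) := by
      apply Finset.sum_le_sum
      intro i _
      apply max_le (by positivity)
      have := hyi i
      have e : 2 * (ε / (2 * (Fintype.card I : ℝ))) = ε / Fintype.card I := by field_simp
      linarith
    simp only [Finset.sum_const, Finset.card_univ, nsmul_eq_mul] at this
    rw [mul_div_cancel₀ _ hc.ne'] at this
    simpa using this
  have hall : ∀ i, x i ≤ f x i := by
    intro i
    have h1 : max 0 (x i - f x i) ≤ φ x :=
      Finset.single_le_sum (f := fun i => max 0 (x i - f x i)) (fun i _ => hnn i) (Finset.mem_univ i)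
    have := le_max_right 0 (x i - f x i)
    linarith
  refine ⟨x, hx, ?_⟩
  have hsum : ∑ i, x i = ∑ i, f x i := by rw [hx.2, (hs x).2]
  have := (Finset.sum_eq_sum_iff_of_le (fun i _ => hall i)).1 hsum
  ext i
  exact (this i (Finset.mem_univ i)).symm

/-- Brouwer for the cube `[0,1]^I`. -/
lemma brouwer_cube (g : (I → ℝ) → (I → ℝ)) (hg : Continuous g)
    (h0 : ∀ x i, 0 ≤ g x i) (h1 : ∀ x i, g x i ≤ 1) : ∃ x, g x = x := by
  rcases isEmpty_or_nonempty I with hI | hI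
  · exact ⟨0, Subsingleton.elim _ _⟩
  obtain ⟨k, hk⟩ : ∃ k : ℝ, k = (Fintype.card I : ℝ) := ⟨_, rfl⟩
  have hkpos : 0 < k := by rw [hk]; exact_mod_cast Fintype.card_pos
  let cl : (Option I → ℝ) → (I → ℝ) := fun z i => k * z (some i)
  have hcl : Continuous cl := by fun_prop
  let f : (Option I → ℝ) → (Option I → ℝ) := fun z o =>
    Option.elim o (1 - ∑ i, g (cl z) i / k) (fun i => g (cl z) i / k)
  have hf : Continuous f := by
    apply continuous_pi
    rintro (_ | i)
    · simp only [f, Option.elim]; fun_prop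
    · simp only [f, Option.elim]; fun_prop
  have hs : ∀ z, f z ∈ stdSimplex ℝ (Option I) := by
    intro z
    refine ⟨?_, ?_⟩
    · rintro (_ | i)
      · simp only [f, Option.elim]
        have : ∑ i, g (cl z) i / k ≤ ∑ i : I, 1 / k := by
          apply Finset.sum_le_sum
          intro i _
          gcongr
          exact h1 _ _
        simp only [Finset.sum_const, Finset.card_univ, nsmul_eq_mul] at this
        rw [← hk, mul_one_div_cancel hkpos.ne'] at this
        linarith
      · simp only [f, Option.elim]
        exact div_nonneg (h0 _ _) hkpos.le
    · rw [Fintype.sum_option]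
      simp [f]
  obtain ⟨z, hz, hfz⟩ := brouwer_simplex f hf hs
  refine ⟨cl z, ?_⟩
  ext i
  have := congrFun hfz (some i)
  simp only [f, Option.elim] at this
  simp only [cl]
  rw [← this]
  field_simp
  rfl

lemma vi (H : (I → ℝ) → (I → ℝ)) (hH : Continuous H) :
    ∃ x : I → ℝ, (∀ i, -1 ≤ x i ∧ x i ≤ 1) ∧ ∀ i, (H x i < 0 → x i = 1) ∧ (0 < H x i → x i = -1) := by
  let a : (I → ℝ) → (I → ℝ) := fun u i => 2 * u i - 1
  let g : (I → ℝ) → (I → ℝ) := fun u i => max 0 (min 1 (u i - H (a u) i))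
  have hg : Continuous g := by fun_prop
  obtain ⟨u, hu⟩ := brouwer_cube g hg (fun x i => le_max_left _ _)
    (fun x i => max_le zero_le_one (min_le_left _ _))
  refine ⟨a u, fun i => ?_, fun i => ?_⟩ <;> have hi : max 0 (min 1 (u i - H (a u) i)) = u i := congrFun hu i
  · have e1 : 0 ≤ u i := by rw [← hi]; exact le_max_left _ _
    have e2 : u i ≤ 1 := by rw [← hi]; exact max_le zero_le_one (min_le_left _ _)
    constructor <;> simp only [a] <;> linarith
  · constructor
    · intro h
      have : u i = 1 := by
        rcases max_cases 0 (min 1 (u i - H (a u) i)) with h1 | h1 <;>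
        rcases min_cases 1 (u i - H (a u) i) with h2 | h2 <;> linarith
      show 2 * u i - 1 = 1
      linarith
    · intro h
      have : u i = 0 := by
        rcases max_cases 0 (min 1 (u i - H (a u) i)) with h1 | h1 <;>
        rcases min_cases 1 (u i - H (a u) i) with h2 | h2 <;> linarith
      show 2 * u i - 1 = -1
      linarith
end Brouwer
end SW

set_option linter.unusedSectionVars false
namespace SW
section Arcs
variable {L : ℝ} [hL : Fact (0 < L)]

/-- half-open arc -/
def arc (L a b : ℝ) : Set (AddCircle L) := (fun x : ℝ => (x : AddCircle L)) '' Set.Ico a b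

lemma coe_eq_iff (x y : ℝ) : (x : AddCircle L) = y ↔ ∃ k : ℤ, y = x + k * L := by
  rw [eq_comm, ← sub_eq_zero, ← AddCircle.coe_sub, AddCircle.coe_eq_zero_iff]
  constructor
  · rintro ⟨k, hk⟩
    refine ⟨k, ?_⟩
    rw [zsmul_eq_mul] at hk; linarith
  · rintro ⟨k, hk⟩
    refine ⟨k, ?_⟩
    rw [zsmul_eq_mul]; linarith

lemma exists_rep (a : ℝ) (z : AddCircle L) : ∃ x : ℝ, (x : AddCircle L) = z ∧ a ≤ x ∧ x < a + L := by
  obtain ⟨y, rfl⟩ := QuotientAddGroup.mk_surjective z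
  obtain ⟨k, hk, -⟩ := existsUnique_add_zsmul_mem_Ico hL.out y a
  refine ⟨y + k • L, ?_, hk.1, hk.2⟩
  symm
  exact (coe_eq_iff y _).2 ⟨k, by simp⟩

lemma mem_arc_iff {x a b : ℝ} (h : x - L < a) (h' : a ≤ x) : (x : AddCircle L) ∈ arc L a b ↔ x < b := by
  constructor
  · rintro ⟨y, ⟨h1, h2⟩, h3⟩
    obtain ⟨k, hk⟩ := (coe_eq_iff y x).1 h3
    have hLp := hL.out
    by_contra hx
    push Not at hx
    have : (0 : ℝ) < k := by
      by_contra hk0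
      push Not at hk0
      nlinarith
    have : (1 : ℤ) ≤ k := by
      have : (0 : ℤ) < k := by exact_mod_cast this
      omega
    have : (1 : ℝ) ≤ k := by exact_mod_cast this
    nlinarith
  · intro hx
    exact ⟨x, ⟨h', hx⟩, rfl⟩

lemma arc_meas (a b : ℝ) : MeasurableSet (arc L a b) := by
  rcases le_or_gt b a with h | h
  · simp [arc, Set.Ico_eq_empty_of_le h]
  · unfold arc
    rw [← Set.Ioo_insert_left h, Set.image_insert_eq]
    apply MeasurableSet.insert
    exact ((QuotientAddGroup.isOpenMap_coe (N := AddSubgroup.zmultiples L)) _ isOpen_Ioo).measurableSet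

lemma arc_empty {a b : ℝ} (h : b ≤ a) : arc L a b = ∅ := by
  simp [arc, Set.Ico_eq_empty_of_le h]

lemma arc_full {a b : ℝ} (h : a + L ≤ b) : arc L a b = Set.univ := by
  ext z
  obtain ⟨x, rfl, h1, h2⟩ := exists_rep a z
  simp only [Set.mem_univ, iff_true]
  exact ⟨x, ⟨h1, by linarith⟩, rfl⟩

lemma arc_shift (a b : ℝ) (k : ℤ) : arc L (a + k * L) (b + k * L) = arc L a b := by
  ext z
  constructor
  · rintro ⟨x, ⟨h1, h2⟩, rfl⟩
    refine ⟨x - k * L, ⟨by linarith, by linarith⟩, ?_⟩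
    exact (coe_eq_iff _ _).2 ⟨k, by ring⟩
  · rintro ⟨x, ⟨h1, h2⟩, rfl⟩
    refine ⟨x + k * L, ⟨by linarith, by linarith⟩, ?_⟩
    exact ((coe_eq_iff _ _).2 ⟨k, by ring⟩).symm

lemma arc_add {a b c : ℝ} (hab : a ≤ b) (hbc : b ≤ c) (hc : c ≤ a + L) :
    arc L a b ∪ arc L b c = arc L a c ∧ Disjoint (arc L a b) (arc L b c) := by
  have key : ∀ z : AddCircle L, ((z ∈ arc L a b ∨ z ∈ arc L b c) ↔ z ∈ arc L a c) ∧
      ¬ (z ∈ arc L a b ∧ z ∈ arc L b c) := by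
    intro z
    obtain ⟨x, rfl, h1, h2⟩ := exists_rep a z
    rw [mem_arc_iff (by linarith) h1, mem_arc_iff (by linarith) h1]
    rcases le_or_gt b x with h | h
    · rw [mem_arc_iff (by linarith) h]
      constructor
      · constructor
        · rintro (h | h) <;> linarith
        · exact Or.inr
      · rintro ⟨h3, h4⟩; linarith
    · have e : (x : AddCircle L) = ((x + L : ℝ) : AddCircle L) := (coe_eq_iff _ _).2 ⟨1, by simp⟩
      have : ¬ ((x : AddCircle L) ∈ arc L b c) := by
        rw [e, mem_arc_iff (by linarith) (by linarith)]; linarith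
      simp only [this, or_false, and_false, not_false_eq_true, and_true]
      constructor
      · intro h; linarith
      · intro _; exact h
  constructor
  · ext z; exact (key z).1
  · rw [Set.disjoint_left]
    intro z h1 h2; exact (key z).2 ⟨h1, h2⟩

lemma arc_merge {a b a' b' : ℝ} (h : ¬ Disjoint (arc L a b) (arc L a' b')) :
    ∃ e, arc L a b ∪ arc L a' b' = arc L a e ∨ arc L a b ∪ arc L a' b' = arc L a' e := by
  rw [Set.not_disjoint_iff] at h
  obtain ⟨z, ⟨x, ⟨h1, h2⟩, h3⟩, ⟨x', ⟨h1', h2'⟩, h3'⟩⟩ := h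
  obtain ⟨k, hk⟩ := (coe_eq_iff x x').1 (h3.trans h3'.symm)
  have gen : ∀ a b c d y : ℝ, a ≤ y → y < b → c ≤ y → y < d →
      arc L a b ∪ arc L c d = arc L (min a c) (max b d) := by
    intro a b c d y h1 h2 h3 h4
    unfold arc
    rw [← Set.image_union, Set.Ico_union_Ico']
    · linarith
    · linarith
  have e1 := gen a b (a' - k * L) (b' - k * L) x h1 h2 (by linarith) (by linarith)
  have e2 : arc L (a' - k * L) (b' - k * L) = arc L a' b' := by
    rw [← arc_shift a' b' (-k)]; push_cast; ring_nf
  rw [e2] at e1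
  rcases min_choice a (a' - k * L) with hm | hm
  · exact ⟨_, Or.inl (by rw [e1, hm])⟩
  · refine ⟨max b (b' - k * L) + k * L, Or.inr ?_⟩
    rw [e1, hm, ← arc_shift _ _ k]; ring_nf

variable (μ : Measure (AddCircle L)) [IsFiniteMeasure μ]

lemma union_meas {V : Type} [Finite V] (a b : V → ℝ) : MeasurableSet (⋃ v, arc L (a v) (b v)) :=
  MeasurableSet.iUnion (fun v => arc_meas _ _)

lemma ev_mem (z : AddCircle L) {V : Type} [Finite V] (a b : V → ℝ) (v : V)
    (ha : z ≠ (a v : AddCircle L)) (hb : z ≠ (b v : AddCircle L)) :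
    ∀ᶠ q : (V → ℝ) × (V → ℝ) in nhds (a, b), (z ∈ arc L (q.1 v) (q.2 v) ↔ z ∈ arc L (a v) (b v)) := by
  obtain ⟨x, rfl, h1, h2⟩ := exists_rep (a v) z
  have h1' : a v < x := lt_of_le_of_ne h1 (fun h => ha (by rw [h]))
  have hb' : x ≠ b v := fun h => hb (by rw [h])
  have c1 : Continuous (fun q : (V → ℝ) × (V → ℝ) => q.1 v) := by fun_prop
  have c2 : Continuous (fun q : (V → ℝ) × (V → ℝ) => q.2 v) := by fun_prop
  have t1 := c1.tendsto (a, b)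
  have t2 := c2.tendsto (a, b)
  have e1 := t1.eventually (gt_mem_nhds h1')
  have e2 := t1.eventually (lt_mem_nhds (show x - L < a v by linarith))
  rw [mem_arc_iff (by linarith) h1]
  rcases lt_or_gt_of_ne hb' with h | h
  · filter_upwards [e1, e2, t2.eventually (lt_mem_nhds h)] with q q1 q2 q3
    rw [mem_arc_iff q2 q1.le]
    exact ⟨fun _ => h, fun _ => q3⟩
  · filter_upwards [e1, e2, t2.eventually (gt_mem_nhds h)] with q q1 q2 q3
    rw [mem_arc_iff q2 q1.le]
    constructor <;> intro h <;> linarith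

lemma theta_cont (hna : ∀ x, μ {x} = 0) {V : Type} [Finite V] :
    Continuous (fun q : (V → ℝ) × (V → ℝ) => μ.real (⋃ v, arc L (q.1 v) (q.2 v))) := by
  cases nonempty_fintype V
  rw [continuous_iff_continuousAt]
  rintro ⟨a, b⟩
  have := tendsto_measure_of_ae_tendsto_indicator_of_isFiniteMeasure (nhds (a, b)) (μ := μ)
    (As := fun q : (V → ℝ) × (V → ℝ) => ⋃ v, arc L (q.1 v) (q.2 v))
    (A := ⋃ v, arc L (a v) (b v)) (union_meas _ _) (fun q => union_meas _ _) (by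
      have : ∀ᵐ z ∂μ, ∀ v, z ≠ (a v : AddCircle L) ∧ z ≠ (b v : AddCircle L) := by
        rw [ae_all_iff]
        intro v
        rw [Filter.eventually_and]
        constructor <;> (rw [ae_iff]; simp [hna])
      filter_upwards [this] with z hz
      have := Filter.eventually_all.2 (fun v => ev_mem z a b v (hz v).1 (hz v).2)
      filter_upwards [this] with q hq
      simp only [Set.mem_iUnion]
      exact exists_congr hq)
  exact (ENNReal.tendsto_toReal (measure_ne_top _ _)).comp this

lemma icc_eq (hna : ∀ x, μ {x} = 0) {V : Type} [Finite V] (a b : V → ℝ) :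
    μ (⋃ v, (fun x : ℝ => (x : AddCircle L)) '' Set.Icc (a v) (b v)) = μ (⋃ v, arc L (a v) (b v)) := by
  cases nonempty_fintype V
  apply le_antisymm
  · have : (⋃ v, (fun x : ℝ => (x : AddCircle L)) '' Set.Icc (a v) (b v)) ⊆
        (⋃ v, arc L (a v) (b v)) ∪ ⋃ v, {(b v : AddCircle L)} := by
      intro z hz
      simp only [Set.mem_iUnion] at hz
      obtain ⟨v, x, ⟨h1, h2⟩, rfl⟩ := hz
      rcases h2.lt_or_eq with h | h
      · left
        exact Set.mem_iUnion.2 ⟨v, x, ⟨h1, h⟩, rfl⟩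
      · right
        exact Set.mem_iUnion.2 ⟨v, by simp [h]⟩
    refine (measure_mono this).trans ((measure_union_le _ _).trans ?_)
    have h0 : μ (⋃ v, {(b v : AddCircle L)}) = 0 := by
      rw [measure_iUnion_null_iff]
      intro v; exact hna _
    rw [h0, add_zero]
  · apply measure_mono
    apply Set.iUnion_mono
    intro v
    exact Set.image_mono Set.Ico_subset_Icc_self
end Arcs
end SW

set_option linter.unusedSectionVars false
namespace SW
section Nu
variable {L : ℝ} [hL : Fact (0 < L)] {n : ℕ} (μ : Fin (n + 1) → Measure (AddCircle L))
  [hp : ∀ i, IsProbabilityMeasure (μ i)]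

/-- weighted combination of differences -/
noncomputable def nu (c : Fin n → ℝ) (A : Set (AddCircle L)) : ℝ :=
  ∑ i, c i * ((μ i.succ).real A - (μ 0).real A)

lemma nu_union (c : Fin n → ℝ) {A B : Set (AddCircle L)} (h : Disjoint A B) (hB : MeasurableSet B) :
    nu μ c (A ∪ B) = nu μ c A + nu μ c B := by
  unfold nu
  rw [← Finset.sum_add_distrib]
  apply Finset.sum_congr rfl
  intro i _
  rw [measureReal_union h hB, measureReal_union h hB]
  ring

lemma nu_univ (c : Fin n → ℝ) : nu μ c Set.univ = 0 := by
  simp [nu]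

lemma nu_empty (c : Fin n → ℝ) : nu μ c ∅ = 0 := by
  simp [nu]

lemma nu_biUnion (c : Fin n → ℝ) (T : Finset (ℝ × ℝ))
    (h : (T : Set (ℝ × ℝ)).PairwiseDisjoint (fun q => arc L q.1 q.2)) :
    nu μ c (⋃ q ∈ T, arc L q.1 q.2) = ∑ q ∈ T, nu μ c (arc L q.1 q.2) := by
  unfold nu
  rw [Finset.sum_comm]
  apply Finset.sum_congr rfl
  intro i _
  rw [measureReal_biUnion_finset h (fun q _ => arc_meas _ _),
    measureReal_biUnion_finset h (fun q _ => arc_meas _ _), ← Finset.sum_sub_distrib, Finset.mul_sum]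

lemma nu_diff (c c' : Fin n → ℝ) (δ : ℝ) (h : ∀ i, |c i - c' i| ≤ δ) (A : Set (AddCircle L)) :
    nu μ c' A - n * δ ≤ nu μ c A := by
  have : ∑ i : Fin n, (-δ) ≤ nu μ c A - nu μ c' A := by
    unfold nu
    rw [← Finset.sum_sub_distrib]
    apply Finset.sum_le_sum
    intro i _
    have h1 : |(μ i.succ).real A - (μ 0).real A| ≤ 1 := by
      have a1 := measureReal_le_one (μ := μ i.succ) (s := A)
      have a2 := measureReal_le_one (μ := μ 0) (s := A)
      have a3 := measureReal_nonneg (μ := μ i.succ) (s := A)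
      have a4 := measureReal_nonneg (μ := μ 0) (s := A)
      rw [abs_le]; constructor <;> linarith
    have h2 : |(c i - c' i) * ((μ i.succ).real A - (μ 0).real A)| ≤ δ := by
      rw [abs_mul]
      have := h i
      have := abs_nonneg (c i - c' i)
      nlinarith [abs_nonneg ((μ i.succ).real A - (μ 0).real A)]
    have := (abs_le.1 h2).1
    linarith
  simp at this
  linarith

lemma nu_merge (c : Fin n → ℝ) (δ : ℝ) (hδ : 0 ≤ δ) (m : ℕ) : ∀ (T : Finset (ℝ × ℝ)), T.card ≤ m →
    (∀ q ∈ T, ∀ e, -δ ≤ nu μ c (arc L q.1 e)) → -(m * δ) ≤ nu μ c (⋃ q ∈ T, arc L q.1 q.2) := by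
  induction m with
  | zero =>
    intro T hT _
    have : T = ∅ := by simpa using hT
    subst this
    simp [nu_empty]
  | succ m ih =>
    intro T hT hq
    by_cases hd : (T : Set (ℝ × ℝ)).PairwiseDisjoint (fun q => arc L q.1 q.2)
    · rw [nu_biUnion μ c T hd]
      have h1 : ∑ q ∈ T, (-δ) ≤ ∑ q ∈ T, nu μ c (arc L q.1 q.2) :=
        Finset.sum_le_sum (fun q h => hq q h _)
      refine le_trans ?_ h1
      simp only [Finset.sum_const, nsmul_eq_mul]
      have : (T.card : ℝ) ≤ (m + 1 : ℕ) := by exact_mod_cast hT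
      nlinarith
    · unfold Set.PairwiseDisjoint Set.Pairwise at hd
      push Not at hd
      obtain ⟨q, hqT, q', hqT', hne, hnd⟩ := hd
      have hqT : q ∈ T := hqT
      have hqT' : q' ∈ T := hqT'
      have hm : ∃ r : ℝ × ℝ, (∀ e, -δ ≤ nu μ c (arc L r.1 e)) ∧
          arc L q.1 q.2 ∪ arc L q'.1 q'.2 = arc L r.1 r.2 := by
        obtain ⟨e, he | he⟩ := arc_merge hnd
        · exact ⟨(q.1, e), hq q hqT, he⟩
        · exact ⟨(q'.1, e), hq q' hqT', he⟩
      obtain ⟨r, hr, hru⟩ := hm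
      obtain ⟨R, hR⟩ : ∃ R, R = (T.erase q).erase q' := ⟨_, rfl⟩
      have hmemR : ∀ x, x ∈ T ↔ x = q ∨ x = q' ∨ x ∈ R := by
        intro x
        rw [hR, Finset.mem_erase, Finset.mem_erase]
        constructor
        · intro h
          by_cases h1 : x = q
          · exact Or.inl h1
          · by_cases h2 : x = q'
            · exact Or.inr (Or.inl h2)
            · exact Or.inr (Or.inr ⟨h2, h1, h⟩)
        · rintro (rfl | rfl | h)
          · exact hqT
          · exact hqT'
          · exact h.2.2
      have hu : (⋃ q ∈ T, arc L q.1 q.2) = ⋃ q ∈ insert r R, arc L q.1 q.2 := by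
        ext z
        have hz : z ∈ arc L q.1 q.2 ∪ arc L q'.1 q'.2 ↔ z ∈ arc L r.1 r.2 := by rw [hru]
        rw [Set.mem_union] at hz
        simp only [Set.mem_iUnion, exists_prop]
        constructor
        · rintro ⟨x, hx, hzx⟩
          rcases (hmemR x).1 hx with rfl | rfl | h
          · exact ⟨r, Finset.mem_insert_self _ _, hz.1 (Or.inl hzx)⟩
          · exact ⟨r, Finset.mem_insert_self _ _, hz.1 (Or.inr hzx)⟩
          · exact ⟨x, Finset.mem_insert_of_mem h, hzx⟩
        · rintro ⟨x, hx, hzx⟩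
          rcases Finset.mem_insert.1 hx with rfl | h
          · rcases hz.2 hzx with h | h
            · exact ⟨q, hqT, h⟩
            · exact ⟨q', hqT', h⟩
          · exact ⟨x, (hmemR x).2 (Or.inr (Or.inr h)), hzx⟩
      rw [hu]
      refine le_trans ?_ (ih _ ?_ ?_)
      · push_cast; linarith
      · refine (Finset.card_insert_le _ _).trans ?_
        rw [hR, Finset.card_erase_of_mem (Finset.mem_erase.2 ⟨hne.symm, hqT'⟩), Finset.card_erase_of_mem hqT]
        have : 1 < T.card := Finset.one_lt_card.2 ⟨q, hqT, q', hqT', hne⟩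
        omega
      · intro x hx
        rw [Finset.mem_insert] at hx
        rcases hx with rfl | hx
        · exact hr
        · exact hq x ((hmemR x).2 (Or.inr (Or.inr hx)))

lemma good_start (hna : ∀ i x, μ i {x} = 0) (c : Fin n → ℝ) :
    ∃ p : ℝ, 0 ≤ p ∧ p ≤ L ∧ ∀ e, 0 ≤ nu μ c (arc L p e) := by
  have hLp := hL.out
  have hc : Continuous (fun t : ℝ => nu μ c (arc L 0 t)) := by
    unfold nu
    have : ∀ i, Continuous (fun t : ℝ => (μ i).real (arc L 0 t)) := by
      intro i
      have h1 := theta_cont (μ i) (hna i) (V := Unit)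
      have h2 : Continuous (fun t : ℝ => ((fun _ : Unit => (0 : ℝ)), (fun _ : Unit => t))) := by fun_prop
      have h3 := h1.comp h2
      simpa [Function.comp_def, Set.iUnion_const] using h3
    fun_prop
  obtain ⟨p, ⟨hp0, hpL⟩, hmin⟩ := (isCompact_Icc (a := (0 : ℝ)) (b := L)).exists_isMinOn
    ⟨0, by simp [hLp.le]⟩ hc.continuousOn
  have hmin : ∀ t, 0 ≤ t → t ≤ L → nu μ c (arc L 0 p) ≤ nu μ c (arc L 0 t) :=
    fun t h1 h2 => hmin ⟨h1, h2⟩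
  refine ⟨p, hp0, hpL, fun e => ?_⟩
  have add : ∀ a b d : ℝ, a ≤ b → b ≤ d → d ≤ a + L → nu μ c (arc L a d) = nu μ c (arc L a b) + nu μ c (arc L b d) := by
    intro a b d h1 h2 h3
    obtain ⟨h4, h5⟩ := arc_add h1 h2 h3
    rw [← h4, nu_union μ c h5 (arc_meas _ _)]
  rcases le_or_gt e p with h | h
  · rw [arc_empty h, nu_empty]
  rcases le_or_gt (p + L) e with h' | h'
  · rw [arc_full h', nu_univ]
  rcases le_or_gt e L with h2 | h2
  · have := add 0 p e hp0 h.le (by linarith)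
    have := hmin e (by linarith) h2
    linarith
  · have a1 := add 0 (e - L) p (by linarith) (by linarith) (by linarith)
    have a2 := add p e (p + L) h.le h'.le le_rfl
    rw [arc_full le_rfl, nu_univ] at a2
    have a3 : arc L e (p + L) = arc L (e - L) p := by
      have := arc_shift (L := L) (e - L) p 1
      rw [← this]; simp
    rw [a3] at a2
    have := hmin (e - L) (by linarith) (by linarith)
    linarith
end Nu
end SW

set_option linter.unusedSectionVars false
namespace SW
section Grid
variable {n : ℕ}

noncomputable def eLo (v : Fin n → ℤ) (u : Fin n → ℝ) (o : Option (Fin n)) : ℝ :=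
  o.elim 0 (fun i => v i - u i)
noncomputable def eHi (v : Fin n → ℤ) (u : Fin n → ℝ) (o : Option (Fin n)) : ℝ :=
  o.elim 1 (fun i => v i + 1 - u i)
noncomputable def lo (v : Fin n → ℤ) (u : Fin n → ℝ) : ℝ :=
  Finset.univ.sup' Finset.univ_nonempty (eLo v u)
noncomputable def hi (v : Fin n → ℤ) (u : Fin n → ℝ) : ℝ :=
  Finset.univ.inf' Finset.univ_nonempty (eHi v u)
noncomputable def ww (v : Fin n → ℤ) (u : Fin n → ℝ) : ℝ := max 0 (hi v u - lo v u)

/-- the box of grid points -/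
noncomputable def box (n N : ℕ) : Finset (Fin n → ℤ) := Finset.Icc (fun _ => -(N : ℤ)) (fun _ => (N : ℤ))

lemma ww_cont (v : Fin n → ℤ) : Continuous (ww v) := by
  have h1 : Continuous (lo v) := by
    unfold lo
    apply Continuous.finset_sup'_apply
    rintro (_ | i) _
    · simp only [eLo, Option.elim]; fun_prop
    · simp only [eLo, Option.elim]; fun_prop
  have h2 : Continuous (hi v) := by
    unfold hi
    apply Continuous.finset_inf'_apply
    rintro (_ | i) _
    · simp only [eHi, Option.elim]; fun_prop
    · simp only [eHi, Option.elim]; fun_prop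
  unfold ww
  fun_prop

lemma ww_nonneg (v : Fin n → ℤ) (u : Fin n → ℝ) : 0 ≤ ww v u := le_max_left _ _

lemma eLo_le (v : Fin n → ℤ) (u : Fin n → ℝ) (o) : eLo v u o ≤ lo v u :=
  Finset.le_sup' (eLo v u) (Finset.mem_univ o)
lemma le_eHi (v : Fin n → ℤ) (u : Fin n → ℝ) (o) : hi v u ≤ eHi v u o :=
  Finset.inf'_le (eHi v u) (Finset.mem_univ o)

lemma ww_pos (v : Fin n → ℤ) (u : Fin n → ℝ) (h : 0 < ww v u) :
    ∃ t : ℝ, (t = 0 ∨ ∃ j, t = Int.fract (-u j)) ∧ ∀ i, v i = ⌊u i + t⌋ := by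
  have hlt : lo v u < hi v u := by
    rcases lt_max_iff.1 h with h | h
    · exact absurd h (lt_irrefl _)
    · linarith
  have fl : ∀ i, v i = ⌊u i + lo v u⌋ := by
    intro i
    symm
    rw [Int.floor_eq_iff]
    have h1 := eLo_le v u (some i)
    have h2 := le_eHi v u (some i)
    simp only [eLo, eHi, Option.elim] at h1 h2
    constructor <;> linarith
  refine ⟨lo v u, ?_, fl⟩
  obtain ⟨o, -, ho⟩ := Finset.exists_mem_eq_sup' (Finset.univ_nonempty) (eLo v u)
  change lo v u = _ at ho
  rcases o with _ | j
  · left; rw [ho]; rfl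
  · right
    refine ⟨j, ?_⟩
    have h1 := eLo_le v u none
    have h2 := le_eHi v u none
    simp only [eLo, eHi, Option.elim] at h1 h2 ho
    symm
    rw [Int.fract_eq_iff]
    refine ⟨h1, by linarith, -v j, ?_⟩
    rw [ho]; push_cast; ring

lemma mem_box {N : ℕ} {u : Fin n → ℝ} (hu : ∀ i, |u i| ≤ N) {t : ℝ} (h0 : 0 ≤ t) (h1 : t < 1) :
    (fun i => ⌊u i + t⌋) ∈ box n N := by
  unfold box
  rw [Finset.mem_Icc]
  constructor
  · intro i
    have := (abs_le.1 (hu i)).1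
    simp only
    rw [Int.le_floor]; push_cast; linarith
  · intro i
    have := (abs_le.1 (hu i)).2
    have : ⌊u i + t⌋ < (N : ℤ) + 1 := by
      rw [Int.floor_lt]; push_cast; linarith
    simp only
    omega

lemma exists_g {N : ℕ} {u : Fin n → ℝ} (hu : ∀ i, |u i| ≤ N) (i0 : Fin n) (k : ℤ) (hk : u i0 = k) :
    ∃ g : Fin n → box n N, (∀ v : box n N, 0 < ww v.1 u → ∃ j, v = g j) ∧
      ∀ j i, |u i - (g j).1 i| ≤ 1 := by
  refine ⟨fun j => ⟨fun i => ⌊u i + Int.fract (-u j)⌋, mem_box hu (Int.fract_nonneg _) (Int.fract_lt_one _)⟩, ?_, ?_⟩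
  · intro v hv
    obtain ⟨t, ht, h⟩ := ww_pos v.1 u hv
    have : ∃ j, t = Int.fract (-u j) := by
      rcases ht with rfl | h
      · refine ⟨i0, ?_⟩
        rw [hk, ← Int.cast_neg, Int.fract_intCast]
      · exact h
    obtain ⟨j, rfl⟩ := this
    refine ⟨j, ?_⟩
    ext i
    exact h i
  · intro j i
    have h1 := Int.floor_le (u i + Int.fract (-u j))
    have h2 := Int.lt_floor_add_one (u i + Int.fract (-u j))
    have h3 := Int.fract_nonneg (-u j)
    have h4 := Int.fract_lt_one (-u j)
    simp only
    rw [abs_le]; constructor <;> linarith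

lemma exists_big {N : ℕ} {u : Fin n → ℝ} (hu : ∀ i, |u i| ≤ N) :
    ∃ v : box n N, 1 ≤ (box n N).card * ww v.1 u := by
  by_contra hcon
  push Not at hcon
  have hsub : Set.Ico (0 : ℝ) 1 ⊆ ⋃ v ∈ box n N, Set.Icc (lo v u) (hi v u) := by
    rintro t ⟨h0, h1⟩
    rw [Set.mem_iUnion₂]
    refine ⟨_, mem_box hu h0 h1, ?_, ?_⟩
    · apply Finset.sup'_le
      rintro (_ | i) _
      · simpa [eLo] using h0
      · simp only [eLo, Option.elim]
        have := Int.floor_le (u i + t)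
        linarith
    · apply Finset.le_inf'
      rintro (_ | i) _
      · simpa [eHi] using h1.le
      · simp only [eHi, Option.elim]
        have := Int.lt_floor_add_one (u i + t)
        linarith
  have hm := (measure_mono (μ := volume) hsub).trans (measure_biUnion_finset_le _ _)
  simp only [Real.volume_Ico, Real.volume_Icc, sub_zero] at hm
  have h2 : ∑ v ∈ box n N, ENNReal.ofReal (hi v u - lo v u) ≤ ∑ v ∈ box n N, ENNReal.ofReal (ww v u) :=
    Finset.sum_le_sum (fun v _ => ENNReal.ofReal_le_ofReal (le_max_right _ _))
  have h3 := hm.trans h2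
  rw [← ENNReal.ofReal_sum_of_nonneg (fun v _ => ww_nonneg v u),
    ENNReal.ofReal_le_ofReal_iff (Finset.sum_nonneg (fun v _ => ww_nonneg v u))] at h3
  have hne : (box n N).Nonempty := ⟨_, mem_box hu le_rfl one_pos⟩
  have hc : (0 : ℝ) < (box n N).card := by exact_mod_cast hne.card_pos
  have h4 : ∑ v ∈ box n N, ww v u < ∑ v ∈ box n N, 1 / ((box n N).card : ℝ) := by
    apply Finset.sum_lt_sum_of_nonempty hne
    intro v hv
    rw [lt_div_iff₀ hc, mul_comm]
    exact hcon ⟨v, hv⟩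
  rw [Finset.sum_const, nsmul_eq_mul, mul_one_div_cancel hc.ne'] at h4
  linarith
end Grid
end SW

set_option linter.unusedSectionVars false
namespace SW
section Main
variable {L : ℝ} [hL : Fact (0 < L)] {n : ℕ} (μ : Fin (n + 1) → Measure (AddCircle L))
  [hp : ∀ i, IsProbabilityMeasure (μ i)]

lemma approx (hn : 0 < n) (hna : ∀ i x, μ i {x} = 0) (lam : ℝ) (hl0 : 0 ≤ lam) (hl1 : lam ≤ 1)
    (N : ℕ) (hN : 0 < N) :
    ∃ a l : Fin n → ℝ, (∀ j, 0 ≤ a j ∧ a j ≤ L) ∧ (∀ j, 0 ≤ l j ∧ l j ≤ L) ∧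
      ∀ i, |(μ i).real (⋃ j, arc L (a j) (a j + l j)) - lam| ≤ n * (n / N) := by
  have hLp := hL.out
  have hNp : (0 : ℝ) < N := by exact_mod_cast hN
  choose p hp0 hpL hpg using fun v : box n N => good_start μ hna (fun i => (v.1 i : ℝ) / N)
  obtain ⟨M, hM⟩ : ∃ M : ℝ, M = (box n N).card := ⟨_, rfl⟩
  -- functions of x
  let yh : (Fin (n + 1) → ℝ) → Fin n → ℝ := fun x i => max (-1) (min 1 (2 * x i.succ))
  let u : (Fin (n + 1) → ℝ) → Fin n → ℝ := fun x i => N * yh x i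
  let s : (Fin (n + 1) → ℝ) → ℝ := fun x => max 0 (2 * ‖(fun i : Fin n => x i.succ)‖ - 1)
  let a : (Fin (n + 1) → ℝ) → box n N → ℝ := fun x v => s x * p v
  let l : (Fin (n + 1) → ℝ) → box n N → ℝ := fun x v => min L (M * L * (x 0 + 1) * ww v.1 (u x))
  let K : (Fin (n + 1) → ℝ) → Set (AddCircle L) := fun x => ⋃ v, arc L (a x v) (a x v + l x v)
  have cy : Continuous yh := by fun_prop
  have cu : Continuous u := by fun_prop
  have cs : Continuous s := by fun_prop
  have ca : Continuous a := by fun_prop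
  have cw : ∀ v : box n N, Continuous (fun x => ww v.1 (u x)) := fun v => (ww_cont v.1).comp cu
  have cl : Continuous l := by fun_prop
  have cK : ∀ i, Continuous (fun x => (μ i).real (K x)) := by
    intro i
    have h2 : Continuous (fun x => (a x, fun v => a x v + l x v)) := by fun_prop
    exact (theta_cont (μ i) (hna i) (V := box n N)).comp h2
  let H : (Fin (n + 1) → ℝ) → (Fin (n + 1) → ℝ) := fun x =>
    Fin.cons ((μ 0).real (K x) - lam) (fun i => (μ i.succ).real (K x) - (μ 0).real (K x))
  have cH : Continuous H := by
    apply continuous_pi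
    intro i
    refine Fin.cases ?_ (fun i => ?_) i
    · simp only [H, Fin.cons_zero]; fun_prop
    · simp only [H, Fin.cons_succ]; fun_prop
  obtain ⟨x, hx1, hx2⟩ := vi H cH
  have hyb : ∀ i, |yh x i| ≤ 1 := by
    intro i
    rw [abs_le]
    exact ⟨le_max_left _ _, max_le (by norm_num) (min_le_left _ _)⟩
  have hub : ∀ i, |u x i| ≤ N := by
    intro i
    simp only [u]
    rw [abs_mul, abs_of_pos hNp]
    have := hyb i
    nlinarith
  obtain ⟨v1, hv1⟩ := exists_big hub
  rw [← hM] at hv1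
  have hMp : 0 < M := by
    have h1 := ww_nonneg v1.1 (u x)
    by_contra h
    push Not at h
    nlinarith
  have hnorm : ‖(fun i : Fin n => x i.succ)‖ ≤ 1 := by
    rw [pi_norm_le_iff_of_nonneg zero_le_one]
    intro i
    rw [Real.norm_eq_abs, abs_le]
    exact hx1 i.succ
  have hs0 : 0 ≤ s x := le_max_left _ _
  have hs1 : s x ≤ 1 := max_le zero_le_one (by linarith)
  have hl : ∀ v, 0 ≤ l x v ∧ l x v ≤ L := by
    intro v
    refine ⟨le_min hLp.le ?_, min_le_left _ _⟩
    have := ww_nonneg v.1 (u x)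
    have : 0 ≤ x 0 + 1 := by linarith [(hx1 0).1]
    positivity
  have ha : ∀ v, 0 ≤ a x v ∧ a x v ≤ L := by
    intro v
    have h1 := hp0 v
    have h2 := hpL v
    refine ⟨mul_nonneg hs0 h1, ?_⟩
    simp only [a]
    nlinarith
  have hK0 : (μ 0).real (K x) = lam := by
    have h0 := hx2 0
    simp only [H, Fin.cons_zero] at h0
    rcases lt_trichotomy ((μ 0).real (K x)) lam with h | h | h
    · have hx : x 0 = 1 := h0.1 (by linarith)
      have : K x = Set.univ := by
        apply Set.eq_univ_of_univ_subset
        refine subset_trans ?_ (Set.subset_iUnion _ v1)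
        rw [arc_full]
        have : l x v1 = L := by
          simp only [l]
          apply min_eq_left
          rw [hx]
          nlinarith
        linarith
      rw [this] at h
      simp at h
      linarith
    · exact h
    · have hx : x 0 = -1 := h0.2 (by linarith)
      have : K x = ∅ := by
        simp only [K]
        rw [Set.iUnion_eq_empty]
        intro v
        apply arc_empty
        have : l x v ≤ 0 := by
          simp only [l]
          refine (min_le_right _ _).trans ?_
          rw [hx]; simp
        linarith
      rw [this] at h
      simp at h
      linarith
  have hgex : ∃ g : Fin n → box n N, K x = (⋃ j, arc L (a x (g j)) (a x (g j) + l x (g j))) ∧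
      (0 < s x → ∀ j i, |u x i - (g j).1 i| ≤ 1) := by
    rcases hs0.eq_or_lt with h | h
    · obtain ⟨v, -, hv⟩ := Finset.exists_max_image Finset.univ (l x) ⟨v1, Finset.mem_univ _⟩
      refine ⟨fun _ => v, ?_, fun h' => absurd h (ne_of_lt h')⟩
      have : Nonempty (Fin n) := ⟨⟨0, hn⟩⟩
      rw [Set.iUnion_const]
      apply subset_antisymm
      · apply Set.iUnion_subset
        intro v'
        apply Set.image_mono
        have := hv v' (Finset.mem_univ _)
        simp only [a, ← h, zero_mul]
        apply Set.Ico_subset_Ico le_rfl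
        linarith
      · exact Set.subset_iUnion (fun v => arc L (a x v) (a x v + l x v)) v
    · have : ∃ i : Fin n, 1 / 2 < |x i.succ| := by
        by_contra hcon
        push Not at hcon
        have : ‖(fun i : Fin n => x i.succ)‖ ≤ 1 / 2 := by
          rw [pi_norm_le_iff_of_nonneg (by norm_num)]
          exact hcon
        have : s x ≤ 0 := max_le le_rfl (by linarith)
        linarith
      obtain ⟨i0, hi0⟩ := this
      have : ∃ k : ℤ, u x i0 = k := by
        rcases lt_abs.1 hi0 with h | h
        · refine ⟨N, ?_⟩
          have : yh x i0 = 1 := by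
            simp only [yh]
            rw [min_eq_left (by linarith), max_eq_right (by norm_num)]
          simp [u, this]
        · refine ⟨-N, ?_⟩
          have : yh x i0 = -1 := by
            simp only [yh]
            rw [max_eq_left]
            exact (min_le_right _ _).trans (by linarith)
          simp [u, this]
      obtain ⟨k, hk⟩ := this
      obtain ⟨g, hg1, hg2⟩ := exists_g hub i0 k hk
      refine ⟨g, ?_, fun _ => hg2⟩
      apply subset_antisymm
      · apply Set.iUnion_subset
        intro v
        rcases (ww_nonneg v.1 (u x)).eq_or_lt with h | h
        · rw [arc_empty]
          · exact Set.empty_subset _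
          · have : l x v ≤ 0 := by
              simp only [l]
              refine (min_le_right _ _).trans ?_
              rw [← h]; simp
            linarith
        · obtain ⟨j, rfl⟩ := hg1 v h
          exact Set.subset_iUnion (fun j => arc L (a x (g j)) (a x (g j) + l x (g j))) j
      · apply Set.iUnion_subset
        intro j
        exact Set.subset_iUnion (fun v => arc L (a x v) (a x v + l x v)) (g j)
  obtain ⟨g, hg1, hg2⟩ := hgex
  refine ⟨fun j => a x (g j), fun j => l x (g j), fun j => ha _, fun j => hl _, ?_⟩
  rw [← hg1]
  have hbnd : (0 : ℝ) ≤ n * (n / N) := by positivity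
  -- the differences
  have hh : ∀ i : Fin n, |(μ i.succ).real (K x) - (μ 0).real (K x)| ≤ n * (n / N) := by
    intro i
    by_contra hcon
    push Not at hcon
    have hv : ∀ j : Fin n, ((μ j.succ).real (K x) - (μ 0).real (K x) < 0 → x j.succ = 1) ∧
        (0 < (μ j.succ).real (K x) - (μ 0).real (K x) → x j.succ = -1) := by
      intro j
      have := hx2 j.succ
      simpa only [H, Fin.cons_succ] using this
    have hne : (μ i.succ).real (K x) - (μ 0).real (K x) ≠ 0 := by
      intro h0
      rw [h0, abs_zero] at hcon
      linarith
    have hxi : |x i.succ| = 1 := by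
      rcases lt_or_gt_of_ne hne with h | h
      · rw [(hv i).1 h]; simp
      · rw [(hv i).2 h]; simp
    have hsx : s x = 1 := by
      apply le_antisymm hs1
      have := norm_le_pi_norm (fun i : Fin n => x i.succ) i
      rw [Real.norm_eq_abs, hxi] at this
      exact le_max_of_le_right (by linarith)
    have hclose := hg2 (by rw [hsx]; exact one_pos)
    have hstart : ∀ j e, -((n : ℝ) / N) ≤ nu μ (yh x) (arc L (a x (g j)) e) := by
      intro j e
      have e1 := hpg (g j) e
      have e2 := nu_diff μ (yh x) (fun i => ((g j).1 i : ℝ) / N) (1 / N) (by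
        intro i
        have h1 := hclose j i
        have : yh x i - ((g j).1 i : ℝ) / N = (u x i - (g j).1 i) / N := by
          simp only [u]; field_simp
        rw [this, abs_div, abs_of_pos hNp]
        gcongr) (arc L (p (g j)) e)
      have e3 : a x (g j) = p (g j) := by simp only [a]; rw [hsx, one_mul]
      rw [e3]
      have e4 : (n : ℝ) * (1 / N) = n / N := by ring
      linarith
    have hmerge := nu_merge μ (yh x) (n / N) (by positivity) n
      (Finset.univ.image (fun j => (a x (g j), a x (g j) + l x (g j))))
      (Finset.card_image_le.trans (by simp)) (by
        intro q hq e
        rw [Finset.mem_image] at hq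
        obtain ⟨j, -, rfl⟩ := hq
        exact hstart j e)
    have hKu : (⋃ q ∈ Finset.univ.image (fun j => (a x (g j), a x (g j) + l x (g j))), arc L q.1 q.2) = K x := by
      rw [hg1]
      ext z
      simp only [Set.mem_iUnion, Finset.mem_image, Finset.mem_univ, true_and, exists_prop]
      constructor
      · rintro ⟨q, ⟨j, rfl⟩, hz⟩
        exact ⟨j, hz⟩
      · rintro ⟨j, hz⟩
        exact ⟨_, ⟨j, rfl⟩, hz⟩
    rw [hKu] at hmerge
    have hsum : nu μ (yh x) (K x) ≤ ∑ j : Fin n, -|(μ j.succ).real (K x) - (μ 0).real (K x)| := by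
      unfold nu
      apply Finset.sum_le_sum
      intro j _
      rcases lt_trichotomy ((μ j.succ).real (K x) - (μ 0).real (K x)) 0 with h | h | h
      · have e : yh x j = 1 := by
          simp only [yh]; rw [(hv j).1 h]; norm_num
        rw [e, abs_of_neg h]; linarith
      · rw [h]; simp
      · have e : yh x j = -1 := by
          simp only [yh]; rw [(hv j).2 h]; norm_num
        rw [e, abs_of_pos h]; linarith
    rw [Finset.sum_neg_distrib] at hsum
    have := Finset.single_le_sum (f := fun j : Fin n => |(μ j.succ).real (K x) - (μ 0).real (K x)|)
      (fun j _ => abs_nonneg _) (Finset.mem_univ i)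
    linarith
  intro i
  refine Fin.cases ?_ (fun i => ?_) i
  · rw [hK0]; simpa using hbnd
  · have := hh i
    rwa [hK0] at this

lemma exact_sol (hn : 0 < n) (hna : ∀ i x, μ i {x} = 0) (lam : ℝ) (hl0 : 0 ≤ lam) (hl1 : lam ≤ 1) :
    ∃ a b : Fin n → ℝ, ∀ i, (μ i).real (⋃ j, arc L (a j) (b j)) = lam := by
  have hLp := hL.out
  let F : (Fin n → ℝ) × (Fin n → ℝ) → ℝ := fun q =>
    ∑ i, |(μ i).real (⋃ j, arc L (q.1 j) (q.1 j + q.2 j)) - lam|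
  have hF : Continuous F := by
    have : ∀ i, Continuous (fun q : (Fin n → ℝ) × (Fin n → ℝ) =>
        (μ i).real (⋃ j, arc L (q.1 j) (q.1 j + q.2 j))) := by
      intro i
      have h2 : Continuous (fun q : (Fin n → ℝ) × (Fin n → ℝ) => (q.1, fun j => q.1 j + q.2 j)) := by
        fun_prop
      exact (theta_cont (μ i) (hna i) (V := Fin n)).comp h2
    fun_prop
  let B : Set (Fin n → ℝ) := Set.Icc (fun _ => 0) (fun _ => L)
  have hB : IsCompact (B ×ˢ B) := isCompact_Icc.prod isCompact_Icc
  obtain ⟨q, hq, hmin⟩ := hB.exists_isMinOn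
    ⟨((fun _ => 0), (fun _ => 0)), ⟨⟨fun _ => le_rfl, fun _ => hLp.le⟩, ⟨fun _ => le_rfl, fun _ => hLp.le⟩⟩⟩
    hF.continuousOn
  refine ⟨q.1, fun j => q.1 j + q.2 j, ?_⟩
  have h0 : F q ≤ 0 := by
    apply le_of_forall_pos_le_add
    intro ε hε
    obtain ⟨N, hN⟩ := exists_nat_gt ((n + 1) * (n * n) / ε)
    have hN0 : (0 : ℝ) < N := lt_of_le_of_lt (by positivity) hN
    obtain ⟨a, l, ha, hl, hal⟩ := approx μ hn hna lam hl0 hl1 N (by exact_mod_cast hN0)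
    have h1 : F q ≤ F (a, l) := hmin ⟨⟨fun j => (ha j).1, fun j => (ha j).2⟩, ⟨fun j => (hl j).1, fun j => (hl j).2⟩⟩
    have h2 : F (a, l) ≤ ∑ i : Fin (n + 1), ((n : ℝ) * (n / N)) := Finset.sum_le_sum (fun i _ => hal i)
    simp only [Finset.sum_const, Finset.card_univ, Fintype.card_fin, nsmul_eq_mul] at h2
    have h3 : ((n + 1 : ℕ) : ℝ) * ((n : ℝ) * (n / N)) ≤ ε := by
      rw [div_lt_iff₀ hε] at hN
      have : ((n + 1 : ℕ) : ℝ) * ((n : ℝ) * (n / N)) = (n + 1) * (n * n) / N := by push_cast; ring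
      rw [this, div_le_iff₀ hN0]
      linarith
    linarith
  intro i
  have h1 := Finset.single_le_sum (f := fun i => |(μ i).real (⋃ j, arc L (q.1 j) (q.1 j + q.2 j)) - lam|)
    (fun j _ => abs_nonneg _) (Finset.mem_univ i)
  have h2 : |(μ i).real (⋃ j, arc L (q.1 j) (q.1 j + q.2 j)) - lam| ≤ 0 := h1.trans h0
  have := abs_nonpos_iff.1 h2
  linarith
end Main
end SW

/-- Stromquist–Woodall: dividing non-atomic probability measures on a circle
by a union of at most `d - 1` arcs. -/
theorem stmt10 (L : ℝ) (hL : 0 < L) (d : ℕ) (hd : 2 ≤ d)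
    (μ : Fin d → Measure (AddCircle L))
    (hprob : ∀ i, IsProbabilityMeasure (μ i))
    (hna : ∀ i, ∀ x : AddCircle L, μ i {x} = 0)
    (lam : ℝ) (hlam0 : 0 ≤ lam) (hlam1 : lam ≤ 1) :
    ∃ K : Set (AddCircle L),
      (∃ m : ℕ, m ≤ d - 1 ∧ ∃ a b : Fin m → ℝ,
        K = ⋃ j : Fin m, (fun x : ℝ => (x : AddCircle L)) '' Set.Icc (a j) (b j)) ∧
      ∀ i, μ i K = ENNReal.ofReal lam := by
  haveI : Fact (0 < L) := ⟨hL⟩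
  obtain ⟨n, rfl⟩ : ∃ n, d = n + 1 := ⟨d - 1, by omega⟩
  obtain ⟨a, b, h⟩ := SW.exact_sol μ (by omega) hna lam hlam0 hlam1
  refine ⟨_, ⟨n, by omega, a, b, rfl⟩, fun i => ?_⟩
  rw [SW.icc_eq (μ i) (hna i) a b, ← h i, ofReal_measureReal]
end
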